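/- Let (T_τ)_{τ∈ℝ} be an ergodic flow of measure-preserving transformations on a σ-finite measure space (X,μ) with ℓ = μ(X), and let f ∈ L¹(X,μ). Then there is an absolute constant c > 0 such that the non-increasing rearrangement of the ergodic Hilbert transform Hf(x) = lim_{δ→0+} ∫_{δ ≤ |τ| ≤ 1/δ} f(T_τ x)/τ dτ satisfies (Hf)*(t) ≤ c ( (1/t)∫₀ᵗ f*(s) ds + ∫ₜ^ℓ f*(s)/s ds ) for all 0 < t < ℓ. -/

import Mathlib

open MeasureTheory Filter Set Metric
open scoped ENNReal NNReal Topology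

noncomputable section

/-- The non-increasing rearrangement `f*` of `f` with respect to the measure `μ`:
`f*(t) = sup { s ≥ 0 : μ{|f| > s} > t }`. -/
def rearrange {α : Type*} [MeasurableSpace α] (μ : Measure α) (f : α → ℝ) (t : ℝ) : ℝ :=
  sSup {s : ℝ | 0 ≤ s ∧ ENNReal.ofReal t < μ {x | s < |f x|}}

/-- The maximal function of the rearrangement: `f**(t) = (1/t) ∫₀ᵗ f*(s) ds`. -/
def doubleStar {α : Type*} [MeasurableSpace α] (μ : Measure α) (f : α → ℝ) (t : ℝ) : ℝ :=
  (1 / t) * ∫ s in Ioo (0 : ℝ) t, rearrange μ f s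

/-- The Luxemburg norm of `g` in the variable exponent Lebesgue space `L^{q(·)}([0,ℓ])`. -/
def luxNorm (ℓ : ℝ≥0∞) (q : ℝ → ℝ) (g : ℝ → ℝ) : ℝ≥0∞ :=
  sInf {lam : ℝ≥0∞ | 0 < lam ∧
    (∫⁻ t in {t : ℝ | 0 < t ∧ ENNReal.ofReal t < ℓ},
      (ENNReal.ofReal |g t| / lam) ^ q t) ≤ 1}

/-- The class `P([0,ℓ])`: bounded measurable exponents with limits `p0` at `0` and
(if `ℓ = ∞`) `pinf` at `∞`, satisfying log-decay conditions at `0` and at `∞`. -/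
structure ClassP (ℓ : ℝ≥0∞) (p : ℝ → ℝ) (p0 pinf : ℝ) : Prop where
  measurable : Measurable p
  bounded : ∃ M : ℝ, ∀ t : ℝ, 0 ≤ t → ENNReal.ofReal t ≤ ℓ → |p t| ≤ M
  lim_zero : Tendsto p (nhdsWithin 0 (Ioi 0)) (nhds p0)
  decay_zero : ∃ C > 0, ∀ t : ℝ, 0 < t → t ≤ 1 / 2 → |p t - p0| ≤ C / Real.log (1 / t)
  lim_infty : ℓ = ∞ → Tendsto p atTop (nhds pinf)
  decay_infty : ℓ = ∞ → ∃ C > 0, ∀ t : ℝ, 0 ≤ t → |p t - pinf| ≤ C / Real.log (Real.exp 1 + t)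

/-- The class `P_a([0,ℓ]) = P([0,ℓ]) ∩ {p : a < p₋ ≤ p₊ < ∞}`. -/
def ClassPa (a : ℝ) (ℓ : ℝ≥0∞) (p : ℝ → ℝ) (p0 pinf : ℝ) : Prop :=
  ClassP ℓ p p0 pinf ∧
    ∃ pm pM : ℝ, a < pm ∧ ∀ t : ℝ, 0 ≤ t → ENNReal.ofReal t ≤ ℓ → pm ≤ p t ∧ p t ≤ pM

/-- The variable exponent Lorentz norm `‖f‖_{L^{p(·),q(·)}(Ω)}`. -/
def lorentzNorm {α : Type*} [MeasurableSpace α] (μ : Measure α) (p q : ℝ → ℝ)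
    (f : α → ℝ) : ℝ≥0∞ :=
  luxNorm (μ univ) q fun t => t ^ (1 / p t - 1 / q t) * rearrange μ f t

/-- The variable exponent Lorentz norm `‖f‖¹_{L^{p(·),q(·)}(Ω)}` defined via `f**`. -/
def lorentzNorm1 {α : Type*} [MeasurableSpace α] (μ : Measure α) (p q : ℝ → ℝ)
    (f : α → ℝ) : ℝ≥0∞ :=
  luxNorm (μ univ) q fun t => t ^ (1 / p t - 1 / q t) * doubleStar μ f t

/-- The weighted variable exponent Lorentz norm `‖f‖_{L^{p(·),q(·)}_w(Ω)}`. -/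
def wLorentzNorm {α : Type*} [MeasurableSpace α] (μ : Measure α) (w p q : ℝ → ℝ)
    (f : α → ℝ) : ℝ≥0∞ :=
  luxNorm (μ univ) q fun t => w t * t ^ (1 / p t - 1 / q t) * rearrange μ f t

/-- The weighted variable exponent Lorentz norm `‖f‖¹_{L^{p(·),q(·)}_w(Ω)}` via `f**`. -/
def wLorentzNorm1 {α : Type*} [MeasurableSpace α] (μ : Measure α) (w p q : ℝ → ℝ)
    (f : α → ℝ) : ℝ≥0∞ :=
  luxNorm (μ univ) q fun t => w t * t ^ (1 / p t - 1 / q t) * doubleStar μ f t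

/-- An ergodic flow `(T_τ)_{τ∈ℝ}` of measure preserving transformations on `(X,μ)`. -/
structure ErgodicFlow (X : Type*) [MeasurableSpace X] (μ : Measure X)
    (T : ℝ → X → X) : Prop where
  measurable : Measurable fun p : ℝ × X => T p.1 p.2
  preserving : ∀ τ : ℝ, MeasurePreserving (T τ) μ μ
  map_zero : ∀ x, T 0 x = x
  map_add : ∀ s t x, T (s + t) x = T s (T t x)
  ergodic : ∀ A : Set X, MeasurableSet A → (∀ τ, T τ ⁻¹' A = A) → μ A = 0 ∨ μ Aᶜ = 0

/-- The ergodic maximal function `Mf(x) = sup_{a>0} (1/a)∫₀^a |f(T_τ x)| dτ`. -/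
def ergMax {X : Type*} (T : ℝ → X → X) (f : X → ℝ) (x : X) : ℝ :=
  ⨆ a : {a : ℝ // 0 < a}, (1 / (a : ℝ)) * ∫ τ in Ioo (0 : ℝ) (a : ℝ), |f (T τ x)|

/-- The ergodic Hilbert transform
`Hf(x) = lim_{δ→0+} ∫_{δ ≤ |τ| ≤ 1/δ} f(T_τ x)/τ dτ`. -/
def ergHilbert {X : Type*} (T : ℝ → X → X) (f : X → ℝ) (x : X) : ℝ :=
  limUnder (nhdsWithin (0 : ℝ) (Ioi 0)) fun δ =>
    ∫ τ in {τ : ℝ | δ ≤ |τ| ∧ |τ| ≤ 1 / δ}, f (T τ x) / τ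


lemma boole_root {n : ℕ} (a m : Fin n → ℝ) (ha : StrictMono a) (hm : ∀ i, 0 < m i) {l : ℝ}
    (hl : 0 < l) (i : Fin n) :
    ∃ b, b < a i ∧ (∀ j, j < i → a j < b) ∧ ∑ j, m j / (a j - b) = l := by
  classical
  set M := ∑ j, m j with hM
  have hMpos : 0 < M := Finset.sum_pos (fun j _ => hm j) ⟨i, Finset.mem_univ i⟩
  let φ : ℝ → ℝ := fun y => l * (y - a i) + m i +
    ∑ j ∈ Finset.univ.erase i, m j * ((y - a i) / (y - a j))
  -- bound
  have hbd : ∀ y, y < a i → (∀ j, j < i → a j < y) → ∀ j ∈ Finset.univ.erase i,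
      m j * ((y - a i) / (y - a j)) ≤ m j := by
    intro y hy hj j hjm
    have hne : j ≠ i := by simpa using hjm
    have : (y - a i) / (y - a j) ≤ 1 := by
      rcases lt_or_gt_of_ne hne with h | h
      · have := hj j h
        apply le_trans (div_nonpos_of_nonpos_of_nonneg (by linarith) (by linarith)) (by norm_num)
      · have h2 := ha h
        rw [div_le_one_of_neg (by linarith)]; linarith
    nlinarith [hm j]
  -- starting point
  have hstart : ∃ y, y < a i ∧ (∀ j, j < i → a j < y) ∧ φ y ≤ 0 := by
    by_cases h0 : ∃ p : Fin n, p < i ∧ ∀ j, j < i → j ≤ p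
    · obtain ⟨p, hpi, hp⟩ := h0
      have hd : 0 < a i - a p := by linarith [ha hpi]
      have hmp := hm p
      set e := (m p / (M + m p)) * (a i - a p) with he
      have hr : m p / (M + m p) < 1 := by rw [div_lt_one (by linarith)]; linarith
      have hr0 : 0 < m p / (M + m p) := by positivity
      have hepos : 0 < e := by positivity
      have he2 : e < a i - a p := by nlinarith
      refine ⟨a p + e, by linarith, ?_, ?_⟩
      · intro j hj
        have := ha.monotone (hp j hj)
        linarith
      · have hy1 : a p + e < a i := by linarith
        have hy2 : ∀ j, j < i → a j < a p + e := by
          intro j hj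
          have := ha.monotone (hp j hj)
          linarith
        have hb := hbd _ hy1 hy2
        have hpm : p ∈ Finset.univ.erase i := by simp [hpi.ne]
        have hs : ∑ j ∈ Finset.univ.erase i, m j * ((a p + e - a i) / (a p + e - a j))
            ≤ ∑ j ∈ (Finset.univ.erase i).erase p, m j + m p * ((a p + e - a i) / (a p + e - a p)) := by
          rw [← Finset.sum_erase_add _ _ hpm]
          gcongr with j hj
          exact hb j (Finset.mem_of_mem_erase hj)
        have hsum : M = ∑ j ∈ (Finset.univ.erase i).erase p, m j + m p + m i := by
          rw [Finset.sum_erase_add _ _ hpm, Finset.sum_erase_add _ _ (Finset.mem_univ i)]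
        have hval : m p * ((a p + e - a i) / (a p + e - a p)) = - M := by
          have : a p + e - a p = e := by ring
          rw [this, he]
          have h1 : a i - a p ≠ 0 := hd.ne'
          have h2 : M + m p ≠ 0 := by positivity
          field_simp
          ring
        simp only [φ]
        nlinarith
    · have hno : ∀ j, ¬ j < i := by
        intro j hj
        apply h0
        have hne : (Finset.univ.filter (fun j : Fin n => j < i)).Nonempty := ⟨j, by simpa using hj⟩
        refine ⟨(Finset.univ.filter (fun j : Fin n => j < i)).max' hne, ?_, ?_⟩
        · have := Finset.max'_mem _ hne
          simpa using this
        · intro k hk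
          apply Finset.le_max'
          simpa using hk
      have hlt : a i - M / l < a i := by
        have : 0 < M / l := by positivity
        linarith
      refine ⟨a i - M / l, hlt, fun j hj => absurd hj (hno j), ?_⟩
      have hb := hbd _ hlt (fun j hj => absurd hj (hno j))
      have hs := Finset.sum_le_sum hb
      have hsum : M = ∑ j ∈ Finset.univ.erase i, m j + m i := by
        rw [Finset.sum_erase_add _ _ (Finset.mem_univ i)]
      have : l * (a i - M / l - a i) = - M := by field_simp; ring
      simp only [φ]
      linarith
  obtain ⟨y, hy, hyj, hφ⟩ := hstart
  have hne : ∀ z, y ≤ z → z ≤ a i → ∀ j ∈ Finset.univ.erase i, z - a j ≠ 0 := by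
    intro z hz1 hz2 j hjm
    have hne : j ≠ i := by simpa using hjm
    rcases lt_or_gt_of_ne hne with h | h
    · have := hyj j h
      have : 0 < z - a j := by linarith
      exact this.ne'
    · have h2 := ha h
      have : z - a j < 0 := by linarith
      exact this.ne
  have hcont : ContinuousOn φ (Icc y (a i)) := by
    refine ContinuousOn.add (by fun_prop) ?_
    refine continuousOn_finsetSum _ fun j hj => ?_
    refine ContinuousOn.mul (by fun_prop) (ContinuousOn.div (by fun_prop) (by fun_prop) ?_)
    intro z hz
    exact hne z hz.1 hz.2 j hj
  have hφa : φ (a i) = m i := by simp [φ]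
  obtain ⟨b, hb, hb0⟩ := intermediate_value_Icc hy.le hcont ⟨hφ, by rw [hφa]; exact (hm i).le⟩
  have hbne : b ≠ a i := by
    rintro rfl
    rw [hφa] at hb0
    exact (hm i).ne' hb0
  have hblt : b < a i := lt_of_le_of_ne hb.2 hbne
  refine ⟨b, hblt, fun j hj => lt_of_lt_of_le (hyj j hj) hb.1, ?_⟩
  rw [← Finset.sum_erase_add _ _ (Finset.mem_univ i)]
  have hbi : b - a i ≠ 0 := by intro h; apply hbne; linarith
  have hE : ∑ j ∈ Finset.univ.erase i, m j * ((b - a i) / (b - a j))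
      = -(b - a i) * ∑ j ∈ Finset.univ.erase i, m j / (a j - b) := by
    rw [Finset.mul_sum]
    refine Finset.sum_congr rfl fun j hj => ?_
    have h1 := hne b hb.1 hb.2 j hj
    have h2 : a j - b ≠ 0 := by intro h; apply h1; linarith
    field_simp
    ring
  have hm2 : m i / (a i - b) = - m i / (b - a i) := by
    rw [← neg_sub b (a i), div_neg, neg_div]
  simp only [φ] at hb0
  rw [hE] at hb0
  rw [hm2]
  have : (b - a i) * (∑ j ∈ Finset.univ.erase i, m j / (a j - b) + - m i / (b - a i) - l) = 0 := by
    field_simp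
    linarith
  rcases mul_eq_zero.1 this with h | h
  · exact absurd h hbi
  · linarith

open Polynomial in
lemma boole_vieta {n : ℕ} (a m b : Fin n → ℝ) (hn : 0 < n) {l : ℝ} (hl : 0 < l)
    (hb : Function.Injective b) (hab : ∀ i j, b i ≠ a j)
    (hr : ∀ i, ∑ j, m j / (a j - b i) = l) :
    (∀ y, (∀ j, y ≠ a j) →
      (l - ∑ j, m j / (a j - y)) * ∏ j, (y - a j) = l * ∏ j, (y - b j)) ∧
    ∑ j, (a j - b j) = (∑ j, m j) / l := by
  classical
  let P : ℝ[X] := C l * ∏ j, (X - C (a j)) + ∑ i, C (m i) * ∏ j ∈ Finset.univ.erase i, (X - C (a j))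
  let Q : ℝ[X] := C l * ∏ j, (X - C (b j))
  have hPe : ∀ y, (∀ j, y ≠ a j) → P.eval y = (l - ∑ j, m j / (a j - y)) * ∏ j, (y - a j) := by
    intro y hy
    simp only [P, eval_add, eval_mul, eval_C, eval_finsetSum, eval_prod, eval_sub, eval_X]
    rw [sub_mul, Finset.sum_mul, sub_eq_add_neg, ← Finset.sum_neg_distrib]
    congr 1
    refine Finset.sum_congr rfl fun i _ => ?_
    rw [← Finset.mul_prod_erase _ _ (Finset.mem_univ i)]
    have h1 : a i - y ≠ 0 := sub_ne_zero.2 (hy i).symm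
    field_simp
    ring
  have hdegA : (∏ j, (X - C (a j))).Monic := monic_prod_of_monic _ _ fun i _ => monic_X_sub_C _
  have hcard : (Finset.univ : Finset (Fin n)).card = n := by simp
  have hPQ : P = Q := by
    rw [← sub_eq_zero]
    apply Polynomial.eq_zero_of_degree_lt_of_eval_finset_eq_zero (Finset.univ.image b)
    · rw [Finset.card_image_of_injective _ hb, hcard]
      have e : P - Q = C l * (∏ j, (X - C (a j)) - ∏ j, (X - C (b j))) +
          ∑ i, C (m i) * ∏ j ∈ Finset.univ.erase i, (X - C (a j)) := by
        simp only [P, Q]; ring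
      rw [e]
      have hda : (∏ j, (X - C (a j))).degree = (n : WithBot ℕ) := by
        rw [degree_prod]; simp
      have hdb : (∏ j, (X - C (b j))).degree = (n : WithBot ℕ) := by
        rw [degree_prod]; simp
      refine lt_of_le_of_lt (degree_add_le _ _) (max_lt ?_ ?_)
      · refine lt_of_le_of_lt ((degree_mul_le _ _).trans (add_le_of_nonpos_left degree_C_le)) ?_
        rw [← hda]
        refine degree_sub_lt (by rw [hda, hdb]) hdegA.ne_zero ?_
        rw [hdegA.leadingCoeff, (monic_prod_of_monic _ _ fun i _ => monic_X_sub_C _).leadingCoeff]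
      · refine lt_of_le_of_lt (degree_sum_le _ _) ?_
        rw [Finset.sup_lt_iff (by simp)]
        intro i _
        refine lt_of_le_of_lt ((degree_mul_le _ _).trans (add_le_of_nonpos_left degree_C_le)) ?_
        rw [degree_prod]
        simp only [degree_X_sub_C, Finset.sum_const, nsmul_eq_mul, mul_one]
        rw [Finset.card_erase_of_mem (Finset.mem_univ i), hcard]
        exact_mod_cast Nat.sub_lt hn one_pos
    · intro y hy
      obtain ⟨i, -, rfl⟩ := Finset.mem_image.1 hy
      rw [eval_sub, hPe _ (hab i), hr i]
      simp only [Q, eval_mul, eval_C, eval_prod, eval_sub, eval_X]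
      have hz : ∏ j, (b i - b j) = 0 := Finset.prod_eq_zero (Finset.mem_univ i) (sub_self _)
      rw [hz]
      ring
  constructor
  · intro y hy
    rw [← hPe y hy, hPQ]
    simp [Q, eval_prod]
  · have hc := congrArg (fun p => coeff p (n - 1)) hPQ
    have h1 : ∀ c : Fin n → ℝ, (∏ j, (X - C (c j))).coeff (n - 1) = - ∑ j, c j := by
      intro c
      have := Polynomial.prod_X_sub_C_coeff_card_pred (Finset.univ : Finset (Fin n)) c (by simpa using hn)
      rwa [hcard] at this
    have h2 : ∀ i, (∏ j ∈ Finset.univ.erase i, (X - C (a j))).coeff (n - 1) = 1 := by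
      intro i
      have hmon : (∏ j ∈ Finset.univ.erase i, (X - C (a j))).Monic :=
        monic_prod_of_monic _ _ fun i _ => monic_X_sub_C _
      have hd : (∏ j ∈ Finset.univ.erase i, (X - C (a j))).natDegree = n - 1 := by
        rw [natDegree_prod_of_monic _ _ fun i _ => monic_X_sub_C _]
        simp
      rw [← hd]
      exact hmon
    simp only [P, Q, coeff_add, coeff_C_mul, finsetSum_coeff, h1, h2, mul_one] at hc
    rw [Finset.sum_sub_distrib, eq_div_iff hl.ne']
    linarith

lemma boole {n : ℕ} (a m : Fin n → ℝ) (ha : StrictMono a) (hm : ∀ i, 0 < m i) {l : ℝ}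
    (hl : 0 < l) :
    volume {y : ℝ | l < ∑ j, m j / (a j - y)} ≤ ENNReal.ofReal ((∑ j, m j) / l) := by
  classical
  rcases Nat.eq_zero_or_pos n with h0 | hn
  · subst h0
    have : {y : ℝ | l < ∑ j, m j / (a j - y)} = ∅ := by
      ext y; simp [hl.le]
    rw [this]; simp
  choose b hb1 hb2 hb3 using boole_root a m ha hm hl
  have hbinj : Function.Injective b := by
    have : StrictMono b := fun i j hij => lt_trans (hb1 i) (hb2 j i hij)
    exact this.injective
  have hab : ∀ i j, b i ≠ a j := by
    intro i j
    rcases lt_or_ge j i with h | h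
    · exact (hb2 i j h).ne'
    · exact (lt_of_lt_of_le (hb1 i) (ha.monotone h)).ne
  obtain ⟨h1, h2⟩ := boole_vieta a m b hn hl hbinj hab hb3
  have hsub : {y : ℝ | l < ∑ j, m j / (a j - y)} ⊆ (Set.range a) ∪ ⋃ i, Ioo (b i) (a i) := by
    intro y hy
    by_cases hya : ∃ j, y = a j
    · obtain ⟨j, rfl⟩ := hya
      left; exact ⟨j, rfl⟩
    · push Not at hya
      right
      by_contra hcon
      simp only [mem_iUnion, not_exists, mem_Ioo, not_and, not_lt] at hcon
      have hpos : ∀ i, 0 ≤ (y - b i) * (y - a i) := by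
        intro i
        rcases le_or_gt y (b i) with h | h
        · exact mul_nonneg_of_nonpos_of_nonpos (by linarith) (by linarith [hb1 i])
        · exact mul_nonneg (by linarith) (by linarith [hcon i h])
      have hp := Finset.prod_nonneg (fun i (_ : i ∈ Finset.univ) => hpos i)
      rw [Finset.prod_mul_distrib] at hp
      have h3 := h1 y hya
      have hA : (∏ j, (y - a j)) ≠ 0 := Finset.prod_ne_zero_iff.2 fun j _ => sub_ne_zero.2 (hya j)
      have hy' : l - ∑ j, m j / (a j - y) < 0 := by
        have : l < ∑ j, m j / (a j - y) := hy
        linarith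
      have : 0 < (∏ j, (y - a j)) ^ 2 := by positivity
      have h4 : l * ((∏ j, (y - b j)) * ∏ j, (y - a j)) =
        (l - ∑ j, m j / (a j - y)) * (∏ j, (y - a j)) ^ 2 := by
        rw [← mul_assoc, ← h3]; ring
      nlinarith
  calc volume {y : ℝ | l < ∑ j, m j / (a j - y)} ≤ volume ((Set.range a) ∪ ⋃ i, Ioo (b i) (a i)) :=
        measure_mono hsub
    _ ≤ volume (Set.range a) + volume (⋃ i, Ioo (b i) (a i)) := measure_union_le _ _
    _ ≤ 0 + ∑ i, ENNReal.ofReal (a i - b i) := by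
        gcongr
        · rw [(Set.finite_range a).measure_zero]
        · refine (measure_iUnion_fintype_le _ _).trans ?_
          simp [Real.volume_Ioo]
    _ = ENNReal.ofReal ((∑ j, m j) / l) := by
        rw [zero_add, ← h2, ENNReal.ofReal_sum_of_nonneg]
        intro i _
        linarith [hb1 i]

lemma boole_finset (S : Finset ℤ) (c : ℤ → ℝ) (hc : ∀ k ∈ S, 0 ≤ c k) {l : ℝ} (hl : 0 < l) :
    volume {y : ℝ | l < ∑ k ∈ S, c k / ((k : ℝ) - y)} ≤ ENNReal.ofReal ((∑ k ∈ S, c k) / l) := by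
  classical
  set S' := S.filter (fun k => 0 < c k) with hS'
  have e1 : ∀ (F : ℤ → ℝ), ∑ k ∈ S, c k * F k = ∑ k ∈ S', c k * F k := by
    intro F
    rw [hS', Finset.sum_filter]
    refine Finset.sum_congr rfl fun k hk => ?_
    split_ifs with h
    · rfl
    · have : c k = 0 := le_antisymm (not_lt.1 h) (hc k hk)
      simp [this]
  have e2 : ∀ (F : ℤ → ℝ), ∑ k ∈ S', c k * F k =
      ∑ i : Fin S'.card, c (S'.orderEmbOfFin rfl i) * F (S'.orderEmbOfFin rfl i) := by
    intro F
    conv_lhs => rw [← Finset.image_orderEmbOfFin_univ S' rfl]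
    rw [Finset.sum_image]
    intro x _ y _ h
    exact (S'.orderEmbOfFin rfl).injective h
  have := boole (fun i => ((S'.orderEmbOfFin rfl i : ℤ) : ℝ)) (fun i => c (S'.orderEmbOfFin rfl i))
    (fun i j hij => by
      have := (S'.orderEmbOfFin rfl).strictMono hij
      exact Int.cast_lt.2 this) (fun i => by
      have := Finset.orderEmbOfFin_mem S' rfl i
      exact (Finset.mem_filter.1 this).2) hl
  have h1 : ∑ k ∈ S, c k = ∑ i : Fin S'.card, c (S'.orderEmbOfFin rfl i) := by
    have := (e1 (fun _ => 1)).trans (e2 (fun _ => 1))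
    simpa using this
  have h2 : ∀ y : ℝ, ∑ k ∈ S, c k / ((k : ℝ) - y) = ∑ i : Fin S'.card, c (S'.orderEmbOfFin rfl i) /
      (((S'.orderEmbOfFin rfl i : ℤ) : ℝ) - y) := by
    intro y
    simp only [div_eq_mul_inv]
    exact (e1 (fun k => ((k : ℝ) - y)⁻¹)).trans (e2 (fun k => ((k : ℝ) - y)⁻¹))
  simp only [h1, h2]
  exact this

/-- discrete Hilbert transform of a finitely supported sequence -/
def dH (S : Finset ℤ) (a : ℤ → ℝ) (j : ℤ) : ℝ := ∑ k ∈ S, a k / ((k : ℝ) - j)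

lemma int_sin_aux (n : ℤ) :
    ∫ θ in (0:ℝ)..(2 * Real.pi), (Real.pi - θ) * Real.sin (n * θ) = 2 * Real.pi / n := by
  rcases eq_or_ne n 0 with rfl | hn
  · simp
  have hn' : (n : ℝ) ≠ 0 := by exact_mod_cast hn
  have hd : ∀ θ ∈ Set.uIcc (0:ℝ) (2 * Real.pi), HasDerivAt
      (fun θ : ℝ => -((Real.pi - θ) * Real.cos (n * θ)) / n - Real.sin (n * θ) / (n : ℝ) ^ 2)
      ((Real.pi - θ) * Real.sin (n * θ)) θ := by
    intro θ _
    have h1 : HasDerivAt (fun θ : ℝ => (n : ℝ) * θ) n θ := by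
      simpa using (hasDerivAt_id θ).const_mul (n : ℝ)
    have h2 := h1.cos
    have h3 := h1.sin
    have h4 : HasDerivAt (fun θ : ℝ => Real.pi - θ) (-1) θ := by
      simpa using (hasDerivAt_id θ).const_sub Real.pi
    refine HasDerivAt.congr_deriv
      (((h4.mul h2).neg.div_const (n : ℝ)).sub (h3.div_const ((n : ℝ) ^ 2))) ?_
    field_simp
    ring
  rw [intervalIntegral.integral_eq_sub_of_hasDerivAt hd
    (Continuous.intervalIntegrable (by fun_prop) _ _)]
  have hc : Real.cos (n * (2 * Real.pi)) = 1 := Real.cos_int_mul_two_pi n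
  have hs : Real.sin (n * (2 * Real.pi)) = 0 := by
    rw [show (n : ℝ) * (2 * Real.pi) = ((2 * n : ℤ) : ℝ) * Real.pi by push_cast; ring]
    exact Real.sin_int_mul_pi _
  rw [hc, hs]
  simp
  ring

lemma int_cos_aux (n : ℤ) :
    ∫ θ in (0:ℝ)..(2 * Real.pi), Real.cos (n * θ) = if n = 0 then 2 * Real.pi else 0 := by
  split_ifs with hn
  · subst hn; simp
  have hn' : (n : ℝ) ≠ 0 := by exact_mod_cast hn
  rw [intervalIntegral.integral_comp_mul_left (fun x => Real.cos x) hn', integral_cos]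
  have hs : Real.sin (n * (2 * Real.pi)) = 0 := by
    rw [show (n : ℝ) * (2 * Real.pi) = ((2 * n : ℤ) : ℝ) * Real.pi by push_cast; ring]
    exact Real.sin_int_mul_pi _
  simp [hs]

lemma parseval_aux (S : Finset ℤ) (a : ℤ → ℝ) :
    ∫ θ in (0:ℝ)..(2 * Real.pi), ((∑ k ∈ S, a k * Real.sin (k * θ)) ^ 2 +
      (∑ k ∈ S, a k * Real.cos (k * θ)) ^ 2) = 2 * Real.pi * ∑ k ∈ S, a k ^ 2 := by
  have e : ∀ θ : ℝ, ((∑ k ∈ S, a k * Real.sin (k * θ)) ^ 2 +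
      (∑ k ∈ S, a k * Real.cos (k * θ)) ^ 2) =
      ∑ k ∈ S, ∑ i ∈ S, a k * a i * Real.cos (((k - i : ℤ) : ℝ) * θ) := by
    intro θ
    rw [sq, sq, Finset.sum_mul_sum, Finset.sum_mul_sum, ← Finset.sum_add_distrib]
    refine Finset.sum_congr rfl fun k _ => ?_
    rw [← Finset.sum_add_distrib]
    refine Finset.sum_congr rfl fun i _ => ?_
    push_cast
    rw [sub_mul, Real.cos_sub]
    ring
  simp only [e]
  rw [intervalIntegral.integral_finsetSum
    (fun k _ => Continuous.intervalIntegrable (by fun_prop) _ _), Finset.mul_sum]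
  refine Finset.sum_congr rfl fun k hk => ?_
  rw [intervalIntegral.integral_finsetSum
    (fun k _ => Continuous.intervalIntegrable (by fun_prop) _ _)]
  simp only [intervalIntegral.integral_const_mul, int_cos_aux, sub_eq_zero]
  rw [Finset.sum_eq_single k]
  · simp; ring
  · intro b _ hb
    rw [if_neg (Ne.symm hb)]; simp
  · intro h; exact absurd hk h

lemma dH_l2 (S J : Finset ℤ) (a : ℤ → ℝ) :
    ∑ j ∈ J, (dH S a j) ^ 2 ≤ Real.pi ^ 2 * ∑ k ∈ S, a k ^ 2 := by
  have hpi := Real.pi_pos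
  set b := dH S a with hb
  have hB : 2 * Real.pi * ∑ j ∈ J, b j ^ 2 = ∫ θ in (0:ℝ)..(2 * Real.pi), (Real.pi - θ) *
      ((∑ k ∈ S, a k * Real.sin (k * θ)) * (∑ j ∈ J, b j * Real.cos (j * θ)) -
       (∑ k ∈ S, a k * Real.cos (k * θ)) * (∑ j ∈ J, b j * Real.sin (j * θ))) := by
    have e : ∀ θ : ℝ, (Real.pi - θ) *
      ((∑ k ∈ S, a k * Real.sin (k * θ)) * (∑ j ∈ J, b j * Real.cos (j * θ)) -
       (∑ k ∈ S, a k * Real.cos (k * θ)) * (∑ j ∈ J, b j * Real.sin (j * θ))) =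
       ∑ j ∈ J, ∑ k ∈ S, b j * a k * ((Real.pi - θ) * Real.sin (((k - j : ℤ) : ℝ) * θ)) := by
      intro θ
      rw [Finset.sum_mul_sum, Finset.sum_mul_sum, Finset.sum_comm,
        Finset.sum_comm (s := S) (t := J), ← Finset.sum_sub_distrib, Finset.mul_sum]
      refine Finset.sum_congr rfl fun j _ => ?_
      rw [← Finset.sum_sub_distrib, Finset.mul_sum]
      refine Finset.sum_congr rfl fun k _ => ?_
      push_cast
      rw [sub_mul (k : ℝ) (j : ℝ), Real.sin_sub]
      ring
    simp only [e]
    rw [intervalIntegral.integral_finsetSum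
      (fun k _ => Continuous.intervalIntegrable (by fun_prop) _ _), Finset.mul_sum]
    refine Finset.sum_congr rfl fun j hj => ?_
    rw [intervalIntegral.integral_finsetSum
      (fun k _ => Continuous.intervalIntegrable (by fun_prop) _ _)]
    simp only [intervalIntegral.integral_const_mul, int_sin_aux]
    have : b j ^ 2 = b j * ∑ k ∈ S, a k / ((k : ℝ) - j) := by rw [sq, hb]; rfl
    rw [this, Finset.mul_sum, Finset.mul_sum]
    refine Finset.sum_congr rfl fun k _ => ?_
    push_cast
    ring
  have hle : ∫ θ in (0:ℝ)..(2 * Real.pi), (Real.pi - θ) *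
      ((∑ k ∈ S, a k * Real.sin (k * θ)) * (∑ j ∈ J, b j * Real.cos (j * θ)) -
       (∑ k ∈ S, a k * Real.cos (k * θ)) * (∑ j ∈ J, b j * Real.sin (j * θ))) ≤
      ∫ θ in (0:ℝ)..(2 * Real.pi), (Real.pi ^ 2 / 2 * ((∑ k ∈ S, a k * Real.sin (k * θ)) ^ 2 +
      (∑ k ∈ S, a k * Real.cos (k * θ)) ^ 2) + 1 / 2 * ((∑ k ∈ J, b k * Real.sin (k * θ)) ^ 2 +
      (∑ k ∈ J, b k * Real.cos (k * θ)) ^ 2)) := by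
    apply intervalIntegral.integral_mono_on (by positivity)
      (Continuous.intervalIntegrable (by fun_prop) _ _)
      (Continuous.intervalIntegrable (by fun_prop) _ _)
    intro θ hθ
    generalize (∑ k ∈ S, a k * Real.sin (k * θ)) = A
    generalize (∑ k ∈ S, a k * Real.cos (k * θ)) = A'
    generalize (∑ k ∈ J, b k * Real.sin (k * θ)) = B
    generalize (∑ k ∈ J, b k * Real.cos (k * θ)) = B'
    have h : (Real.pi - θ) ^ 2 ≤ Real.pi ^ 2 := by nlinarith [hθ.1, hθ.2]
    set u := Real.pi - θ
    nlinarith [sq_nonneg (u * A - B'), sq_nonneg (u * A' + B), mul_le_mul_of_nonneg_right h (sq_nonneg A),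
      mul_le_mul_of_nonneg_right h (sq_nonneg A')]
  rw [intervalIntegral.integral_add (Continuous.intervalIntegrable (by fun_prop) _ _)
      (Continuous.intervalIntegrable (by fun_prop) _ _), intervalIntegral.integral_const_mul,
      intervalIntegral.integral_const_mul, parseval_aux, parseval_aux, ← hB] at hle
  have : Real.pi * (∑ j ∈ J, b j ^ 2) ≤ Real.pi * (Real.pi ^ 2 * ∑ k ∈ S, a k ^ 2) := by nlinarith
  exact le_of_mul_le_mul_left this hpi

lemma dH_weak_pos (S J : Finset ℤ) (a : ℤ → ℝ) (ha : ∀ k ∈ S, 0 ≤ a k) {l : ℝ} (hl : 0 < l)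
    (hJ : ∀ j ∈ J, l < dH S a j) : (J.card : ℝ) * l ≤ 16 * ∑ k ∈ S, a k := by
  classical
  set s := ∑ k ∈ S, a k with hs
  set J1 := J.filter (fun j => j ∈ S ∧ l / 8 < a j) with hJ1
  set J2 := J.filter (fun j => ¬ (j ∈ S ∧ l / 8 < a j)) with hJ2
  have hcard : (J.card : ℝ) = J1.card + J2.card := by
    rw [hJ1, hJ2]; exact_mod_cast (Finset.card_filter_add_card_filter_not _).symm
  have h1 : (J1.card : ℝ) * (l / 8) ≤ s := by
    calc (J1.card : ℝ) * (l / 8) = ∑ j ∈ J1, l / 8 := by simp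
      _ ≤ ∑ j ∈ J1, a j := Finset.sum_le_sum fun j hj => (Finset.mem_filter.1 hj).2.2.le
      _ ≤ s := Finset.sum_le_sum_of_subset_of_nonneg (fun j hj => (Finset.mem_filter.1 hj).2.1)
          fun j hj _ => ha j hj
  have h2 : (J2.card : ℝ) * (1 / 4) ≤ s / (l / 2) := by
    have hb := boole_finset S a ha (half_pos hl)
    have hsub : ⋃ j ∈ J2, Ioo ((j : ℝ) + 1 / 4) ((j : ℝ) + 1 / 2) ⊆
        {y : ℝ | l / 2 < ∑ k ∈ S, a k / ((k : ℝ) - y)} := by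
      intro y hy
      simp only [mem_iUnion] at hy
      obtain ⟨j, hj, hy1, hy2⟩ := hy
      have hjJ := (Finset.mem_filter.1 hj).1
      have hj2 := (Finset.mem_filter.1 hj).2
      have hd := hJ j hjJ
      have key : ∀ k ∈ S, a k / ((k : ℝ) - j) - (if k = j then l / 2 else 0) ≤ a k / ((k : ℝ) - y) := by
        intro k hk
        have hak := ha k hk
        split_ifs with hkj
        · subst hkj
          have hle : a k ≤ l / 8 := by
            by_contra hcon
            exact hj2 ⟨hk, not_le.1 hcon⟩
          rw [sub_self, div_zero, zero_sub, neg_le, ← div_neg, neg_sub]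
          rw [div_le_iff₀ (by linarith)]
          nlinarith
        · rw [sub_zero]
          rcases lt_or_gt_of_ne hkj with h | h
          · have : (k : ℝ) + 1 ≤ j := by exact_mod_cast h
            rw [div_eq_mul_inv, div_eq_mul_inv]
            apply mul_le_mul_of_nonneg_left _ hak
            rw [inv_le_inv_of_neg (by linarith) (by linarith)]
            linarith
          · have : (j : ℝ) + 1 ≤ k := by exact_mod_cast h
            apply div_le_div_of_nonneg_left hak (by linarith) (by linarith)
      have hsum := Finset.sum_le_sum key
      rw [Finset.sum_sub_distrib] at hsum
      have h3 : ∑ k ∈ S, (if k = j then l / 2 else 0) ≤ l / 2 := by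
        rw [Finset.sum_ite_eq']
        split_ifs <;> linarith
      have h4 : dH S a j = ∑ k ∈ S, a k / ((k : ℝ) - j) := rfl
      show l / 2 < _
      linarith
    have hvol : volume (⋃ j ∈ J2, Ioo ((j : ℝ) + 1 / 4) ((j : ℝ) + 1 / 2)) =
        ENNReal.ofReal ((J2.card : ℝ) * (1 / 4)) := by
      rw [measure_biUnion_finset]
      · simp only [Real.volume_Ioo]
        rw [Finset.sum_congr rfl (g := fun _ => ENNReal.ofReal (1 / 4))]
        · rw [Finset.sum_const, nsmul_eq_mul, ENNReal.ofReal_mul (by positivity)]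
          simp
        · intro x _
          congr 1; ring
      · intro i _ j _ hij
        apply Set.disjoint_left.2
        rintro y ⟨h1, h2⟩ ⟨h3, h4⟩
        apply hij
        have e1 : i < j + 1 := by
          have : (i : ℝ) < j + 1 := by linarith
          exact_mod_cast this
        have e2 : j < i + 1 := by
          have : (j : ℝ) < i + 1 := by linarith
          exact_mod_cast this
        omega
      · intro j _; exact measurableSet_Ioo
    have := (measure_mono hsub).trans hb
    rw [hvol] at this
    have hs0 : 0 ≤ s := Finset.sum_nonneg ha
    exact (ENNReal.ofReal_le_ofReal_iff (by positivity)).1 this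
  rw [le_div_iff₀ (by positivity)] at h2
  rw [hcard]
  nlinarith

lemma dH_neg (S : Finset ℤ) (a : ℤ → ℝ) (j : ℤ) :
    dH (S.map (Equiv.neg ℤ).toEmbedding) (fun k => a (-k)) (-j) = - dH S a j := by
  simp only [dH, Finset.sum_map, ← Finset.sum_neg_distrib]
  refine Finset.sum_congr rfl fun k _ => ?_
  simp only [Equiv.coe_toEmbedding, Equiv.neg_apply, neg_neg, Int.cast_neg]
  rw [← div_neg]; congr 1; ring

lemma dH_weak_neg (S J : Finset ℤ) (a : ℤ → ℝ) (ha : ∀ k ∈ S, 0 ≤ a k) {l : ℝ} (hl : 0 < l)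
    (hJ : ∀ j ∈ J, dH S a j < -l) : (J.card : ℝ) * l ≤ 16 * ∑ k ∈ S, a k := by
  have := dH_weak_pos (S.map (Equiv.neg ℤ).toEmbedding) (J.map (Equiv.neg ℤ).toEmbedding)
    (fun k => a (-k)) (by
      intro k hk
      obtain ⟨i, hi, rfl⟩ := Finset.mem_map.1 hk
      simpa using ha i hi) hl (by
      intro k hk
      obtain ⟨i, hi, rfl⟩ := Finset.mem_map.1 hk
      have := hJ i hi
      have h2 := dH_neg S a i
      simp only [Equiv.coe_toEmbedding, Equiv.neg_apply]
      linarith)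
  simpa using this

lemma cover_Z (J : Finset ℤ) (n : ℤ → ℕ) (hn : ∀ j ∈ J, 1 ≤ n j) :
    ∃ J' ⊆ J, (J' : Set ℤ).PairwiseDisjoint (fun j => Finset.Ioo (j - n j) (j + n j)) ∧
      J.card ≤ ∑ j ∈ J', 6 * n j := by
  classical
  obtain ⟨u, hu, hd, hc⟩ := Vitali.exists_disjoint_subfamily_covering_enlargement
    (fun j : ℤ => Set.Ioo (j - n j) (j + n j)) (J : Set ℤ) (fun j => (n j : ℝ)) 2 (by norm_num)
    (fun a _ => by positivity) (∑ j ∈ J, (n j : ℝ))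
    (fun a ha => Finset.single_le_sum (f := fun j => (n j : ℝ)) (fun _ _ => by positivity) ha)
    (fun a ha => ⟨a, by have := hn a ha; constructor <;> simp <;> omega⟩)
  have hfin : u.Finite := J.finite_toSet.subset hu
  refine ⟨hfin.toFinset, by intro x hx; exact hu (by simpa using hx), ?_, ?_⟩
  · intro i hi j hj hij
    have := hd (by simpa using hi) (by simpa using hj) hij
    rw [Function.onFun, Finset.disjoint_left]
    intro x hx hx'
    exact Set.disjoint_left.1 this (by simpa using hx) (by simpa using hx')
  · have hsub : J ⊆ hfin.toFinset.biUnion (fun b => Finset.Ioo (b - 3 * (n b : ℤ)) (b + 3 * n b)) := by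
      intro x hx
      obtain ⟨b, hb, ⟨y, hy1, hy2⟩, hle⟩ := hc x hx
      rw [Finset.mem_biUnion]
      refine ⟨b, by simpa using hb, ?_⟩
      have hle' : n x ≤ 2 * n b := by exact_mod_cast hle
      simp only [Set.mem_Ioo, Finset.mem_Ioo] at *
      omega
    refine (Finset.card_le_card hsub).trans (Finset.card_biUnion_le.trans ?_)
    refine Finset.sum_le_sum fun b _ => ?_
    rw [Int.card_Ioo]
    omega

lemma max_Z_dichotomy (S : Finset ℤ) (a : ℤ → ℝ) (ha : ∀ k ∈ S, 0 ≤ a k) {l : ℝ} (hl : 0 < l)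
    (j : ℤ) (N : ℕ) (hN : 1 ≤ N)
    (hj : l < dH (S.filter (fun k => (N : ℤ) ≤ |k - j|)) a j) :
    (N * l ≤ 64 * ∑ k ∈ S.filter (fun k => k ∈ Finset.Ioo (j - N) (j + N)), a k) ∨
    ((N : ℝ) ≤ 2 * ((Finset.Ioo (j - (N : ℤ)) (j + N)).filter (fun i => l / 2 < dH S a i)).card) := by
  classical
  by_contra! hcon
  obtain ⟨h1, h2⟩ := hcon
  set far := S.filter (fun k => (N : ℤ) ≤ |k - j|) with hfar
  set near := S.filter (fun k => k ∈ Finset.Ioo (j - (N:ℤ)) (j + N)) with hnear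
  have hsplit : ∀ i, dH S a i = dH far a i + dH near a i := by
    intro i
    have e : near = S.filter (fun k => ¬ ((N : ℤ) ≤ |k - j|)) := by
      rw [hnear]
      refine Finset.filter_congr fun k _ => ?_
      rw [not_le, abs_lt, Finset.mem_Ioo]
      constructor <;> intro h <;> constructor <;> omega
    rw [e]
    exact (Finset.sum_filter_add_sum_filter_not S _ _).symm
  set W := Finset.Ico j (j + N) with hW
  set bad := W.filter (fun i => dH near a i < - (l / 2)) with hbad
  have hbadc := dH_weak_neg near bad a (fun k hk => ha k (Finset.mem_filter.1 hk).1) (half_pos hl)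
    (fun i hi => (Finset.mem_filter.1 hi).2)
  have hmono : ∀ i ∈ W, dH far a j ≤ dH far a i := by
    intro i hi
    rw [hW, Finset.mem_Ico] at hi
    refine Finset.sum_le_sum fun k hk => ?_
    rw [hfar, Finset.mem_filter] at hk
    have hak := ha k hk.1
    have hi1 : (j : ℝ) ≤ i := by exact_mod_cast hi.1
    rcases le_abs'.1 hk.2 with h | h
    · have : (k : ℝ) + 1 ≤ j := by
        have : k + 1 ≤ j := by omega
        exact_mod_cast this
      rw [div_eq_mul_inv, div_eq_mul_inv]
      apply mul_le_mul_of_nonneg_left _ hak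
      rw [inv_le_inv_of_neg (by linarith) (by linarith)]
      linarith
    · have : (i : ℝ) + 1 ≤ k := by
        have : i + 1 ≤ k := by omega
        exact_mod_cast this
      apply div_le_div_of_nonneg_left hak (by linarith) (by linarith)
  have hgood : W.filter (fun i => ¬ dH near a i < - (l / 2)) ⊆
      (Finset.Ioo (j - (N : ℤ)) (j + N)).filter (fun i => l / 2 < dH S a i) := by
    intro i hi
    rw [Finset.mem_filter] at hi ⊢
    have h3 := hmono i hi.1
    have hi1 := hi.1
    rw [hW, Finset.mem_Ico] at hi1
    refine ⟨?_, ?_⟩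
    · rw [Finset.mem_Ioo]; omega
    · rw [hsplit i]
      have := hi.2
      linarith
  have hc := Finset.card_le_card hgood
  have hWc : bad.card + (W.filter (fun i => ¬ dH near a i < - (l / 2))).card = N := by
    rw [hbad, Finset.card_filter_add_card_filter_not, hW]
    simp
  have hc' : ((W.filter (fun i => ¬ dH near a i < - (l / 2))).card : ℝ) ≤
    ((Finset.Ioo (j - (N : ℤ)) (j + N)).filter (fun i => l / 2 < dH S a i)).card := by exact_mod_cast hc
  have hWc' : (bad.card : ℝ) + (W.filter (fun i => ¬ dH near a i < - (l / 2))).card = N := by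
    exact_mod_cast hWc
  nlinarith

lemma max_Z (S J : Finset ℤ) (a : ℤ → ℝ) (ha : ∀ k ∈ S, 0 ≤ a k) {l : ℝ} (hl : 0 < l)
    (n : ℤ → ℕ) (hn : ∀ j ∈ J, 1 ≤ n j)
    (hJ : ∀ j ∈ J, l < dH (S.filter (fun k => (n j : ℤ) ≤ |k - j|)) a j) :
    (J.card * l ≤ 50000 * ∑ k ∈ S, a k) ∧ (J.card * l ^ 2 ≤ 50000 * ∑ k ∈ S, a k ^ 2) := by
  classical
  obtain ⟨J', hJ', hdis, hcard⟩ := cover_Z J n hn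
  have hcard' : (J.card : ℝ) ≤ 6 * ∑ j ∈ J', (n j : ℝ) := by
    rw [Finset.mul_sum]; exact_mod_cast hcard
  set I : ℤ → Finset ℤ := fun j => Finset.Ioo (j - (n j : ℤ)) (j + n j) with hI
  -- disjoint sums
  have hsum : ∀ g : ℤ → ℝ, (∀ k ∈ S, 0 ≤ g k) →
      ∑ j ∈ J', ∑ k ∈ S.filter (fun k => k ∈ I j), g k ≤ ∑ k ∈ S, g k := by
    intro g hg
    rw [← Finset.sum_biUnion]
    · refine Finset.sum_le_sum_of_subset_of_nonneg ?_ fun k hk _ => hg k hk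
      intro k hk
      obtain ⟨j, _, hk⟩ := Finset.mem_biUnion.1 hk
      exact (Finset.mem_filter.1 hk).1
    · intro i hi j hj hij
      have := hdis hi hj hij
      rw [Function.onFun, Finset.disjoint_left] at this ⊢
      intro x hx hx'
      exact this (Finset.mem_filter.1 hx).2 (Finset.mem_filter.1 hx').2
  set E : ℤ → Finset ℤ := fun j => (I j).filter (fun i => l / 2 < dH S a i) with hE
  set U := J'.biUnion E with hU
  have hUc : ∑ j ∈ J', ((E j).card : ℝ) = U.card := by
    rw [hU, Finset.card_biUnion]
    · push_cast; rfl
    · intro i hi j hj hij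
      have := hdis hi hj hij
      rw [Function.onFun, Finset.disjoint_left] at this
      rw [Function.onFun, Finset.disjoint_left]
      intro x hx hx'
      exact this (Finset.mem_filter.1 hx).1 (Finset.mem_filter.1 hx').1
  have hUmem : ∀ i ∈ U, l / 2 < dH S a i := by
    intro i hi
    obtain ⟨j, _, hk⟩ := Finset.mem_biUnion.1 hi
    exact (Finset.mem_filter.1 hk).2
  have hU1 := dH_weak_pos S U a ha (half_pos hl) hUmem
  have hU2 : U.card * (l / 2) ^ 2 ≤ 10 * ∑ k ∈ S, a k ^ 2 := by
    have h0 : 0 ≤ ∑ k ∈ S, a k ^ 2 := Finset.sum_nonneg fun _ _ => sq_nonneg _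
    have hpi : Real.pi ^ 2 ≤ 10 := by nlinarith [Real.pi_lt_d2, Real.pi_pos]
    calc U.card * (l / 2) ^ 2 = ∑ i ∈ U, (l / 2) ^ 2 := by simp
      _ ≤ ∑ i ∈ U, (dH S a i) ^ 2 := Finset.sum_le_sum fun i hi =>
          pow_le_pow_left₀ (by positivity) (hUmem i hi).le 2
      _ ≤ Real.pi ^ 2 * ∑ k ∈ S, a k ^ 2 := dH_l2 S U a
      _ ≤ _ := by gcongr
  have hdich : ∀ j ∈ J', ((n j : ℝ) * l ≤ 64 * ∑ k ∈ S.filter (fun k => k ∈ I j), a k) ∨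
      ((n j : ℝ) ≤ 2 * (E j).card) := fun j hj =>
    max_Z_dichotomy S a ha hl j (n j) (hn j (hJ' hj)) (hJ j (hJ' hj))
  have hs0 : ∀ j, 0 ≤ ∑ k ∈ S.filter (fun k => k ∈ I j), a k := fun j =>
    Finset.sum_nonneg fun k hk => ha k (Finset.mem_filter.1 hk).1
  have hs02 : ∀ j, 0 ≤ ∑ k ∈ S.filter (fun k => k ∈ I j), a k ^ 2 := fun j =>
    Finset.sum_nonneg fun k hk => sq_nonneg _
  constructor
  · have h1 : ∀ j ∈ J', (n j : ℝ) * l ≤ 64 * ∑ k ∈ S.filter (fun k => k ∈ I j), a k +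
        2 * l * (E j).card := by
      intro j hj
      rcases hdich j hj with h | h
      · have : 0 ≤ 2 * l * (E j).card := by positivity
        linarith
      · nlinarith [hs0 j]
    have h2 := Finset.sum_le_sum h1
    rw [Finset.sum_add_distrib, ← Finset.mul_sum, ← Finset.mul_sum, ← Finset.sum_mul, hUc] at h2
    have h3 := hsum a ha
    have h4 : 0 ≤ ∑ k ∈ S, a k := Finset.sum_nonneg ha
    nlinarith
  · have h1 : ∀ j ∈ J', (n j : ℝ) * l ^ 2 ≤ 8192 * ∑ k ∈ S.filter (fun k => k ∈ I j), a k ^ 2 +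
        2 * l ^ 2 * (E j).card := by
      intro j hj
      rcases hdich j hj with h | h
      · have h5 : 0 ≤ 2 * l ^ 2 * (E j).card := by positivity
        have hcs := sq_sum_le_card_mul_sum_sq (s := S.filter (fun k => k ∈ I j)) (f := a)
        have hcI : ((S.filter (fun k => k ∈ I j)).card : ℝ) ≤ 2 * n j := by
          have : (S.filter (fun k => k ∈ I j)).card ≤ (I j).card := Finset.card_le_card fun k hk =>
            (Finset.mem_filter.1 hk).2
          have h6 : (I j).card ≤ 2 * n j := by rw [hI, Int.card_Ioo]; omega
          exact_mod_cast this.trans h6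
        have hnj : (1 : ℝ) ≤ n j := by exact_mod_cast hn j (hJ' hj)
        have h7 : ((n j : ℝ) * l) ^ 2 ≤ (64 * ∑ k ∈ S.filter (fun k => k ∈ I j), a k) ^ 2 :=
          pow_le_pow_left₀ (by positivity) h 2
        have h8 : (n j : ℝ) * ((n j : ℝ) * l ^ 2) ≤
            n j * (8192 * ∑ k ∈ S.filter (fun k => k ∈ I j), a k ^ 2) := by
          have := mul_le_mul_of_nonneg_right hcI (hs02 j)
          nlinarith
        have := le_of_mul_le_mul_left h8 (by linarith)
        linarith
      · nlinarith [hs02 j, sq_nonneg l, mul_le_mul_of_nonneg_right h (sq_nonneg l)]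
    have h2 := Finset.sum_le_sum h1
    rw [Finset.sum_add_distrib, ← Finset.mul_sum, ← Finset.mul_sum, ← Finset.sum_mul, hUc] at h2
    have h3 := hsum (fun k => a k ^ 2) (fun _ _ => sq_nonneg _)
    have h4 : 0 ≤ ∑ k ∈ S, a k ^ 2 := Finset.sum_nonneg fun _ _ => sq_nonneg _
    have h5 := mul_le_mul_of_nonneg_right hcard' (sq_nonneg l)
    nlinarith

lemma max_Z_neg (S J : Finset ℤ) (a : ℤ → ℝ) (ha : ∀ k ∈ S, 0 ≤ a k) {l : ℝ} (hl : 0 < l)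
    (n : ℤ → ℕ) (hn : ∀ j ∈ J, 1 ≤ n j)
    (hJ : ∀ j ∈ J, dH (S.filter (fun k => (n j : ℤ) ≤ |k - j|)) a j < -l) :
    (J.card * l ≤ 50000 * ∑ k ∈ S, a k) ∧ (J.card * l ^ 2 ≤ 50000 * ∑ k ∈ S, a k ^ 2) := by
  have := max_Z (S.map (Equiv.neg ℤ).toEmbedding) (J.map (Equiv.neg ℤ).toEmbedding)
    (fun k => a (-k)) (by
      intro k hk
      obtain ⟨i, hi, rfl⟩ := Finset.mem_map.1 hk
      simpa using ha i hi) hl (fun j => n (-j)) (by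
      intro k hk
      obtain ⟨i, hi, rfl⟩ := Finset.mem_map.1 hk
      simpa using hn i hi) (by
      intro k hk
      obtain ⟨i, hi, rfl⟩ := Finset.mem_map.1 hk
      have := hJ i hi
      have h2 := dH_neg (S.filter (fun k => (n i : ℤ) ≤ |k - i|)) a i
      simp only [Equiv.coe_toEmbedding, Equiv.neg_apply, neg_neg]
      have e : (S.map (Equiv.neg ℤ).toEmbedding).filter (fun k => (n i : ℤ) ≤ |k - -i|) =
          (S.filter (fun k => (n i : ℤ) ≤ |k - i|)).map (Equiv.neg ℤ).toEmbedding := by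
        rw [Finset.filter_map]
        congr 1
        refine Finset.filter_congr fun k _ => ?_
        simp only [Function.comp, Equiv.coe_toEmbedding, Equiv.neg_apply]
        rw [show -k - -i = -(k - i) by ring, abs_neg]
      rw [e]
      linarith)
  simpa using this

lemma dH_sub (S : Finset ℤ) (a b : ℤ → ℝ) (j : ℤ) :
    dH S (fun k => a k - b k) j = dH S a j - dH S b j := by
  simp only [dH, ← Finset.sum_sub_distrib, sub_div]

lemma max_Z_abs (S J : Finset ℤ) (a : ℤ → ℝ) {l : ℝ} (hl : 0 < l)
    (n : ℤ → ℕ) (hn : ∀ j ∈ J, 1 ≤ n j)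
    (hJ : ∀ j ∈ J, l < |dH (S.filter (fun k => (n j : ℤ) ≤ |k - j|)) a j|) :
    (J.card * l ≤ 400000 * ∑ k ∈ S, |a k|) ∧ (J.card * l ^ 2 ≤ 800000 * ∑ k ∈ S, a k ^ 2) := by
  classical
  set p : ℤ → ℝ := fun k => max (a k) 0
  set q : ℤ → ℝ := fun k => max (-a k) 0
  have hp : ∀ k, 0 ≤ p k := fun k => le_max_right _ _
  have hq : ∀ k, 0 ≤ q k := fun k => le_max_right _ _
  have hpq : a = fun k => p k - q k := by
    funext k
    simp only [p, q]
    rcases le_total (a k) 0 with h | h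
    · rw [max_eq_right h, max_eq_left (by linarith)]; ring
    · rw [max_eq_left h, max_eq_right (by linarith)]; ring
  have hp1 : ∀ k, p k ≤ |a k| := fun k => max_le (le_abs_self _) (abs_nonneg _)
  have hq1 : ∀ k, q k ≤ |a k| := fun k => max_le (neg_le_abs _) (abs_nonneg _)
  have hp2 : ∀ k, p k ^ 2 ≤ a k ^ 2 := fun k => by
    rw [← sq_abs (a k)]; exact pow_le_pow_left₀ (hp k) (hp1 k) 2
  have hq2 : ∀ k, q k ^ 2 ≤ a k ^ 2 := fun k => by
    rw [← sq_abs (a k)]; exact pow_le_pow_left₀ (hq k) (hq1 k) 2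
  set D : (ℤ → ℝ) → ℤ → ℝ := fun b j => dH (S.filter (fun k => (n j : ℤ) ≤ |k - j|)) b j with hD
  have hl2 := half_pos hl
  have r1 := max_Z S (J.filter (fun j => l / 2 < D p j)) p (fun k _ => hp k) hl2 n
    (fun j hj => hn j (Finset.mem_filter.1 hj).1) (fun j hj => (Finset.mem_filter.1 hj).2)
  have r2 := max_Z_neg S (J.filter (fun j => D p j < -(l / 2))) p (fun k _ => hp k) hl2 n
    (fun j hj => hn j (Finset.mem_filter.1 hj).1) (fun j hj => (Finset.mem_filter.1 hj).2)
  have r3 := max_Z S (J.filter (fun j => l / 2 < D q j)) q (fun k _ => hq k) hl2 n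
    (fun j hj => hn j (Finset.mem_filter.1 hj).1) (fun j hj => (Finset.mem_filter.1 hj).2)
  have r4 := max_Z_neg S (J.filter (fun j => D q j < -(l / 2))) q (fun k _ => hq k) hl2 n
    (fun j hj => hn j (Finset.mem_filter.1 hj).1) (fun j hj => (Finset.mem_filter.1 hj).2)
  have hsub : J ⊆ (J.filter (fun j => l / 2 < D p j) ∪ J.filter (fun j => D p j < -(l / 2))) ∪
      (J.filter (fun j => l / 2 < D q j) ∪ J.filter (fun j => D q j < -(l / 2))) := by
    intro j hj
    have h := hJ j hj
    rw [hpq, dH_sub] at h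
    change l < |D p j - D q j| at h
    simp only [Finset.mem_union, Finset.mem_filter, hj, true_and]
    by_contra! hcon
    obtain ⟨⟨h1, h2⟩, h3, h4⟩ := hcon
    rcases abs_cases (D p j - D q j) with ⟨h5, _⟩ | ⟨h5, _⟩ <;> linarith
  have hc : J.card ≤ ((J.filter (fun j => l / 2 < D p j)).card +
      (J.filter (fun j => D p j < -(l / 2))).card) + ((J.filter (fun j => l / 2 < D q j)).card +
      (J.filter (fun j => D q j < -(l / 2))).card) :=
    (Finset.card_le_card hsub).trans ((Finset.card_union_le _ _).trans
      (add_le_add (Finset.card_union_le _ _) (Finset.card_union_le _ _)))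
  have hc' : (J.card : ℝ) ≤ (((J.filter (fun j => l / 2 < D p j)).card : ℝ) +
      (J.filter (fun j => D p j < -(l / 2))).card) + ((J.filter (fun j => l / 2 < D q j)).card +
      (J.filter (fun j => D q j < -(l / 2))).card) := by exact_mod_cast hc
  have e1 : ∑ k ∈ S, p k ≤ ∑ k ∈ S, |a k| := Finset.sum_le_sum fun k _ => hp1 k
  have e2 : ∑ k ∈ S, q k ≤ ∑ k ∈ S, |a k| := Finset.sum_le_sum fun k _ => hq1 k
  have e3 : ∑ k ∈ S, p k ^ 2 ≤ ∑ k ∈ S, a k ^ 2 := Finset.sum_le_sum fun k _ => hp2 k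
  have e4 : ∑ k ∈ S, q k ^ 2 ≤ ∑ k ∈ S, a k ^ 2 := Finset.sum_le_sum fun k _ => hq2 k
  constructor
  · have := mul_le_mul_of_nonneg_right hc' hl2.le
    linarith [r1.1, r2.1, r3.1, r4.1]
  · have := mul_le_mul_of_nonneg_right hc' (sq_nonneg (l / 2))
    linarith [r1.2, r2.2, r3.2, r4.2]

/-- two-sided truncations -/
lemma max_Z_two (S J : Finset ℤ) (a : ℤ → ℝ) {l : ℝ} (hl : 0 < l)
    (n m : ℤ → ℕ) (hn : ∀ j ∈ J, 1 ≤ n j) (hnm : ∀ j ∈ J, n j ≤ m j)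
    (hJ : ∀ j ∈ J, l < |dH (S.filter (fun k => (n j : ℤ) ≤ |k - j| ∧ |k - j| ≤ m j)) a j|) :
    (J.card * l ≤ 10 ^ 7 * ∑ k ∈ S, |a k|) ∧ (J.card * l ^ 2 ≤ 10 ^ 7 * ∑ k ∈ S, a k ^ 2) := by
  classical
  set D : (ℤ → ℕ) → ℤ → ℝ := fun n j => dH (S.filter (fun k => (n j : ℤ) ≤ |k - j|)) a j with hD
  have hl2 := half_pos hl
  have r1 := max_Z_abs S (J.filter (fun j => l / 2 < |D n j|)) a hl2 n
    (fun j hj => hn j (Finset.mem_filter.1 hj).1) (fun j hj => (Finset.mem_filter.1 hj).2)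
  have r2 := max_Z_abs S (J.filter (fun j => l / 2 < |D (fun j => m j + 1) j|)) a hl2
    (fun j => m j + 1) (fun j hj => by omega) (fun j hj => (Finset.mem_filter.1 hj).2)
  have hsub : J ⊆ J.filter (fun j => l / 2 < |D n j|) ∪
      J.filter (fun j => l / 2 < |D (fun j => m j + 1) j|) := by
    intro j hj
    have h := hJ j hj
    have h1 := hnm j hj
    have e : dH (S.filter (fun k => (n j : ℤ) ≤ |k - j| ∧ |k - j| ≤ m j)) a j =
        D n j - D (fun j => m j + 1) j := by
      rw [eq_sub_iff_add_eq]
      simp only [hD, dH]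
      rw [← Finset.sum_filter_add_sum_filter_not (S.filter (fun k => (n j : ℤ) ≤ |k - j|))
        (fun k => |k - j| ≤ m j)]
      rw [Finset.filter_filter, Finset.filter_filter]
      congr 2
      ext k
      simp only [Finset.mem_filter]
      push_cast
      constructor
      · rintro ⟨h, h'⟩; exact ⟨h, by omega, by omega⟩
      · rintro ⟨h, h', h''⟩; exact ⟨h, by omega⟩
    rw [e] at h
    simp only [Finset.mem_union, Finset.mem_filter, hj, true_and]
    by_contra! hcon
    have := abs_sub (D n j) (D (fun j => m j + 1) j)
    linarith [hcon.1, hcon.2]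
  have hc := (Finset.card_le_card hsub).trans (Finset.card_union_le _ _)
  have hc' : (J.card : ℝ) ≤ ((J.filter (fun j => l / 2 < |D n j|)).card : ℝ) +
      (J.filter (fun j => l / 2 < |D (fun j => m j + 1) j|)).card := by exact_mod_cast hc
  have e1 : 0 ≤ ∑ k ∈ S, |a k| := Finset.sum_nonneg fun _ _ => abs_nonneg _
  have e2 : 0 ≤ ∑ k ∈ S, a k ^ 2 := Finset.sum_nonneg fun _ _ => sq_nonneg _
  constructor
  · have := mul_le_mul_of_nonneg_right hc' hl2.le
    linarith [r1.1, r2.1]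
  · have := mul_le_mul_of_nonneg_right hc' (sq_nonneg (l / 2))
    linarith [r1.2, r2.2]

/-- truncated discrete ergodic Hilbert sums -/
def dS {X : Type*} (U : ℤ → X → X) (F : X → ℝ) (n m : ℕ) (x : X) : ℝ :=
  ∑ k ∈ Finset.Icc n m, (F (U k x) - F (U (-k) x)) / k

lemma dH_eq_dS (a : ℤ → ℝ) (S : Finset ℤ) (j : ℤ) (n m : ℕ) (hn : 1 ≤ n)
    (hS : Finset.Icc (j - m) (j + m) ⊆ S) :
    dH (S.filter (fun k => (n : ℤ) ≤ |k - j| ∧ |k - j| ≤ m)) a j =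
      ∑ k ∈ Finset.Icc n m, (a (j + k) - a (j - k)) / (k : ℝ) := by
  classical
  have e : S.filter (fun k => (n : ℤ) ≤ |k - j| ∧ |k - j| ≤ m) =
      (Finset.Icc n m).image (fun k : ℕ => j + (k : ℤ)) ∪
      (Finset.Icc n m).image (fun k : ℕ => j - (k : ℤ)) := by
    ext k
    simp only [Finset.mem_filter, Finset.mem_union, Finset.mem_image, Finset.mem_Icc]
    constructor
    · rintro ⟨h1, h2, h3⟩
      rcases le_total j k with h | h
      · left
        rw [abs_of_nonneg (by omega)] at h2 h3
        exact ⟨(k - j).toNat, by omega, by omega⟩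
      · right
        rw [abs_of_nonpos (by omega)] at h2 h3
        exact ⟨(j - k).toNat, by omega, by omega⟩
    · rintro (⟨i, hi, rfl⟩ | ⟨i, hi, rfl⟩)
      · refine ⟨hS (by rw [Finset.mem_Icc]; omega), ?_⟩
        rw [add_sub_cancel_left, abs_of_nonneg (by omega)]
        omega
      · refine ⟨hS (by rw [Finset.mem_Icc]; omega), ?_⟩
        rw [show j - (i : ℤ) - j = -i by ring, abs_neg, abs_of_nonneg (by omega)]
        omega
  rw [e, dH, Finset.sum_union, Finset.sum_image, Finset.sum_image, ← Finset.sum_add_distrib]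
  · refine Finset.sum_congr rfl fun k _ => ?_
    push_cast
    rw [show (j : ℝ) + k - j = k by ring, show (j : ℝ) - k - j = -k by ring, div_neg]
    ring
  · intro x _ y _ h
    have : j - (x : ℤ) = j - y := h
    omega
  · intro x _ y _ h
    have : j + (x : ℤ) = j + y := h
    omega
  · rw [Finset.disjoint_left]
    intro k hk hk'
    simp only [Finset.mem_image, Finset.mem_Icc] at hk hk'
    obtain ⟨i, hi, rfl⟩ := hk
    obtain ⟨i', hi', h⟩ := hk'
    omega

lemma max_Z_pow (p : ℕ) (hp : p = 1 ∨ p = 2) (S J : Finset ℤ) (a : ℤ → ℝ) {l : ℝ} (hl : 0 < l)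
    (n m : ℤ → ℕ) (hn : ∀ j ∈ J, 1 ≤ n j) (hnm : ∀ j ∈ J, n j ≤ m j)
    (hJ : ∀ j ∈ J, l < |dH (S.filter (fun k => (n j : ℤ) ≤ |k - j| ∧ |k - j| ≤ m j)) a j|) :
    (J.card * l ^ p ≤ 10 ^ 7 * ∑ k ∈ S, |a k| ^ p) := by
  have := max_Z_two S J a hl n m hn hnm hJ
  rcases hp with rfl | rfl
  · simpa using this.1
  · simpa using this.2

section
variable {X : Type*} [MeasurableSpace X] {μ : Measure X}

lemma trans_Z_N (p : ℕ) (hp : p = 1 ∨ p = 2) (U : ℤ → X → X)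
    (hU : ∀ k, MeasurePreserving (U k) μ μ)
    (hadd : ∀ j k x, U (j + k) x = U j (U k x)) (F : X → ℝ) (hF : Measurable F)
    {l : ℝ} (hl : 0 < l) (N : ℕ) :
    ENNReal.ofReal (l ^ p) * μ {x | ∃ n m : ℕ, 1 ≤ n ∧ n ≤ m ∧ m ≤ N ∧ l < |dS U F n m x|} ≤
      ENNReal.ofReal (2 * 10 ^ 7) * ∫⁻ x, ENNReal.ofReal (|F x| ^ p) ∂μ := by
  classical
  set E := {x | ∃ n m : ℕ, 1 ≤ n ∧ n ≤ m ∧ m ≤ N ∧ l < |dS U F n m x|} with hE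
  have hdS : ∀ n m, Measurable (dS U F n m) := by
    intro n m
    unfold dS
    refine Finset.measurable_sum _ fun k _ => ?_
    exact ((hF.comp (hU _).measurable).sub (hF.comp (hU _).measurable)).div_const _
  have hEm : MeasurableSet E := by
    have : E = ⋃ n : ℕ, ⋃ m : ℕ, {x | 1 ≤ n ∧ n ≤ m ∧ m ≤ N ∧ l < |dS U F n m x|} := by
      ext x; simp [hE]
    rw [this]
    refine MeasurableSet.iUnion fun n => MeasurableSet.iUnion fun m => ?_
    by_cases h : 1 ≤ n ∧ n ≤ m ∧ m ≤ N
    · have : {x | 1 ≤ n ∧ n ≤ m ∧ m ≤ N ∧ l < |dS U F n m x|} = {x | l < |dS U F n m x|} := by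
        ext x; simp [h]
      rw [this]
      exact measurableSet_lt measurable_const (hdS n m).abs
    · have : {x | 1 ≤ n ∧ n ≤ m ∧ m ≤ N ∧ l < |dS U F n m x|} = ∅ := by
        ext x
        simp only [mem_ofPred_eq, mem_empty_iff_false, iff_false]
        tauto
      rw [this]; exact MeasurableSet.empty
  set L : ℕ := 2 * N + 1 with hL
  have hpt : ∀ x, ∑ j ∈ Finset.range L, (E.indicator (fun _ => ENNReal.ofReal (l ^ p))) (U j x) ≤
      ENNReal.ofReal (10 ^ 7) * ∑ k ∈ Finset.Ico (-(N : ℤ)) (L + N),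
        ENNReal.ofReal (|F (U k x)| ^ p) := by
    intro x
    set J := (Finset.range L).filter (fun j : ℕ => U j x ∈ E) with hJ
    have h1 : ∀ j : ℤ, ∃ n m : ℕ, U j x ∈ E → 1 ≤ n ∧ n ≤ m ∧ m ≤ N ∧ l < |dS U F n m (U j x)| := by
      intro j
      by_cases h : U j x ∈ E
      · obtain ⟨n, m, h⟩ := id h
        exact ⟨n, m, fun _ => h⟩
      · exact ⟨0, 0, fun h' => absurd h' h⟩
    choose n m hnm using h1
    have key := max_Z_pow p hp (Finset.Ico (-(N : ℤ)) (L + N)) (J.map Nat.castEmbedding)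
      (fun k => F (U k x)) hl n m (by
        intro j hj
        obtain ⟨i, hi, rfl⟩ := Finset.mem_map.1 hj
        exact (hnm _ (Finset.mem_filter.1 hi).2).1) (by
        intro j hj
        obtain ⟨i, hi, rfl⟩ := Finset.mem_map.1 hj
        exact (hnm _ (Finset.mem_filter.1 hi).2).2.1) (by
        intro j hj
        obtain ⟨i, hi, rfl⟩ := Finset.mem_map.1 hj
        have hh := Finset.mem_filter.1 hi
        obtain ⟨h1, h2, h3, h4⟩ := hnm i hh.2
        have hi' := Finset.mem_range.1 hh.1
        rw [Nat.castEmbedding_apply]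
        rw [dH_eq_dS _ _ _ _ _ h1]
        · convert h4 using 2
          unfold dS
          refine Finset.sum_congr rfl fun k _ => ?_
          rw [← hadd, ← hadd, add_comm (i : ℤ), sub_eq_neg_add (i : ℤ)]
        · intro k hk
          rw [Finset.mem_Icc] at hk
          rw [Finset.mem_Ico]
          omega)
    rw [Finset.card_map] at key
    calc ∑ j ∈ Finset.range L, (E.indicator (fun _ => ENNReal.ofReal (l ^ p))) (U j x)
        = ENNReal.ofReal (J.card * l ^ p) := by
          simp only [indicator_apply]
          rw [← Finset.sum_filter, Finset.sum_const, nsmul_eq_mul, ENNReal.ofReal_mul (by positivity)]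
          simp [hJ]
      _ ≤ _ := by
          refine (ENNReal.ofReal_le_ofReal key).trans ?_
          rw [ENNReal.ofReal_mul (by positivity), ENNReal.ofReal_sum_of_nonneg]
          intro i _; positivity
  have h_itg := lintegral_mono (μ := μ) hpt
  have hmf : Measurable (fun x => ENNReal.ofReal (|F x| ^ p)) :=
    (hF.abs.pow_const p).ennreal_ofReal
  have hmf' : ∀ k : ℤ, Measurable (fun x => ENNReal.ofReal (|F (U k x)| ^ p)) :=
    fun k => hmf.comp (hU k).measurable
  have hmi : ∀ j : ℕ, Measurable (fun x => (E.indicator (fun _ => ENNReal.ofReal (l ^ p))) (U j x)) :=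
    fun j => (measurable_const.indicator hEm).comp (hU j).measurable
  rw [lintegral_finsetSum _ (fun j _ => hmi j),
    lintegral_const_mul _ (Finset.measurable_sum _ fun k _ => hmf' k),
    lintegral_finsetSum _ (fun k _ => hmf' k)] at h_itg
  have e1 : ∀ j : ℕ, ∫⁻ x, (E.indicator (fun _ => ENNReal.ofReal (l ^ p))) (U j x) ∂μ =
      ENNReal.ofReal (l ^ p) * μ E := by
    intro j
    rw [(hU j).lintegral_comp (measurable_const.indicator hEm), lintegral_indicator_const hEm]
  have e2 : ∀ k : ℤ, ∫⁻ x, ENNReal.ofReal (|F (U k x)| ^ p) ∂μ =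
      ∫⁻ x, ENNReal.ofReal (|F x| ^ p) ∂μ := fun k => (hU k).lintegral_comp hmf
  simp only [e1, e2, Finset.sum_const, nsmul_eq_mul, Finset.card_range, Int.card_Ico] at h_itg
  have e3 : ((((L : ℤ) + N) - (-(N : ℤ))).toNat : ℝ≥0∞) ≤ 2 * L := by
    have : (((L : ℤ) + N) - (-(N : ℤ))).toNat ≤ 2 * L := by omega
    exact_mod_cast this
  have hL0 : (L : ℝ≥0∞) ≠ 0 := by simp [hL]
  have hLt : (L : ℝ≥0∞) ≠ ∞ := ENNReal.natCast_ne_top L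
  rw [← ENNReal.mul_le_mul_iff_right hL0 hLt]
  refine h_itg.trans ?_
  calc _ ≤ ENNReal.ofReal (10 ^ 7) * ((2 * L) * ∫⁻ x, ENNReal.ofReal (|F x| ^ p) ∂μ) := by gcongr
    _ = _ := by
      rw [ENNReal.ofReal_mul (by norm_num), ENNReal.ofReal_ofNat]; ring

lemma trans_Z (p : ℕ) (hp : p = 1 ∨ p = 2) (U : ℤ → X → X)
    (hU : ∀ k, MeasurePreserving (U k) μ μ)
    (hadd : ∀ j k x, U (j + k) x = U j (U k x)) (F : X → ℝ) (hF : Measurable F)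
    {l : ℝ} (hl : 0 < l) :
    ENNReal.ofReal (l ^ p) * μ {x | ∃ n m : ℕ, 1 ≤ n ∧ n ≤ m ∧ l < |dS U F n m x|} ≤
      ENNReal.ofReal (2 * 10 ^ 7) * ∫⁻ x, ENNReal.ofReal (|F x| ^ p) ∂μ := by
  have e : {x | ∃ n m : ℕ, 1 ≤ n ∧ n ≤ m ∧ l < |dS U F n m x|} =
      ⋃ N : ℕ, {x | ∃ n m : ℕ, 1 ≤ n ∧ n ≤ m ∧ m ≤ N ∧ l < |dS U F n m x|} := by
    ext x
    simp only [mem_ofPred_eq, mem_iUnion]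
    constructor
    · rintro ⟨n, m, h1, h2, h3⟩; exact ⟨m, n, m, h1, h2, le_rfl, h3⟩
    · rintro ⟨N, n, m, h1, h2, _, h3⟩; exact ⟨n, m, h1, h2, h3⟩
  rw [e, Monotone.measure_iUnion, ENNReal.mul_iSup]
  · exact iSup_le fun N => trans_Z_N p hp U hU hadd F hF hl N
  · intro N N' h x
    rintro ⟨n, m, h1, h2, h3, h4⟩
    exact ⟨n, m, h1, h2, h3.trans h, h4⟩
end

section
variable {X : Type*} [MeasurableSpace X] {μ : Measure X} {T : ℝ → X → X}

lemma ErgodicFlow.meas_orbit (hT : ErgodicFlow X μ T) {β : Type*} [MeasurableSpace β] {f : X → β}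
    (hf : Measurable f) (x : X) : Measurable (fun τ => f (T τ x)) :=
  hf.comp (hT.measurable.comp (measurable_id.prodMk measurable_const))

lemma ErgodicFlow.meas_joint (hT : ErgodicFlow X μ T) {β : Type*} [MeasurableSpace β] {f : X → β}
    (hf : Measurable f) : Measurable (fun q : X × ℝ => f (T q.2 q.1)) :=
  hf.comp (hT.measurable.comp measurable_swap)

lemma flow_tonelli [SigmaFinite μ] (hT : ErgodicFlow X μ T) {g : X → ℝ≥0∞} (hg : Measurable g)
    {w : ℝ → ℝ≥0∞} (hw : Measurable w) :
    ∫⁻ x, (∫⁻ τ, g (T τ x) * w τ) ∂μ = (∫⁻ x, g x ∂μ) * ∫⁻ τ, w τ := by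
  rw [lintegral_lintegral_swap]
  · rw [← lintegral_const_mul _ hw]
    refine lintegral_congr fun τ => ?_
    have hm : Measurable (fun x => g (T τ x)) := hg.comp (hT.preserving τ).measurable
    rw [lintegral_mul_const _ hm, (hT.preserving τ).lintegral_comp hg]
  · exact ((hT.meas_joint hg).mul (hw.comp measurable_snd)).aemeasurable

lemma cs_aux {g w : ℝ → ℝ≥0∞} (hg : Measurable g) (hw : Measurable w) :
    (∫⁻ τ, g τ * w τ) ^ 2 ≤ (∫⁻ τ, g τ ^ 2 * w τ) * ∫⁻ τ, w τ := by
  set ν := (volume : Measure ℝ).withDensity w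
  have e : ∀ u : ℝ → ℝ≥0∞, Measurable u → ∫⁻ τ, u τ * w τ = ∫⁻ τ, u τ ∂ν := by
    intro u hu
    rw [lintegral_withDensity_eq_lintegral_mul _ hw hu]
    refine lintegral_congr fun τ => ?_
    simp [mul_comm]
  have e1 : ∫⁻ τ, w τ = ∫⁻ τ, 1 ∂ν := by
    rw [← e _ measurable_const]; simp
  rw [e g hg, e (fun τ => g τ ^ 2) (hg.pow_const 2), e1]
  have := ENNReal.lintegral_mul_le_Lp_mul_Lq ν Real.HolderConjugate.two_two hg.aemeasurable
    (g := fun _ => 1) aemeasurable_const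
  simp only [Pi.mul_apply, mul_one, ENNReal.one_rpow] at this
  refine (pow_le_pow_left' this 2).trans ?_
  rw [mul_pow, ← ENNReal.rpow_natCast, ← ENNReal.rpow_natCast, ← ENNReal.rpow_mul,
    ← ENNReal.rpow_mul]
  norm_num

lemma flow_conv [SigmaFinite μ] (hT : ErgodicFlow X μ T) {g : X → ℝ≥0∞} (hg : Measurable g)
    {w : ℝ → ℝ≥0∞} (hw : Measurable w) (p : ℕ) (hp : p = 1 ∨ p = 2) :
    ∫⁻ x, (∫⁻ τ, g (T τ x) * w τ) ^ p ∂μ ≤ (∫⁻ x, g x ^ p ∂μ) * (∫⁻ τ, w τ) ^ p := by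
  rcases hp with rfl | rfl
  · simp only [pow_one]
    exact (flow_tonelli hT hg hw).le
  · calc ∫⁻ x, (∫⁻ τ, g (T τ x) * w τ) ^ 2 ∂μ
        ≤ ∫⁻ x, ((∫⁻ τ, g (T τ x) ^ 2 * w τ) * ∫⁻ τ, w τ) ∂μ :=
          lintegral_mono fun x => cs_aux (hT.meas_orbit hg x) hw
      _ = (∫⁻ x, (∫⁻ τ, g (T τ x) ^ 2 * w τ) ∂μ) * ∫⁻ τ, w τ := by
          refine lintegral_mul_const _ ?_
          exact (((hT.meas_joint hg).pow_const 2).mul (hw.comp measurable_snd)).lintegral_prod_right'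
      _ = _ := by
          rw [flow_tonelli hT (g := fun x => g x ^ 2) (hg.pow_const 2) hw]
          ring

/-- truncated Hilbert integral -/
def hI {X : Type*} (T : ℝ → X → X) (f : X → ℝ) (a b : ℝ) (x : X) : ℝ :=
  ∫ τ in a..b, (f (T τ x) - f (T (-τ) x)) / τ

/-- points with locally integrable orbit -/
def LI {X : Type*} (T : ℝ → X → X) (f : X → ℝ) (x : X) : Prop :=
  LocallyIntegrable (fun τ => f (T τ x)) volume

lemma ae_LI [SigmaFinite μ] (hT : ErgodicFlow X μ T) {f : X → ℝ} (hf : Measurable f)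
    (p : ℕ) (hp : p = 1 ∨ p = 2) (hfi : ∫⁻ x, ENNReal.ofReal (|f x| ^ p) ∂μ ≠ ∞) :
    ∀ᵐ x ∂μ, LI T f x := by
  have hmp : Measurable (fun x => ENNReal.ofReal (|f x| ^ p)) := (hf.abs.pow_const p).ennreal_ofReal
  have h1 : ∀ n : ℕ, ∀ᵐ x ∂μ, ∫⁻ τ in Icc (-(n : ℝ)) n, ENNReal.ofReal (|f (T τ x)| ^ p) < ∞ := by
    intro n
    have hw : Measurable ((Icc (-(n : ℝ)) n).indicator (fun _ => (1 : ℝ≥0∞))) :=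
      measurable_const.indicator measurableSet_Icc
    have := flow_tonelli hT hmp hw
    have hlt : ∫⁻ x, (∫⁻ τ, ENNReal.ofReal (|f (T τ x)| ^ p) *
        (Icc (-(n : ℝ)) n).indicator (fun _ => (1 : ℝ≥0∞)) τ) ∂μ ≠ ∞ := by
      rw [this, lintegral_indicator_const measurableSet_Icc]
      refine ENNReal.mul_ne_top hfi ?_
      simp
    have hm : Measurable (fun x => ∫⁻ τ, ENNReal.ofReal (|f (T τ x)| ^ p) *
        (Icc (-(n : ℝ)) n).indicator (fun _ => (1 : ℝ≥0∞)) τ) :=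
      ((hT.meas_joint hmp).mul (hw.comp measurable_snd)).lintegral_prod_right'
    filter_upwards [ae_lt_top hm hlt] with x hx
    rw [← lintegral_indicator measurableSet_Icc]
    refine lt_of_le_of_lt (le_of_eq (lintegral_congr fun τ => ?_)) hx
    by_cases h : τ ∈ Icc (-(n : ℝ)) n <;> simp [h]
  rw [← ae_all_iff] at h1
  filter_upwards [h1] with x hx
  unfold LI
  rw [locallyIntegrable_iff]
  intro K hK
  obtain ⟨r, hr⟩ := hK.isBounded.subset_closedBall 0
  obtain ⟨n, hn⟩ := exists_nat_ge r
  have hKs : K ⊆ Icc (-(n : ℝ)) n := by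
    intro τ hτ
    have := hr hτ
    rw [mem_closedBall, dist_zero_right, Real.norm_eq_abs, abs_le] at this
    constructor <;> linarith [this.1, this.2]
  refine IntegrableOn.mono_set ?_ hKs
  refine ⟨(hT.meas_orbit hf x).aestronglyMeasurable, ?_⟩
  rw [hasFiniteIntegral_iff_norm]
  calc ∫⁻ τ in Icc (-(n : ℝ)) n, ENNReal.ofReal ‖f (T τ x)‖
      ≤ ∫⁻ τ in Icc (-(n : ℝ)) n, (1 + ENNReal.ofReal (|f (T τ x)| ^ p)) := by
        refine lintegral_mono fun τ => ?_
        rw [← ENNReal.ofReal_one, ← ENNReal.ofReal_add (by norm_num) (by positivity)]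
        refine ENNReal.ofReal_le_ofReal ?_
        rw [Real.norm_eq_abs]
        rcases hp with rfl | rfl
        · linarith [pow_one |f (T τ x)|]
        · nlinarith [sq_nonneg (|f (T τ x)| - 1), abs_nonneg (f (T τ x))]
    _ = volume (Icc (-(n : ℝ)) n) + ∫⁻ τ in Icc (-(n : ℝ)) n, ENNReal.ofReal (|f (T τ x)| ^ p) := by
        rw [lintegral_add_left measurable_const]; simp
    _ < ∞ := ENNReal.add_lt_top.2 ⟨by simp, hx n⟩
end

/-- Poisson-type kernel -/
def kv (h τ : ℝ) : ℝ := 10 / h * (1 + (τ / h) ^ 2)⁻¹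

lemma kv_nonneg {h : ℝ} (hh : 0 < h) (τ : ℝ) : 0 ≤ kv h τ := by unfold kv; positivity

lemma kv_meas (h : ℝ) : Measurable (kv h) := by unfold kv; fun_prop

lemma kv_lint {h : ℝ} (hh : 0 < h) : ∫⁻ τ, ENNReal.ofReal (kv h τ) ≤ ENNReal.ofReal 32 := by
  have hi : Integrable (kv h) := by
    unfold kv
    exact (integrable_inv_one_add_sq.comp_div hh.ne').const_mul _
  rw [← ofReal_integral_eq_lintegral_ofReal hi (ae_of_all _ (kv_nonneg hh))]
  refine ENNReal.ofReal_le_ofReal ?_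
  unfold kv
  rw [integral_const_mul, Measure.integral_comp_div (fun x => (1 + x ^ 2)⁻¹) h,
    integral_univ_inv_one_add_sq, abs_of_pos hh, smul_eq_mul, ← mul_assoc, div_mul_cancel₀ _ hh.ne']
  linarith [Real.pi_lt_d2]

lemma LI_neg {φ : ℝ → ℝ} (hφ : LocallyIntegrable φ) : LocallyIntegrable (fun τ => φ (-τ)) := by
  rw [locallyIntegrable_iff] at hφ ⊢
  intro K hK
  have := hφ (-K) hK.neg
  have h2 := (Measure.measurePreserving_neg (volume : Measure ℝ)).integrableOn_comp_preimage
    (Homeomorph.neg ℝ).measurableEmbedding (f := φ) (s := -K)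
  rw [show (Neg.neg ⁻¹' (-K) : Set ℝ) = K by ext; simp] at h2
  exact h2.2 this

lemma LI_ii {φ : ℝ → ℝ} (hφ : LocallyIntegrable φ) (a b : ℝ) : IntervalIntegrable φ volume a b :=
  intervalIntegrable_iff.2 ((hφ.integrableOn_isCompact isCompact_uIcc).mono_set uIoc_subset_uIcc)

lemma LI_mul_cont {φ ρ : ℝ → ℝ} (hφ : LocallyIntegrable φ) {a b : ℝ} 
    (hρ : ContinuousOn ρ (uIcc a b)) : IntervalIntegrable (fun τ => φ τ * ρ τ) volume a b :=
  (LI_ii hφ a b).mul_continuousOn hρ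

lemma cmp_aux {φ : ℝ → ℝ} (hφ : LocallyIntegrable φ) {h : ℝ} (hh : 0 < h) {n m : ℕ} (hn : 1 ≤ n)
    (hnm : n ≤ m) :
    ENNReal.ofReal |(∫ τ in (((n : ℝ) - 1/2) * h)..(((m : ℝ) + 1/2) * h), (φ τ - φ (-τ)) / τ) -
      ∑ k ∈ Finset.Icc n m, ((1 / h * ∫ s in (-(h / 2))..(h / 2), φ (s + k * h)) -
        (1 / h * ∫ s in (-(h / 2))..(h / 2), φ (s + -(k * h)))) / (k : ℝ)| ≤
    ∫⁻ τ, ENNReal.ofReal |φ τ| * ENNReal.ofReal (kv h τ) := by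
  set ψ : ℝ → ℝ := fun τ => φ τ - φ (-τ) with hψ
  have hψL : LocallyIntegrable ψ := hφ.sub (LI_neg hφ)
  have hψN : LocallyIntegrable (fun τ => |ψ τ|) := by
    rw [locallyIntegrable_iff] at hψL ⊢
    exact fun K hK => (hψL K hK).abs
  set a : ℕ → ℝ := fun k => ((k : ℝ) - 1/2) * h with ha
  have hapos : ∀ k : ℕ, 1 ≤ k → 0 < a k := by
    intro k hk
    have : (1 : ℝ) ≤ k := by exact_mod_cast hk
    simp only [ha]
    apply mul_pos _ hh; linarith
  have hamono : Monotone a := by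
    intro i j hij
    have : (i : ℝ) ≤ j := by exact_mod_cast hij
    simp only [ha]; gcongr
  have hsub : ∀ {i j : ℕ}, 1 ≤ i → i ≤ j → uIcc (a i) (a j) ⊆ Ioi 0 := by
    intro i j hi hij x hx
    rw [uIcc_of_le (hamono hij)] at hx
    exact (hapos i hi).trans_le hx.1
  have hi1 : ∀ {i j : ℕ}, 1 ≤ i → i ≤ j → IntervalIntegrable (fun τ => ψ τ / τ) volume (a i) (a j) := by
    intro i j hi hij
    simp only [div_eq_mul_inv]
    refine LI_mul_cont hψL (continuousOn_id.inv₀ fun x hx => ?_)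
    exact ne_of_gt (hsub hi hij hx)
  have hi2 : ∀ {i j : ℕ}, IntervalIntegrable (fun τ => |ψ τ| * (kv h τ / 2)) volume (a i) (a j) := by
    intro i j
    refine LI_mul_cont hψN (Continuous.continuousOn ?_)
    unfold kv
    refine Continuous.div_const ?_ 2
    refine continuous_const.mul (Continuous.inv₀ (by fun_prop) fun x => by positivity)
  have e1 : (∫ τ in (((n : ℝ) - 1/2) * h)..(((m : ℝ) + 1/2) * h), ψ τ / τ) =
      ∑ k ∈ Finset.Icc n m, ∫ τ in (a k)..(a (k + 1)), ψ τ / τ := by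
    have := intervalIntegral.sum_integral_adjacent_intervals_Ico (f := fun τ => ψ τ / τ)
      (μ := volume) (a := a) (m := n) (n := m + 1) (by omega) (fun k hk => hi1 (hn.trans hk.1) (by omega))
    rw [show Finset.Icc n m = Finset.Ico n (m + 1) by ext; simp, this]
    congr 1
    simp only [ha]; push_cast; ring
  have e2 : ∀ k ∈ Finset.Icc n m, ((1 / h * ∫ s in (-(h / 2))..(h / 2), φ (s + k * h)) -
        (1 / h * ∫ s in (-(h / 2))..(h / 2), φ (s + -(k * h)))) / (k : ℝ) =
      ∫ τ in (a k)..(a (k + 1)), ψ τ * (1 / (k * h)) := by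
    intro k hk
    have h1 : ∫ s in (-(h / 2))..(h / 2), φ (s + k * h) = ∫ τ in (a k)..(a (k + 1)), φ τ := by
      rw [intervalIntegral.integral_comp_add_right]
      congr 1 <;> simp only [ha] <;> push_cast <;> ring
    have h2 : ∫ s in (-(h / 2))..(h / 2), φ (s + -(k * h)) = ∫ τ in (a k)..(a (k + 1)), φ (-τ) := by
      rw [intervalIntegral.integral_comp_add_right, intervalIntegral.integral_comp_neg]
      congr 1 <;> simp only [ha] <;> push_cast <;> ring
    rw [h1, h2, intervalIntegral.integral_mul_const, hψ,
      intervalIntegral.integral_sub (LI_ii hφ _ _) (LI_ii (LI_neg hφ) _ _)]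
    have hk0 : (k : ℝ) ≠ 0 := by
      have := (Finset.mem_Icc.1 hk).1
      have : k ≠ 0 := by omega
      exact_mod_cast this
    field_simp
  rw [e1, Finset.sum_congr rfl e2, ← Finset.sum_sub_distrib]
  have e3 : ∀ k ∈ Finset.Icc n m, |(∫ τ in (a k)..(a (k + 1)), ψ τ / τ) -
      ∫ τ in (a k)..(a (k + 1)), ψ τ * (1 / (k * h))| ≤
      ∫ τ in (a k)..(a (k + 1)), |ψ τ| * (kv h τ / 2) := by
    intro k hk
    have hk1 : 1 ≤ k := hn.trans (Finset.mem_Icc.1 hk).1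
    have hkr : (1 : ℝ) ≤ k := by exact_mod_cast hk1
    rw [← intervalIntegral.integral_sub (hi1 hk1 (by omega)) ((LI_ii hψL _ _).mul_const _)]
    rw [← Real.norm_eq_abs]
    refine intervalIntegral.norm_integral_le_of_norm_le (hamono (by omega)) ?_ hi2
    refine ae_of_all _ fun τ hτ => ?_
    have hτ0 : 0 < τ := (hapos k hk1).trans hτ.1
    have hτ1 : ((k : ℝ) - 1/2) * h < τ := hτ.1
    have hτ2 : τ ≤ ((k : ℝ) + 1/2) * h := by
      have := hτ.2
      simp only [ha] at this
      push_cast at this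
      linarith
    rw [Real.norm_eq_abs, div_eq_mul_inv, ← mul_sub, abs_mul]
    refine mul_le_mul_of_nonneg_left ?_ (abs_nonneg _)
    have hkh : 0 < (k : ℝ) * h := by positivity
    have e : τ⁻¹ - 1 / (k * h) = (k * h - τ) / (τ * (k * h)) := by field_simp
    have e' : kv h τ / 2 = 5 * h / (h ^ 2 + τ ^ 2) := by unfold kv; field_simp; ring
    rw [e, e', abs_div, abs_of_pos (mul_pos hτ0 hkh), div_le_div_iff₀ (by positivity) (by positivity)]
    have h1 : |k * h - τ| ≤ h / 2 := by rw [abs_le]; constructor <;> linarith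
    have h2 : h / 2 ≤ τ := by nlinarith
    have h3 : 2 * τ ≤ 3 * (k * h) := by nlinarith
    calc |k * h - τ| * (h ^ 2 + τ ^ 2) ≤ h / 2 * (5 * τ ^ 2) := by
          apply mul_le_mul h1 _ (by positivity) (by positivity)
          nlinarith
      _ ≤ 5 * h * (τ * (k * h)) := by
          have : 0 ≤ h * τ := by positivity
          nlinarith
  have e4 : |∑ k ∈ Finset.Icc n m, ((∫ τ in (a k)..(a (k + 1)), ψ τ / τ) -
      ∫ τ in (a k)..(a (k + 1)), ψ τ * (1 / (k * h)))| ≤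
      ∫ τ in (a n)..(a (m + 1)), |ψ τ| * (kv h τ / 2) := by
    refine (Finset.abs_sum_le_sum_abs _ _).trans ((Finset.sum_le_sum e3).trans (le_of_eq ?_))
    rw [show Finset.Icc n m = Finset.Ico n (m + 1) by ext; simp]
    exact intervalIntegral.sum_integral_adjacent_intervals_Ico (by omega) (fun k hk => hi2)
  refine (ENNReal.ofReal_le_ofReal e4).trans ?_
  have hle : a n ≤ a (m + 1) := hamono (by omega)
  rw [intervalIntegral.integral_of_le hle,
    ofReal_integral_eq_lintegral_ofReal ((intervalIntegrable_iff_integrableOn_Ioc_of_le hle).1 hi2)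
      (ae_of_all _ fun τ => mul_nonneg (abs_nonneg _) (div_nonneg (kv_nonneg hh _) (by norm_num)))]
  set u : ℝ → ℝ≥0∞ := fun τ => ENNReal.ofReal |φ τ| * ENNReal.ofReal (kv h τ / 2) with hu
  have hkn : ∀ τ, kv h (-τ) = kv h τ := by intro τ; unfold kv; rw [neg_div, neg_sq]
  have hum : AEMeasurable u := by
    refine AEMeasurable.mul (f := fun τ => ENNReal.ofReal |φ τ|)
      (g := fun τ => ENNReal.ofReal (kv h τ / 2)) ?_ ?_
    · exact hφ.aestronglyMeasurable.aemeasurable.abs.ennreal_ofReal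
    · exact ((kv_meas h).div_const 2).ennreal_ofReal.aemeasurable
  calc ∫⁻ τ in Ioc (a n) (a (m + 1)), ENNReal.ofReal (|ψ τ| * (kv h τ / 2))
      ≤ ∫⁻ τ, ENNReal.ofReal (|ψ τ| * (kv h τ / 2)) := setLIntegral_le_lintegral _ _
    _ ≤ ∫⁻ τ, (u τ + u (-τ)) := by
        refine lintegral_mono fun τ => ?_
        simp only [hu, hkn]
        have hk2 : 0 ≤ kv h τ / 2 := div_nonneg (kv_nonneg hh _) (by norm_num)
        rw [← add_mul, ← ENNReal.ofReal_add (abs_nonneg _) (abs_nonneg _),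
          ← ENNReal.ofReal_mul (by positivity)]
        refine ENNReal.ofReal_le_ofReal (mul_le_mul_of_nonneg_right (abs_sub _ _) hk2)
    _ = (∫⁻ τ, u τ) + ∫⁻ τ, u (-τ) := lintegral_add_left' hum _
    _ = 2 * ∫⁻ τ, u τ := by
        rw [lintegral_neg_eq_self (μ := volume) u]; ring
    _ = ∫⁻ τ, 2 * u τ := (lintegral_const_mul'' _ hum).symm
    _ = _ := by
        refine lintegral_congr fun τ => ?_
        simp only [hu]
        rw [← mul_assoc, mul_comm (2 : ℝ≥0∞), mul_assoc]
        congr 1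
        rw [show (2 : ℝ≥0∞) = ENNReal.ofReal 2 by simp, ← ENNReal.ofReal_mul (by norm_num)]
        congr 1; ring

section
variable {X : Type*} [MeasurableSpace X] {μ : Measure X} {T : ℝ → X → X}

/-- averages along the orbit -/
def avg {X : Type*} (T : ℝ → X → X) (f : X → ℝ) (h : ℝ) (x : X) : ℝ :=
  1 / h * ∫ s in (-(h / 2))..(h / 2), f (T s x)

lemma avg_meas (hT : ErgodicFlow X μ T) {f : X → ℝ} (hf : Measurable f) {h : ℝ} (hh : 0 < h) :
    Measurable (avg T f h) := by
  unfold avg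
  refine Measurable.const_mul ?_ _
  simp only [intervalIntegral.integral_of_le (show -(h / 2) ≤ h / 2 by linarith)]
  exact ((hT.meas_joint hf).stronglyMeasurable.integral_prod_right').measurable

lemma avg_lint [SigmaFinite μ] (hT : ErgodicFlow X μ T) {f : X → ℝ} (hf : Measurable f) {h : ℝ}
    (hh : 0 < h) (p : ℕ) (hp : p = 1 ∨ p = 2) :
    ∫⁻ x, ENNReal.ofReal (|avg T f h x| ^ p) ∂μ ≤ ∫⁻ x, ENNReal.ofReal (|f x| ^ p) ∂μ := by
  set w : ℝ → ℝ≥0∞ := (Ioc (-(h / 2)) (h / 2)).indicator (fun _ => ENNReal.ofReal (1 / h)) with hw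
  have hwm : Measurable w := measurable_const.indicator measurableSet_Ioc
  have hg : Measurable (fun x => ENNReal.ofReal |f x|) := hf.abs.ennreal_ofReal
  have hle : -(h / 2) ≤ h / 2 := by linarith
  have h1 : ∀ x, ENNReal.ofReal |avg T f h x| ≤ ∫⁻ τ, ENNReal.ofReal |f (T τ x)| * w τ := by
    intro x
    unfold avg
    rw [abs_mul, abs_of_pos (by positivity), ENNReal.ofReal_mul (by positivity),
      intervalIntegral.integral_of_le hle]
    have h2 : ENNReal.ofReal |∫ s in Ioc (-(h / 2)) (h / 2), f (T s x)| ≤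
        ∫⁻ s in Ioc (-(h / 2)) (h / 2), ENNReal.ofReal |f (T s x)| := by
      have := enorm_integral_le_lintegral_enorm (μ := volume.restrict (Ioc (-(h / 2)) (h / 2)))
        (fun s => f (T s x))
      simpa only [Real.enorm_eq_ofReal_abs] using this
    refine (mul_le_mul_right h2 _).trans (le_of_eq ?_)
    rw [← lintegral_const_mul _ (hT.meas_orbit hg x), ← lintegral_indicator measurableSet_Ioc]
    refine lintegral_congr fun τ => ?_
    by_cases h : τ ∈ Ioc (-(h / 2)) (h / 2) <;> simp [hw, h, mul_comm]
  have h3 : ∫⁻ τ, w τ = 1 := by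
    rw [hw, lintegral_indicator_const measurableSet_Ioc, Real.volume_Ioc,
      ← ENNReal.ofReal_mul (by positivity)]
    rw [show 1 / h * (h / 2 - -(h / 2)) = 1 by field_simp; ring]
    simp
  have h4 := flow_conv hT hg hwm p hp
  rw [h3, one_pow, mul_one] at h4
  simp only [ENNReal.ofReal_pow (abs_nonneg _)]
  exact (lintegral_mono fun x => pow_le_pow_left' (h1 x) p).trans h4

lemma flow_max_h [SigmaFinite μ] (hT : ErgodicFlow X μ T) {f : X → ℝ} (hf : Measurable f)
    (p : ℕ) (hp : p = 1 ∨ p = 2) (hfi : ∫⁻ x, ENNReal.ofReal (|f x| ^ p) ∂μ ≠ ∞)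
    {h : ℝ} (hh : 0 < h) {l : ℝ} (hl : 0 < l) :
    ENNReal.ofReal (l ^ p) * μ {x | ∃ n m : ℕ, 1 ≤ n ∧ n ≤ m ∧
      l < |hI T f (((n : ℝ) - 1/2) * h) (((m : ℝ) + 1/2) * h) x|} ≤
      ENNReal.ofReal (10 ^ 9) * ∫⁻ x, ENNReal.ofReal (|f x| ^ p) ∂μ := by
  set U : ℤ → X → X := fun k => T (k * h) with hU
  set F := avg T f h with hF
  set M := ∫⁻ x, ENNReal.ofReal (|f x| ^ p) ∂μ with hM
  have hg : Measurable (fun x => ENNReal.ofReal |f x|) := hf.abs.ennreal_ofReal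
  have hkm : Measurable (fun τ => ENNReal.ofReal (kv h τ)) := (kv_meas h).ennreal_ofReal
  set R : X → ℝ≥0∞ := fun x => ∫⁻ τ, ENNReal.ofReal |f (T τ x)| * ENNReal.ofReal (kv h τ) with hR
  have hRm : Measurable R :=
    ((hT.meas_joint hg).mul (hkm.comp measurable_snd)).lintegral_prod_right'
  have hl2 := half_pos hl
  set A := {x | ∃ n m : ℕ, 1 ≤ n ∧ n ≤ m ∧ l / 2 < |dS U F n m x|} with hA
  set B := {x | ENNReal.ofReal (l / 2) ^ p ≤ R x ^ p} with hB
  have hUadd : ∀ j k x, U (j + k) x = U j (U k x) := by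
    intro j k x
    simp only [hU]
    rw [← hT.map_add]; push_cast; congr 1; ring
  have hAb : ENNReal.ofReal ((l / 2) ^ p) * μ A ≤ ENNReal.ofReal (2 * 10 ^ 7) * M := by
    refine (trans_Z p hp U (fun k => hT.preserving _) hUadd F (avg_meas hT hf hh) hl2).trans ?_
    gcongr
    exact avg_lint hT hf hh p hp
  have hBb : ENNReal.ofReal ((l / 2) ^ p) * μ B ≤ ENNReal.ofReal (10 ^ 7) * M := by
    rw [ENNReal.ofReal_pow hl2.le]
    refine (mul_meas_ge_le_lintegral (hRm.pow_const p) _).trans ?_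
    refine (flow_conv hT hg hkm p hp).trans ?_
    simp only [← ENNReal.ofReal_pow (abs_nonneg _)]
    rw [mul_comm]
    gcongr
    refine (pow_le_pow_left' (kv_lint hh) p).trans ?_
    rw [← ENNReal.ofReal_pow (by norm_num)]
    refine ENNReal.ofReal_le_ofReal ?_
    rcases hp with rfl | rfl <;> norm_num
  have hsub : {x | ∃ n m : ℕ, 1 ≤ n ∧ n ≤ m ∧
      l < |hI T f (((n : ℝ) - 1/2) * h) (((m : ℝ) + 1/2) * h) x|} ⊆ {x | ¬ LI T f x} ∪ (A ∪ B) := by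
    rintro x ⟨n, m, hn, hnm, hx⟩
    by_cases hL : LI T f x
    swap
    · exact Or.inl hL
    right
    by_contra hcon
    rw [mem_union, not_or] at hcon
    obtain ⟨h1, h2⟩ := hcon
    have h1' : |dS U F n m x| ≤ l / 2 := by
      by_contra! h
      exact h1 ⟨n, m, hn, hnm, h⟩
    have h2' : R x < ENNReal.ofReal (l / 2) := by
      by_contra! h
      exact h2 (pow_le_pow_left' h p)
    have hc := cmp_aux hL hh hn hnm
    have e : dS U F n m x = ∑ k ∈ Finset.Icc n m,
        ((1 / h * ∫ s in (-(h / 2))..(h / 2), f (T (s + k * h) x)) -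
        (1 / h * ∫ s in (-(h / 2))..(h / 2), f (T (s + -(k * h)) x))) / (k : ℝ) := by
      unfold dS
      refine Finset.sum_congr rfl fun k _ => ?_
      simp only [hF, avg, hU, hT.map_add]
      push_cast
      simp only [neg_mul]
    rw [← e] at hc
    have h3 := (hc.trans_lt h2')
    rw [ENNReal.ofReal_lt_ofReal_iff hl2] at h3
    unfold hI at hx
    have := abs_sub_abs_le_abs_sub (∫ τ in (((n : ℝ) - 1/2) * h)..(((m : ℝ) + 1/2) * h),
      (f (T τ x) - f (T (-τ) x)) / τ) (dS U F n m x)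
    linarith
  have hnull : μ {x | ¬ LI T f x} = 0 := ae_LI hT hf p hp hfi
  have hm : μ {x | ∃ n m : ℕ, 1 ≤ n ∧ n ≤ m ∧
      l < |hI T f (((n : ℝ) - 1/2) * h) (((m : ℝ) + 1/2) * h) x|} ≤ μ A + μ B := by
    refine (measure_mono hsub).trans ((measure_union_le _ _).trans ?_)
    rw [hnull, zero_add]
    exact measure_union_le _ _
  have hlp : ENNReal.ofReal (l ^ p) ≤ ENNReal.ofReal 4 * ENNReal.ofReal ((l / 2) ^ p) := by
    rw [← ENNReal.ofReal_mul (by norm_num)]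
    refine ENNReal.ofReal_le_ofReal ?_
    rcases hp with rfl | rfl
    · linarith [pow_one l, pow_one (l / 2)]
    · nlinarith
  calc _ ≤ ENNReal.ofReal 4 * ENNReal.ofReal ((l / 2) ^ p) * (μ A + μ B) := by gcongr
    _ = ENNReal.ofReal 4 * (ENNReal.ofReal ((l / 2) ^ p) * μ A +
        ENNReal.ofReal ((l / 2) ^ p) * μ B) := by ring
    _ ≤ ENNReal.ofReal 4 * (ENNReal.ofReal (2 * 10 ^ 7) * M + ENNReal.ofReal (10 ^ 7) * M) := by
        gcongr
    _ = ENNReal.ofReal (4 * (2 * 10 ^ 7 + 10 ^ 7)) * M := by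
        rw [← add_mul, ← ENNReal.ofReal_add (by norm_num) (by norm_num), ← mul_assoc,
          ← ENNReal.ofReal_mul (by norm_num)]
    _ ≤ _ := by
        gcongr
        norm_num

lemma hI_ii {f : X → ℝ} {x : X} (hL : LI T f x) {a b : ℝ} (ha : 0 < a) (hb : 0 < b) :
    IntervalIntegrable (fun τ => (f (T τ x) - f (T (-τ) x)) / τ) volume a b := by
  simp only [div_eq_mul_inv]
  refine LI_mul_cont (φ := fun τ => f (T τ x) - f (T (-τ) x)) (LocallyIntegrable.sub hL (LI_neg hL))
    (continuousOn_id.inv₀ fun y hy => ?_)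
  have : 0 < y := (lt_min ha hb).trans_le hy.1
  exact this.ne'

lemma hI_cont {f : X → ℝ} {x : X} (hL : LI T f x) {a b : ℝ} (ha : 0 < a) (hb : 0 < b) {l : ℝ}
    (h : l < |hI T f a b x|) :
    ∃ ε > 0, ∀ a' b', |a' - a| < ε → |b' - b| < ε → l < |hI T f a' b' x| := by
  -- primitive
  have hP : ∀ c, 0 < c → ContinuousAt (fun y => hI T f 1 y x) c := by
    intro c hc
    have h0 : (0 : ℝ) < min (c / 2) (1 / 2) := by positivity
    have hi := hI_ii hL h0 (show (0 : ℝ) < max (c + 1) 2 by positivity)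
    have hmem : ∀ y, min (c / 2) (1 / 2) ≤ y → y ≤ max (c + 1) 2 →
        y ∈ uIcc (min (c / 2) (1 / 2)) (max (c + 1) 2) := by
      intro y h1 h2
      exact mem_uIcc_of_le h1 h2
    have hco := intervalIntegral.continuousOn_primitive_interval' hi (a := 1)
      (hmem 1 ((min_le_right _ _).trans (by norm_num)) (by apply le_max_of_le_right; norm_num))
    refine hco.continuousAt ?_
    rw [uIcc_of_le ((min_le_right _ _).trans (by apply le_max_of_le_right; norm_num))]
    refine Icc_mem_nhds ((min_le_left _ _).trans_lt (by linarith)) (lt_max_of_lt_left (by linarith))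
  have hsum : ∀ a' b', 0 < a' → 0 < b' → hI T f a' b' x = hI T f 1 b' x - hI T f 1 a' x := by
    intro a' b' ha' hb'
    unfold hI
    rw [intervalIntegral.integral_interval_sub_left (hI_ii hL one_pos hb') (hI_ii hL one_pos ha')]
  have hη : 0 < |hI T f a b x| - l := by linarith
  obtain ⟨ε1, he1, h1⟩ := Metric.continuousAt_iff.1 (hP a ha) _ (half_pos hη)
  obtain ⟨ε2, he2, h2⟩ := Metric.continuousAt_iff.1 (hP b hb) _ (half_pos hη)
  refine ⟨min (min ε1 ε2) (min a b), by positivity, fun a' b' h3 h4 => ?_⟩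
  have h5 : 0 < a' := by
    have := h3.trans_le ((min_le_right _ _).trans (min_le_left _ _))
    rw [abs_lt] at this; linarith [this.1]
  have h6 : 0 < b' := by
    have := h4.trans_le ((min_le_right _ _).trans (min_le_right _ _))
    rw [abs_lt] at this; linarith [this.1]
  have h7 := h1 (x := a') (h3.trans_le ((min_le_left _ _).trans (min_le_left _ _)))
  have h8 := h2 (x := b') (h4.trans_le ((min_le_left _ _).trans (min_le_right _ _)))
  rw [Real.dist_eq] at h7 h8
  have e1 := hsum a' b' h5 h6
  have e2 := hsum a b ha hb
  have : |hI T f a b x - hI T f a' b' x| < |hI T f a b x| - l := by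
    rw [abs_lt] at h7 h8 ⊢
    constructor <;> linarith [h7.1, h7.2, h8.1, h8.2]
  have h9 := abs_sub_abs_le_abs_sub (hI T f a b x) (hI T f a' b' x)
  linarith

lemma flow_max [SigmaFinite μ] (hT : ErgodicFlow X μ T) {f : X → ℝ} (hf : Measurable f)
    (p : ℕ) (hp : p = 1 ∨ p = 2) {l : ℝ} (hl : 0 < l) :
    ENNReal.ofReal (l ^ p) * μ {x | ∃ a b : ℝ, 0 < a ∧ a < b ∧ l < |hI T f a b x|} ≤
      ENNReal.ofReal (10 ^ 9) * ∫⁻ x, ENNReal.ofReal (|f x| ^ p) ∂μ := by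
  by_cases hfi : ∫⁻ x, ENNReal.ofReal (|f x| ^ p) ∂μ = ∞
  · rw [hfi, ENNReal.mul_top]
    · exact le_top
    · simp
  set Eh : ℕ → Set X := fun j => {x | ∃ n m : ℕ, 1 ≤ n ∧ n ≤ m ∧
      l < |hI T f (((n : ℝ) - 1/2) * (1 / ((j : ℝ) + 1))) (((m : ℝ) + 1/2) * (1 / ((j : ℝ) + 1))) x|}
    with hEh
  set G : ℕ → Set X := fun J => {x | ∀ j ≥ J, x ∈ Eh j} with hG
  have hsub : {x | ∃ a b : ℝ, 0 < a ∧ a < b ∧ l < |hI T f a b x|} ⊆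
      {x | ¬ LI T f x} ∪ ⋃ J, G J := by
    rintro x ⟨a, b, ha, hab, hx⟩
    by_cases hL : LI T f x
    swap
    · exact Or.inl hL
    right
    obtain ⟨ε, hε, hloc⟩ := hI_cont hL ha (ha.trans hab) hx
    obtain ⟨J, hJ⟩ := exists_nat_one_div_lt (show 0 < min ε (b - a) by
      apply lt_min hε; linarith)
    refine mem_iUnion.2 ⟨J, fun j hj => ?_⟩
    have hhj : 1 / ((j : ℝ) + 1) < min ε (b - a) := lt_of_le_of_lt (by
      have : (J : ℝ) ≤ j := by exact_mod_cast hj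
      apply one_div_le_one_div_of_le (by positivity); linarith) hJ
    set h := 1 / ((j : ℝ) + 1) with hh
    have hh0 : 0 < h := by positivity
    have hh1 : h < ε := hhj.trans_le (min_le_left _ _)
    have hh2 : h < b - a := hhj.trans_le (min_le_right _ _)
    have key : ∀ c, 0 < c → |((⌊c / h⌋₊ : ℝ) + 1/2) * h - c| < ε := by
      intro c hc
      have h1 := Nat.floor_le (show 0 ≤ c / h by positivity)
      have h2 := Nat.lt_floor_add_one (c / h)
      rw [le_div_iff₀ hh0] at h1
      rw [div_lt_iff₀ hh0] at h2
      rw [abs_lt]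
      constructor <;> nlinarith
    refine ⟨⌊a / h⌋₊ + 1, ⌊b / h⌋₊, by omega, ?_, ?_⟩
    · rw [Nat.le_floor_iff (by have := ha.trans hab; positivity), le_div_iff₀ hh0]
      have h1 := Nat.floor_le (show 0 ≤ a / h by positivity)
      rw [le_div_iff₀ hh0] at h1
      push_cast
      linarith
    · apply hloc
      · have := key a ha
        push_cast
        rwa [show ((⌊a / h⌋₊ : ℝ) + 1 - 1 / 2) * h = ((⌊a / h⌋₊ : ℝ) + 1 / 2) * h by ring]
      · exact key b (ha.trans hab)
  have hnull : μ {x | ¬ LI T f x} = 0 := ae_LI hT hf p hp hfi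
  have hmono : Monotone G := by
    intro J J' hJ x hx j hj
    exact hx j (le_trans hJ hj)
  have : μ {x | ∃ a b : ℝ, 0 < a ∧ a < b ∧ l < |hI T f a b x|} ≤ ⨆ J, μ (G J) := by
    refine (measure_mono hsub).trans ((measure_union_le _ _).trans ?_)
    rw [hnull, zero_add, hmono.measure_iUnion]
  refine (mul_le_mul_right this _).trans ?_
  rw [ENNReal.mul_iSup]
  refine iSup_le fun J => ?_
  have hGE : G J ⊆ Eh J := fun x hx => hx J le_rfl
  exact (mul_le_mul_right (measure_mono hGE) _).trans
    (flow_max_h hT hf p hp hfi (by positivity) hl)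
end

section
variable {X : Type*} [MeasurableSpace X] {μ : Measure X} {T : ℝ → X → X}

/-- an a.e. property holds a.e. along a.e. orbit -/
lemma ae_orbit [SigmaFinite μ] (hT : ErgodicFlow X μ T) {P : X → Prop} (hP : ∀ᵐ x ∂μ, P x) :
    ∀ᵐ x ∂μ, ∀ᵐ τ : ℝ, P (T τ x) := by
  obtain ⟨N, hN, hNm, hN0⟩ := exists_measurable_superset_of_null (ae_iff.1 hP)
  have h := flow_tonelli hT (g := N.indicator (fun _ => 1)) (measurable_const.indicator hNm)
    (w := fun _ => 1) measurable_const
  rw [lintegral_indicator_const hNm, hN0] at h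
  simp only [mul_one, mul_zero, zero_mul] at h
  rw [lintegral_eq_zero_iff] at h
  · filter_upwards [h] with x hx
    have hx' : ∫⁻ τ, N.indicator (fun _ => (1 : ℝ≥0∞)) (T τ x) = 0 := hx
    rw [lintegral_eq_zero_iff (hT.meas_orbit (measurable_const.indicator hNm) x)] at hx'
    filter_upwards [hx'] with τ hτ
    by_contra hc
    have : T τ x ∈ N := hN hc
    simp [this] at hτ
  · exact (hT.meas_joint (measurable_const.indicator hNm)).lintegral_prod_right'

lemma ae_neg_real {P : ℝ → Prop} (h : ∀ᵐ τ : ℝ, P τ) : ∀ᵐ τ : ℝ, P (-τ) :=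
  (Measure.measurePreserving_neg (volume : Measure ℝ)).quasiMeasurePreserving.ae h

lemma hI_congr_ae [SigmaFinite μ] (hT : ErgodicFlow X μ T) {u v : X → ℝ} (h : u =ᵐ[μ] v) :
    ∀ᵐ x ∂μ, ∀ a b, hI T u a b x = hI T v a b x := by
  filter_upwards [ae_orbit hT h] with x hx a b
  unfold hI
  refine intervalIntegral.integral_congr_ae ?_
  filter_upwards [hx, ae_neg_real hx] with τ h1 h2 _
  rw [h1, h2]

lemma hI_sub {f g : X → ℝ} {x : X} (hf : LI T f x) (hg : LI T g x) {a b : ℝ} (ha : 0 < a)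
    (hb : 0 < b) : hI T (fun y => f y - g y) a b x = hI T f a b x - hI T g a b x := by
  unfold hI
  rw [← intervalIntegral.integral_sub (hI_ii hf ha hb) (hI_ii hg ha hb)]
  congr 1
  funext τ
  ring

lemma hI_add {f g : X → ℝ} {x : X} (hf : LI T f x) (hg : LI T g x) {a b : ℝ} (ha : 0 < a)
    (hb : 0 < b) : hI T (fun y => f y + g y) a b x = hI T f a b x + hI T g a b x := by
  unfold hI
  rw [← intervalIntegral.integral_add (hI_ii hf ha hb) (hI_ii hg ha hb)]
  congr 1
  funext τ
  ring

lemma hI_smul {f : X → ℝ} {x : X} (c : ℝ) {a b : ℝ} :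
    hI T (fun y => c * f y) a b x = c * hI T f a b x := by
  unfold hI
  rw [← intervalIntegral.integral_const_mul]
  congr 1
  funext τ
  ring

/-- Cauchy condition along a family of pairs -/
def QGood {X : Type*} (Q : ℕ → ℝ → ℝ → Prop) (T : ℝ → X → X) (f : X → ℝ) (x : X) : Prop :=
  ∀ ε : ℝ, 0 < ε → ∃ n, ∀ a b, Q n a b → |hI T f a b x| ≤ ε

/-- admissible family of pairs -/
def QAdm (Q : ℕ → ℝ → ℝ → Prop) : Prop :=
  (∀ n a b, Q n a b → 0 < a ∧ a < b) ∧ ∀ n m a b, n ≤ m → Q m a b → Q n a b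

lemma QGood_add {Q : ℕ → ℝ → ℝ → Prop} (hQ : QAdm Q) {f g : X → ℝ} {x : X} (hf : LI T f x)
    (hg : LI T g x) (h1 : QGood Q T f x) (h2 : QGood Q T g x) :
    QGood Q T (fun y => f y + g y) x := by
  intro ε hε
  obtain ⟨n, hn⟩ := h1 (ε / 2) (by positivity)
  obtain ⟨m, hm⟩ := h2 (ε / 2) (by positivity)
  refine ⟨max n m, fun a b hab => ?_⟩
  have := hQ.1 _ _ _ hab
  rw [hI_add hf hg this.1 (this.1.trans this.2)]
  have e1 := hn a b (hQ.2 _ _ _ _ (le_max_left _ _) hab)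
  have e2 := hm a b (hQ.2 _ _ _ _ (le_max_right _ _) hab)
  exact (abs_add_le _ _).trans (by linarith)

lemma QGood_smul {Q : ℕ → ℝ → ℝ → Prop} {f : X → ℝ} {x : X} (c : ℝ) (h1 : QGood Q T f x) :
    QGood Q T (fun y => c * f y) x := by
  intro ε hε
  obtain ⟨n, hn⟩ := h1 (ε / (|c| + 1)) (by positivity)
  refine ⟨n, fun a b hab => ?_⟩
  rw [hI_smul, abs_mul]
  have := hn a b hab
  calc |c| * |hI T f a b x| ≤ (|c| + 1) * (ε / (|c| + 1)) := by gcongr; linarith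
    _ = ε := by field_simp

lemma QGood_congr [SigmaFinite μ] (hT : ErgodicFlow X μ T) {Q : ℕ → ℝ → ℝ → Prop} {u v : X → ℝ}
    (h : u =ᵐ[μ] v) (hu : ∀ᵐ x ∂μ, QGood Q T u x) : ∀ᵐ x ∂μ, QGood Q T v x := by
  filter_upwards [hI_congr_ae hT h, hu] with x h1 h2 ε hε
  obtain ⟨n, hn⟩ := h2 ε hε
  exact ⟨n, fun a b hab => by rw [← h1]; exact hn a b hab⟩

lemma banach_principle [SigmaFinite μ] (hT : ErgodicFlow X μ T) {Q : ℕ → ℝ → ℝ → Prop}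
    (hQ : QAdm Q) {f : X → ℝ} (hf : Measurable f) (hfL : ∀ᵐ x ∂μ, LI T f x)
    (p : ℕ) (hp : p = 1 ∨ p = 2)
    (happ : ∀ ε : ℝ≥0∞, ε ≠ 0 → ∃ g : X → ℝ, Measurable g ∧ (∀ᵐ x ∂μ, LI T g x) ∧
      (∀ᵐ x ∂μ, QGood Q T g x) ∧ ∫⁻ x, ENNReal.ofReal (|f x - g x| ^ p) ∂μ ≤ ε) :
    ∀ᵐ x ∂μ, QGood Q T f x := by
  have key : ∀ k : ℕ, ∀ᵐ x ∂μ, ∃ n, ∀ a b, Q n a b → |hI T f a b x| ≤ 2 * (1 / ((k : ℝ) + 1)) := by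
    intro k
    set l : ℝ := 1 / ((k : ℝ) + 1) with hl
    have hl0 : 0 < l := by positivity
    rw [ae_iff]
    set B := {x | ¬ ∃ n, ∀ a b, Q n a b → |hI T f a b x| ≤ 2 * l} with hB
    have hbound : ∀ ε : ℝ≥0∞, ε ≠ 0 → ENNReal.ofReal (l ^ p) * μ B ≤ ENNReal.ofReal (10 ^ 9) * ε := by
      intro ε hε
      obtain ⟨g, hg, hgL, hgG, hge⟩ := happ ε hε
      have hm := flow_max hT (hf.sub hg) p hp hl0
      have hsub : μ B ≤ μ {x | ∃ a b : ℝ, 0 < a ∧ a < b ∧ l < |hI T (f - g) a b x|} := by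
        refine measure_mono_ae ?_
        filter_upwards [hfL, hgL, hgG] with x h1 h2 h3 hx
        obtain ⟨n, hn⟩ := h3 l hl0
        have hx' : ¬ ∃ n, ∀ a b, Q n a b → |hI T f a b x| ≤ 2 * l := hx
        push Not at hx'
        obtain ⟨a, b, hab, hlt⟩ := hx' n
        have h4 := hQ.1 _ _ _ hab
        refine ⟨a, b, h4.1, h4.2, ?_⟩
        have h5 := hI_sub h1 h2 h4.1 (h4.1.trans h4.2)
        change l < |hI T (fun y => f y - g y) a b x|
        rw [h5]
        have := abs_sub_abs_le_abs_sub (hI T f a b x) (hI T g a b x)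
        linarith [hn a b hab]
      calc _ ≤ _ := mul_le_mul_right hsub _
        _ ≤ _ := hm
        _ ≤ _ := mul_le_mul_right hge _
    have hz : ENNReal.ofReal (l ^ p) * μ B = 0 := by
      by_contra hne
      set y := ENNReal.ofReal (l ^ p) * μ B with hy
      have hc : ENNReal.ofReal (10 ^ 9) ≠ 0 := by simp
      have hct : ENNReal.ofReal (10 ^ 9) ≠ ∞ := ENNReal.ofReal_ne_top
      have h1 := hbound 1 one_ne_zero
      have hyt : y ≠ ∞ := ne_top_of_le_ne_top (by simp) h1
      have h2 := hbound (y / 2 / ENNReal.ofReal (10 ^ 9)) (by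
        refine ENNReal.div_ne_zero.2 ⟨ENNReal.div_ne_zero.2 ⟨hne, by simp⟩, hct⟩)
      rw [ENNReal.mul_div_cancel hc hct] at h2
      exact absurd h2 (not_le.2 (ENNReal.half_lt_self hne hyt))
    rcases mul_eq_zero.1 hz with h | h
    · rw [ENNReal.ofReal_eq_zero] at h
      have : 0 < l ^ p := by positivity
      linarith
    · exact h
  rw [← ae_all_iff] at key
  filter_upwards [key] with x hx ε hε
  obtain ⟨k, hk⟩ := exists_nat_one_div_lt (half_pos hε)
  obtain ⟨n, hn⟩ := hx k
  exact ⟨n, fun a b hab => (hn a b hab).trans (by linarith)⟩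
end

section
variable {X : Type*} [MeasurableSpace X] {μ : Measure X} {T : ℝ → X → X}

lemma LI_bdd (hT : ErgodicFlow X μ T) {f : X → ℝ} (hf : Measurable f) {M : ℝ}
    (hM : ∀ x, |f x| ≤ M) (x : X) : LI T f x := by
  refine (locallyIntegrable_const M).mono (hT.meas_orbit hf x).aestronglyMeasurable ?_
  refine Eventually.of_forall fun τ => ?_
  rw [Real.norm_eq_abs, Real.norm_eq_abs]
  exact (hM _).trans (le_abs_self M)

/-- small pairs -/
def QS (n : ℕ) (a b : ℝ) : Prop := 0 < a ∧ a < b ∧ b < 1 / ((n : ℝ) + 1)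

/-- large pairs -/
def QL (n : ℕ) (a b : ℝ) : Prop := (n : ℝ) + 1 < a ∧ a < b

lemma QS_adm : QAdm QS := by
  refine ⟨fun n a b h => ⟨h.1, h.2.1⟩, fun n m a b hnm h => ⟨h.1, h.2.1, h.2.2.trans_le ?_⟩⟩
  have : (n : ℝ) ≤ m := by exact_mod_cast hnm
  gcongr

lemma QL_adm : QAdm QL := by
  refine ⟨fun n a b h => ⟨lt_trans (by positivity) h.1, h.2⟩, fun n m a b hnm h => ⟨lt_of_le_of_lt ?_ h.1, h.2⟩⟩
  have : (n : ℝ) ≤ m := by exact_mod_cast hnm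
  gcongr

lemma avg_shift (hT : ErgodicFlow X μ T) {f : X → ℝ} (h τ : ℝ) (x : X) :
    avg T f h (T τ x) = 1 / h * ∫ s in (-(h/2) + τ)..(h/2 + τ), f (T s x) := by
  unfold avg
  rw [← intervalIntegral.integral_comp_add_right (fun s => f (T s x))]
  simp only [hT.map_add]

lemma avg_QS (hT : ErgodicFlow X μ T) {f : X → ℝ} (hf : Measurable f) {M : ℝ}
    (hM : ∀ x, |f x| ≤ M) {h : ℝ} (hh : 0 < h) (x : X) : QGood QS T (avg T f h) x := by
  have hM0 : 0 ≤ M := (abs_nonneg _).trans (hM x)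
  have hL := LI_bdd hT hf hM x
  have hdiff : ∀ τ : ℝ, 0 < τ → |avg T f h (T τ x) - avg T f h (T (-τ) x)| ≤ 4 * M / h * τ := by
    intro τ hτ
    rw [avg_shift hT, avg_shift hT, ← mul_sub, intervalIntegral.integral_interval_sub_interval_comm
      (LI_ii hL _ _) (LI_ii hL _ _) (LI_ii hL _ _)]
    have e1 : ∀ c d : ℝ, |∫ s in c..d, f (T s x)| ≤ M * |d - c| := fun c d => by
      have := intervalIntegral.norm_integral_le_of_norm_le_const (a := c) (b := d)
        (f := fun s => f (T s x)) (C := M) (fun s _ => by rw [Real.norm_eq_abs]; exact hM _)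
      simpa using this
    rw [abs_mul, abs_of_pos (show 0 < 1 / h by positivity)]
    have a1 := e1 (-(h/2) + τ) (-(h/2) + -τ)
    have a2 := e1 (h/2 + τ) (h/2 + -τ)
    have b1 : |(-(h/2) + -τ) - (-(h/2) + τ)| = 2 * τ := by
      rw [abs_of_neg] <;> linarith
    have b2 : |(h/2 + -τ) - (h/2 + τ)| = 2 * τ := by
      rw [abs_of_neg] <;> linarith
    rw [b1] at a1
    rw [b2] at a2
    have := abs_sub (∫ s in (-(h/2) + τ)..(-(h/2) + -τ), f (T s x)) (∫ s in (h/2 + τ)..(h/2 + -τ), f (T s x))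
    calc _ ≤ 1 / h * (4 * M * τ) := by gcongr; linarith
      _ = _ := by ring
  intro ε hε
  obtain ⟨n, hn⟩ := exists_nat_one_div_lt (show 0 < ε / (4 * M / h + 1) by positivity)
  refine ⟨n, fun a b hab => ?_⟩
  obtain ⟨ha, hab', hb⟩ := hab
  have := intervalIntegral.norm_integral_le_of_norm_le_const (a := a) (b := b)
    (f := fun τ => (avg T f h (T τ x) - avg T f h (T (-τ) x)) / τ) (C := 4 * M / h) (fun τ hτ => by
      rw [uIoc_of_le hab'.le] at hτ
      have hτ0 : 0 < τ := ha.trans hτ.1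
      rw [Real.norm_eq_abs, abs_div, abs_of_pos hτ0, div_le_iff₀ hτ0]
      exact hdiff τ hτ0)
  unfold hI
  rw [Real.norm_eq_abs] at this
  refine this.trans ?_
  rw [abs_of_pos (by linarith)]
  have hlt : b - a < ε / (4 * M / h + 1) := by linarith
  have h0 : 0 ≤ 4 * M / h := by positivity
  calc 4 * M / h * (b - a) ≤ (4 * M / h + 1) * (ε / (4 * M / h + 1)) := by
        gcongr <;> linarith
    _ = ε := by field_simp

lemma avg_tendsto [SigmaFinite μ] (hT : ErgodicFlow X μ T) {f : X → ℝ} (hf : Measurable f) {M : ℝ}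
    (hM : ∀ x, |f x| ≤ M) :
    ∀ᵐ x ∂μ, Tendsto (fun n : ℕ => avg T f (1 / ((n : ℝ) + 1)) x) atTop (𝓝 (f x)) := by
  have hpos : ∀ n : ℕ, 0 < 1 / ((n : ℝ) + 1) := fun n => by positivity
  set N := {x | ¬ Tendsto (fun n : ℕ => avg T f (1 / ((n : ℝ) + 1)) x) atTop (𝓝 (f x))} with hN
  have hNm : MeasurableSet N := by
    have h1 : N = {x | Tendsto (fun n : ℕ => avg T f (1 / ((n : ℝ) + 1)) x - f x) atTop (𝓝 0)}ᶜ := by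
      ext x
      simp only [hN, mem_compl_iff, Set.mem_ofPred_eq]
      rw [tendsto_sub_nhds_zero_iff]
    rw [h1]
    refine MeasurableSet.compl ?_
    exact measurableSet_tendsto (𝓝 0) (fun n => (avg_meas hT hf (hpos n)).sub hf)
  have horb : ∀ x, ∀ᵐ τ : ℝ, T τ x ∉ N := by
    intro x
    have hL := LI_bdd hT hf hM x
    filter_upwards [LocallyIntegrable.ae_hasDerivAt_integral hL] with τ hτ
    have hd := (hasDerivAt_iff_tendsto_slope_zero.1 (hτ 0))
    simp only [hN, Set.mem_ofPred_eq, not_not]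
    have hseq : Tendsto (fun n : ℕ => 1 / ((n : ℝ) + 1) / 2) atTop (𝓝[≠] 0) := by
      refine tendsto_nhdsWithin_iff.2 ⟨?_, Eventually.of_forall fun n => (by have := hpos n; positivity : 1 / ((n : ℝ) + 1) / 2 ≠ 0)⟩
      simpa using tendsto_one_div_add_atTop_nhds_zero_nat.div_const (2 : ℝ)
    have hseq' : Tendsto (fun n : ℕ => -(1 / ((n : ℝ) + 1) / 2)) atTop (𝓝[≠] 0) := by
      refine tendsto_nhdsWithin_iff.2 ⟨?_, Eventually.of_forall fun n => (by have := hpos n; exact neg_ne_zero.2 (by positivity) : -(1 / ((n : ℝ) + 1) / 2) ≠ 0)⟩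
      simpa using (tendsto_one_div_add_atTop_nhds_zero_nat.div_const (2 : ℝ)).neg
    have ht := ((hd.comp hseq).add (hd.comp hseq')).const_mul (1/2 : ℝ)
    have e : 1 / 2 * (f (T τ x) + f (T τ x)) = f (T τ x) := by ring
    rw [e] at ht
    refine ht.congr fun n => ?_
    simp only [Function.comp, smul_eq_mul]
    rw [avg_shift hT]
    have hn := hpos n
    set h := 1 / ((n : ℝ) + 1) with hh
    have e1 : ∫ s in (-(h/2) + τ)..(h/2 + τ), f (T s x) =
        (∫ s in (0:ℝ)..(τ + h/2), f (T s x)) - ∫ s in (0:ℝ)..(τ + -(h/2)), f (T s x) := by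
      rw [intervalIntegral.integral_interval_sub_left (LI_ii hL _ _) (LI_ii hL _ _)]
      congr 1 <;> ring
    rw [e1]
    have : h ≠ 0 := hn.ne'
    field_simp
    ring
  have h := flow_tonelli hT (g := N.indicator (fun _ => 1)) (measurable_const.indicator hNm)
    (w := (Icc (0:ℝ) 1).indicator fun _ => 1) (measurable_const.indicator measurableSet_Icc)
  have h0 : ∀ x, ∫⁻ τ, N.indicator (fun _ => (1:ℝ≥0∞)) (T τ x) * (Icc (0:ℝ) 1).indicator (fun _ => 1) τ = 0 := by
    intro x
    rw [lintegral_congr_ae (g := fun _ => 0), lintegral_zero]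
    filter_upwards [horb x] with τ hτ
    simp [hτ]
  simp only [h0, lintegral_zero] at h
  rw [lintegral_indicator_const hNm, lintegral_indicator_const measurableSet_Icc] at h
  simp at h
  rw [ae_iff]
  exact h.symm

lemma QS_bdd [SigmaFinite μ] (hT : ErgodicFlow X μ T) {f : X → ℝ} (hf : Measurable f) {M : ℝ}
    (h0 : ∀ x, 0 ≤ f x) (hM : ∀ x, |f x| ≤ M) (hfi : ∫⁻ x, ENNReal.ofReal (f x) ∂μ ≠ ∞) :
    ∀ᵐ x ∂μ, QGood QS T f x := by
  have hpos : ∀ n : ℕ, 0 < 1 / ((n : ℝ) + 1) := fun n => by positivity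
  refine banach_principle hT QS_adm hf (Eventually.of_forall (LI_bdd hT hf hM)) 1 (Or.inl rfl) ?_
  intro ε hε
  have hlim : Tendsto (fun n : ℕ => ∫⁻ x, ENNReal.ofReal (f x - avg T f (1 / ((n : ℝ) + 1)) x) ∂μ)
      atTop (𝓝 (∫⁻ x, 0 ∂μ)) := by
    refine tendsto_lintegral_of_dominated_convergence (fun x => ENNReal.ofReal (f x))
      (fun n => ((hf.sub (avg_meas hT hf (hpos n)))).ennreal_ofReal) ?_ hfi ?_
    · intro n
      refine Eventually.of_forall fun x => ?_
      refine ENNReal.ofReal_le_ofReal ?_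
      have : 0 ≤ avg T f (1 / ((n : ℝ) + 1)) x := by
        unfold avg
        have := hpos n
        refine mul_nonneg (by positivity) (intervalIntegral.integral_nonneg (by linarith) fun s _ => h0 _)
      linarith
    · filter_upwards [avg_tendsto hT hf hM] with x hx
      have := ENNReal.tendsto_ofReal (hx.const_sub (f x))
      simpa using this
  rw [lintegral_zero] at hlim
  have hev := (ENNReal.tendsto_nhds_zero.1 hlim) (ε / 2) (by simpa [pos_iff_ne_zero] using hε)
  obtain ⟨n, hn⟩ := hev.exists
  have hg := avg_meas hT hf (hpos n)
  have hgM : ∀ x, |avg T f (1 / ((n : ℝ) + 1)) x| ≤ M := by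
    intro x
    unfold avg
    have hp := hpos n
    set h := 1 / ((n : ℝ) + 1)
    have := intervalIntegral.norm_integral_le_of_norm_le_const (a := -(h/2)) (b := h/2)
        (f := fun s => f (T s x)) (C := M) (fun s _ => by rw [Real.norm_eq_abs]; exact hM _)
    rw [Real.norm_eq_abs, abs_of_pos (show 0 < h/2 - -(h/2) by linarith)] at this
    rw [abs_mul, abs_of_pos (show 0 < 1 / h by positivity)]
    calc _ ≤ 1 / h * (M * (h/2 - -(h/2))) := by gcongr
      _ = M := by field_simp; ring
  refine ⟨_, hg, Eventually.of_forall (LI_bdd hT hg hgM), Eventually.of_forall (avg_QS hT hf hM (hpos n)), ?_⟩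
  set g := avg T f (1 / ((n : ℝ) + 1))
  have hg0 : ∀ x, 0 ≤ g x := by
    intro x
    simp only [g]
    unfold avg
    have := hpos n
    refine mul_nonneg (by positivity) (intervalIntegral.integral_nonneg (by linarith) fun s _ => h0 _)
  have hgl : ∫⁻ x, ENNReal.ofReal (g x) ∂μ ≤ ∫⁻ x, ENNReal.ofReal (f x) ∂μ := by
    have := avg_lint hT hf (hpos n) 1 (Or.inl rfl)
    have e1 : ∀ x, |avg T f (1 / ((n : ℝ) + 1)) x| = g x := fun x => abs_of_nonneg (hg0 x)
    have e2 : ∀ x, |f x| = f x := fun x => abs_of_nonneg (h0 x)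
    simpa only [pow_one, e1, e2] using this
  have hfg : Measurable fun x => f x - g x := hf.sub hg
  have hid : ∫⁻ x, ENNReal.ofReal (|f x - g x| ^ 1) ∂μ + ∫⁻ x, ENNReal.ofReal (f x) ∂μ =
      2 * ∫⁻ x, ENNReal.ofReal (f x - g x) ∂μ + ∫⁻ x, ENNReal.ofReal (g x) ∂μ := by
    rw [← lintegral_const_mul _ hfg.ennreal_ofReal, ← lintegral_add_right _ hf.ennreal_ofReal,
      ← lintegral_add_right _ hg.ennreal_ofReal]
    refine lintegral_congr fun x => ?_
    rw [pow_one]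
    rcases le_total (g x) (f x) with h | h
    · rw [abs_of_nonneg (by linarith), ← ENNReal.ofReal_add (by linarith) (h0 x),
        show (2:ℝ≥0∞) = ENNReal.ofReal 2 by simp, ← ENNReal.ofReal_mul (by norm_num),
        ← ENNReal.ofReal_add (by linarith) (hg0 x)]
      congr 1; ring
    · rw [abs_of_nonpos (by linarith), ENNReal.ofReal_of_nonpos (show f x - g x ≤ 0 by linarith),
        ← ENNReal.ofReal_add (by linarith) (h0 x)]
      simp
  have : ∫⁻ x, ENNReal.ofReal (|f x - g x| ^ 1) ∂μ ≤ 2 * ∫⁻ x, ENNReal.ofReal (f x - g x) ∂μ := by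
    refine (ENNReal.add_le_add_iff_right hfi).1 ?_
    rw [hid]
    gcongr
  refine this.trans ?_
  calc _ ≤ 2 * (ε / 2) := by gcongr
    _ = ε := ENNReal.mul_div_cancel (by simp) (by simp)

/-- reduction to bounded nonnegative functions -/
lemma QGood_reduce [SigmaFinite μ] (hT : ErgodicFlow X μ T) {Q : ℕ → ℝ → ℝ → Prop} (hQ : QAdm Q)
    (hb : ∀ f : X → ℝ, Measurable f → (∀ x, 0 ≤ f x) → (∃ M, ∀ x, |f x| ≤ M) →
      ∫⁻ x, ENNReal.ofReal (f x) ∂μ ≠ ∞ → ∀ᵐ x ∂μ, QGood Q T f x)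
    {f : X → ℝ} (hf : Measurable f) (hfi : ∫⁻ x, ENNReal.ofReal |f x| ∂μ ≠ ∞) :
    ∀ᵐ x ∂μ, QGood Q T f x := by
  have hpos : ∀ f : X → ℝ, Measurable f → (∀ x, 0 ≤ f x) → ∫⁻ x, ENNReal.ofReal (f x) ∂μ ≠ ∞ →
      ∀ᵐ x ∂μ, QGood Q T f x := by
    intro f hf h0 hfi
    refine banach_principle hT hQ hf (ae_LI hT hf 1 (Or.inl rfl) (by simpa [abs_of_nonneg, h0] using hfi)) 1 (Or.inl rfl) ?_
    intro ε hε
    have hlim : Tendsto (fun n : ℕ => ∫⁻ x, ENNReal.ofReal (f x - min (f x) n) ∂μ)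
        atTop (𝓝 (∫⁻ x, 0 ∂μ)) := by
      refine tendsto_lintegral_of_dominated_convergence (fun x => ENNReal.ofReal (f x))
        (fun n => (hf.sub (hf.min measurable_const)).ennreal_ofReal) ?_ hfi ?_
      · intro n
        refine Eventually.of_forall fun x => ENNReal.ofReal_le_ofReal ?_
        have : 0 ≤ min (f x) n := le_min (h0 x) (by positivity)
        linarith
      · refine Eventually.of_forall fun x => ?_
        obtain ⟨n, hn⟩ := exists_nat_ge (f x)
        refine tendsto_const_nhds.congr' ?_
        filter_upwards [eventually_ge_atTop n] with m hm
        have : f x ≤ m := hn.trans (by exact_mod_cast hm)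
        simp [this]
    rw [lintegral_zero] at hlim
    obtain ⟨n, hn⟩ := ((ENNReal.tendsto_nhds_zero.1 hlim) ε (pos_iff_ne_zero.2 hε)).exists
    have hm : Measurable fun x => min (f x) (n : ℝ) := hf.min measurable_const
    have hm0 : ∀ x, 0 ≤ min (f x) (n : ℝ) := fun x => le_min (h0 x) (by positivity)
    have hmM : ∀ x, |min (f x) (n : ℝ)| ≤ n := fun x => by
      rw [abs_of_nonneg (hm0 x)]; exact min_le_right _ _
    refine ⟨fun x => min (f x) n, hm, Eventually.of_forall (LI_bdd hT hm hmM), hb _ hm hm0 ⟨_, hmM⟩ ?_, ?_⟩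
    · refine ne_top_of_le_ne_top hfi (lintegral_mono fun x => ENNReal.ofReal_le_ofReal (min_le_left _ _))
    · refine le_trans (le_of_eq ?_) hn
      refine lintegral_congr fun x => ?_
      rw [pow_one, abs_of_nonneg (by linarith [min_le_left (f x) (n:ℝ)])]
  have hp : ∀ x, |max (f x) 0| ≤ |f x| := fun x => by
    rw [abs_of_nonneg (le_max_right _ _)]; exact max_le (le_abs_self _) (abs_nonneg _)
  have hn : ∀ x, |max (-f x) 0| ≤ |f x| := fun x => by
    rw [abs_of_nonneg (le_max_right _ _)]; exact max_le (neg_le_abs _) (abs_nonneg _)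
  have m1 : Measurable fun x => max (f x) 0 := hf.max measurable_const
  have m2 : Measurable fun x => max (-f x) 0 := hf.neg.max measurable_const
  have i1 : ∫⁻ x, ENNReal.ofReal |max (f x) 0| ∂μ ≠ ∞ :=
    ne_top_of_le_ne_top hfi (lintegral_mono fun x => ENNReal.ofReal_le_ofReal (hp x))
  have i2 : ∫⁻ x, ENNReal.ofReal |max (-f x) 0| ∂μ ≠ ∞ :=
    ne_top_of_le_ne_top hfi (lintegral_mono fun x => ENNReal.ofReal_le_ofReal (hn x))
  have g1 := hpos _ m1 (fun x => le_max_right _ _) (by simpa only [abs_of_nonneg (le_max_right _ (0:ℝ))] using i1)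
  have g2 := hpos _ m2 (fun x => le_max_right _ _) (by simpa only [abs_of_nonneg (le_max_right _ (0:ℝ))] using i2)
  have L1 := ae_LI hT m1 1 (Or.inl rfl) (by simpa only [pow_one] using i1)
  have m3 : Measurable fun x => (-1:ℝ) * max (-f x) 0 := m2.const_mul _
  have L2 := ae_LI hT m3 1 (Or.inl rfl)
    (by simpa only [pow_one, abs_mul, abs_neg, abs_one, one_mul] using i2)
  filter_upwards [g1, g2, L1, L2] with x h1 h2 h3 h4
  have := QGood_add hQ h3 h4 h1 (QGood_smul (-1) h2)
  convert this using 2 with y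
  rcases le_total (f y) 0 with h | h
  · rw [max_eq_right h, max_eq_left (by linarith)]; ring
  · rw [max_eq_left h, max_eq_right (by linarith)]; ring

lemma QS_good [SigmaFinite μ] (hT : ErgodicFlow X μ T) {f : X → ℝ} (hf : Measurable f)
    (hfi : ∫⁻ x, ENNReal.ofReal |f x| ∂μ ≠ ∞) : ∀ᵐ x ∂μ, QGood QS T f x :=
  QGood_reduce hT QS_adm (fun _ hf h0 ⟨_, hM⟩ hi => QS_bdd hT hf h0 hM hi) hf hfi
end

section
variable {X : Type*} [MeasurableSpace X] {μ : Measure X} {T : ℝ → X → X}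

lemma cob_aux {φ : ℝ → ℝ} (hφ : Measurable φ) {M : ℝ} (hM : ∀ τ, |φ τ| ≤ M) (s : ℝ) {a b : ℝ}
    (ha : 2 * |s| < a) (ha0 : 0 < a) (hab : a < b) :
    |∫ τ in a..b, (φ (τ + s) - φ τ) / τ| ≤ 6 * M * |s| / a := by
  have hM0 : 0 ≤ M := (abs_nonneg _).trans (hM 0)
  have hs1 := le_abs_self s
  have hs2 := neg_le_abs s
  have hs0 := abs_nonneg s
  -- integrability
  have h_itg : ∀ c d r : ℝ, r < c → r < d → IntervalIntegrable (fun v => φ v / (v - r)) volume c d := by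
    intro c d r hc hd
    rw [intervalIntegrable_iff]
    refine Measure.integrableOn_of_bounded (M := M / (min c d - r)) (by simp) ?_ ?_
    · exact (hφ.div (measurable_id.sub_const r)).aestronglyMeasurable
    · refine (ae_restrict_mem measurableSet_uIoc).mono fun v hv => ?_
      have hv1 : min c d < v := hv.1
      have : 0 < min c d - r := by have := lt_min hc hd; linarith
      rw [Real.norm_eq_abs, abs_div, abs_of_pos (show 0 < v - r by linarith)]
      gcongr
      exact hM v
  have h1 : ∫ τ in a..b, (φ (τ + s) - φ τ) / τ =
      (∫ v in (a+s)..(b+s), φ v / (v - s)) - ∫ v in a..b, φ v / v := by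
    rw [← intervalIntegral.integral_comp_add_right (fun v => φ v / (v - s))]
    have i0 := h_itg a b 0 ha0 (ha0.trans hab)
    have i1 := (h_itg (a + s) (b + s) s (by linarith) (by linarith)).comp_add_right s
    simp only [sub_zero] at i0
    simp only [add_sub_cancel_right] at i1 ⊢
    rw [← intervalIntegral.integral_sub i1 i0]
    congr 1; funext τ; ring
  have h2 : (∫ v in (a+s)..(b+s), φ v / (v - s)) - ∫ v in a..b, φ v / v =
      ((∫ v in (a+s)..a, φ v / (v - s)) - (∫ v in (b+s)..b, φ v / (v - s))) +
      ∫ v in a..b, (φ v / (v - s) - φ v / v) := by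
    have i0 := h_itg a b 0 ha0 (ha0.trans hab)
    simp only [sub_zero] at i0
    rw [intervalIntegral.integral_sub (h_itg a b s (by linarith) (by linarith)) i0,
      ← intervalIntegral.integral_interval_sub_interval_comm
        (h_itg _ _ s (by linarith) (by linarith)) (h_itg _ _ s (by linarith) (by linarith))
        (h_itg _ _ s (by linarith) (by linarith))]
    ring
  have hbd : ∀ c : ℝ, a ≤ c → |∫ v in (c+s)..c, φ v / (v - s)| ≤ 2 * M * |s| / a := by
    intro c hc
    have := intervalIntegral.norm_integral_le_of_norm_le_const (a := c + s) (b := c)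
      (f := fun v => φ v / (v - s)) (C := M / (a / 2)) (fun v hv => by
        have hv1 : min (c+s) c < v := hv.1
        have hh : a / 2 < v - s := by
          rcases min_lt_iff.1 hv1 with h | h <;> linarith
        rw [Real.norm_eq_abs, abs_div, abs_of_pos (show 0 < v - s by linarith)]
        gcongr
        exact hM v)
    rw [Real.norm_eq_abs] at this
    refine this.trans (le_of_eq ?_)
    rw [show c - (c + s) = -s by ring, abs_neg]
    field_simp
  have h3 : |∫ v in a..b, (φ v / (v - s) - φ v / v)| ≤ 2 * M * |s| / a := by
    have hder : ∀ v ∈ uIcc a b, HasDerivAt (fun v : ℝ => -(2 * M * |s|) * v⁻¹) (2 * M * |s| / v ^ 2) v := by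
      intro v hv
      rw [uIcc_of_le hab.le] at hv
      have hv0 : v ≠ 0 := (ha0.trans_le hv.1).ne'
      have := (hasDerivAt_inv hv0).const_mul (-(2 * M * |s|))
      rw [show 2 * M * |s| / v ^ 2 = -(2 * M * |s|) * -(v ^ 2)⁻¹ by rw [div_eq_mul_inv]; ring]
      exact this
    have hcont : ContinuousOn (fun v : ℝ => 2 * M * |s| / v ^ 2) (uIcc a b) := by
      rw [uIcc_of_le hab.le]
      refine continuousOn_const.div (by fun_prop) fun v hv => ?_
      have : 0 < v := ha0.trans_le hv.1
      positivity
    have hle := intervalIntegral.norm_integral_le_of_norm_le (μ := volume) (f := fun v => φ v / (v - s) - φ v / v)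
      (g := fun v : ℝ => 2 * M * |s| / v ^ 2) hab.le (Eventually.of_forall fun v hv => by
        have hv0 : 0 < v := ha0.trans hv.1
        have hvs : v / 2 < v - s := by linarith [hv.1]
        have hvs0 : 0 < v - s := by linarith
        have e : φ v / (v - s) - φ v / v = φ v * s / ((v - s) * v) := by field_simp; ring
        rw [Real.norm_eq_abs, e, abs_div, abs_mul, abs_of_pos (show 0 < (v - s) * v by positivity)]
        calc |φ v| * |s| / ((v - s) * v) ≤ M * |s| / (v / 2 * v) := by
              gcongr; exact hM v
          _ = 2 * M * |s| / v ^ 2 := by field_simp) hcont.intervalIntegrable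
    rw [Real.norm_eq_abs] at hle
    refine hle.trans ?_
    rw [intervalIntegral.integral_eq_sub_of_hasDerivAt hder hcont.intervalIntegrable]
    have hb0 : 0 < b := ha0.trans hab
    have : 0 ≤ 2 * M * |s| * b⁻¹ := by positivity
    rw [div_eq_mul_inv]
    linarith
  rw [h1, h2]
  have b1 := hbd a le_rfl
  have b2 := hbd b hab.le
  refine (abs_add_le _ _).trans ?_
  have := abs_sub (∫ v in (a+s)..a, φ v / (v - s)) (∫ v in (b+s)..b, φ v / (v - s))
  have e : 6 * M * |s| / a = 2 * M * |s| / a + 2 * M * |s| / a + 2 * M * |s| / a := by ring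
  linarith

lemma cob_QL (hT : ErgodicFlow X μ T) {g : X → ℝ} (hg : Measurable g) {M : ℝ}
    (hM : ∀ x, |g x| ≤ M) (s : ℝ) (x : X) : QGood QL T (fun y => g (T s y) - g y) x := by
  have hM0 : 0 ≤ M := (abs_nonneg _).trans (hM x)
  intro ε hε
  obtain ⟨n, hn⟩ := exists_nat_gt (2 * |s| + 12 * M * |s| / ε)
  refine ⟨n, fun a b hab => ?_⟩
  obtain ⟨h1, h2⟩ := hab
  have hp : 0 ≤ 12 * M * |s| / ε := by positivity
  have hs0 := abs_nonneg s
  have ha0 : 0 < a := by linarith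
  have hm := hT.meas_orbit hg x
  have hm' : Measurable fun τ => g (T (-τ) x) := hm.comp measurable_neg
  have c1 := cob_aux hm (fun τ => hM _) s (a := a) (b := b) (by linarith) ha0 h2
  have c2 := cob_aux hm' (fun τ => hM _) (-s) (a := a) (b := b) (by rw [abs_neg]; linarith) ha0 h2
  rw [abs_neg] at c2
  have hL := LI_bdd hT (hg.comp (hT.preserving s).measurable) (fun x => hM _) x
  have hL1 := LI_bdd hT hg hM x
  have ii : ∀ ψ : ℝ → ℝ, LocallyIntegrable ψ volume → IntervalIntegrable (fun τ => ψ τ / τ) volume a b := by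
    intro ψ hψ
    have := (LI_ii hψ a b).mul_continuousOn (g := fun τ => τ⁻¹) (by
      refine ContinuousOn.inv₀ continuousOn_id fun v hv => ?_
      rw [uIcc_of_le h2.le] at hv
      exact (ha0.trans_le hv.1).ne')
    simpa only [div_eq_mul_inv] using this
  have hsh : LocallyIntegrable (fun τ => g (T (τ + s) x)) volume := by
    have e : (fun τ => g (T (τ + s) x)) = fun τ => (g ∘ T s) (T τ x) := by
      funext τ
      rw [add_comm, hT.map_add]; rfl
    rw [e]; exact hL
  have e : hI T (fun y => g (T s y) - g y) a b x =
      (∫ τ in a..b, (g (T (τ + s) x) - g (T τ x)) / τ) -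
      ∫ τ in a..b, (g (T (-(τ + -s)) x) - g (T (-τ) x)) / τ := by
    unfold hI
    rw [← intervalIntegral.integral_sub]
    · congr 1; funext τ
      beta_reduce
      rw [← hT.map_add, ← hT.map_add, show -(τ + -s) = s + -τ by ring, add_comm s τ]
      ring
    · exact ii _ (hsh.sub hL1)
    · refine ii _ (LocallyIntegrable.sub ?_ (LI_neg hL1))
      have := LI_neg hsh
      have e : (fun τ => g (T (-(τ + -s)) x)) = fun τ => g (T (-τ + s) x) := by
        funext τ
        rw [show -(τ + -s) = -τ + s by ring]
      rw [e]; exact this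
  rw [e]
  have h6 : 6 * M * |s| / a + 6 * M * |s| / a ≤ ε := by
    rw [← add_div, div_le_iff₀ ha0]
    have : 12 * M * |s| / ε < a := by linarith
    rw [div_lt_iff₀ hε] at this
    linarith
  exact (abs_sub _ _).trans (by linarith)

lemma lp_sq (g : Lp ℝ 2 μ) : ∫⁻ x, ENNReal.ofReal (|g x| ^ 2) ∂μ = ‖g‖ₑ ^ 2 := by
  rw [Lp.enorm_def]
  have := eLpNorm_nnreal_pow_eq_lintegral (μ := μ) (f := g) (p := 2) (by norm_num)
  simp only [NNReal.coe_ofNat, ENNReal.rpow_ofNat, ENNReal.coe_ofNat] at this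
  rw [this]
  refine lintegral_congr fun x => ?_
  rw [ENNReal.ofReal_pow (abs_nonneg _), Real.enorm_eq_ofReal_abs]

lemma lp_fin (g : Lp ℝ 2 μ) : ∫⁻ x, ENNReal.ofReal (|g x| ^ 2) ∂μ ≠ ∞ := by
  rw [lp_sq]; simp

lemma lp_meas (g : Lp ℝ 2 μ) : Measurable (g : X → ℝ) := (Lp.stronglyMeasurable g).measurable

lemma lp_LI [SigmaFinite μ] (hT : ErgodicFlow X μ T) (g : Lp ℝ 2 μ) : ∀ᵐ x ∂μ, LI T g x :=
  ae_LI hT (lp_meas g) 2 (Or.inr rfl) (lp_fin g)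

/-- the submodule of functions with good behaviour at infinity -/
def goodL [SigmaFinite μ] (hT : ErgodicFlow X μ T) : Submodule ℝ (Lp ℝ 2 μ) where
  carrier := {g | ∀ᵐ x ∂μ, QGood QL T g x}
  add_mem' := by
    intro u v hu hv
    refine QGood_congr hT (Lp.coeFn_add u v).symm ?_
    filter_upwards [lp_LI hT u, lp_LI hT v, hu, hv] with x h1 h2 h3 h4
    exact QGood_add QL_adm h1 h2 h3 h4
  zero_mem' := by
    refine QGood_congr hT (Lp.coeFn_zero ℝ 2 μ).symm ?_
    refine Eventually.of_forall fun x ε hε => ⟨0, fun a b _ => ?_⟩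
    simp [hI, hε.le]
  smul_mem' := by
    intro c u hu
    refine QGood_congr hT (Lp.coeFn_smul c u).symm ?_
    filter_upwards [hu] with x h1
    exact QGood_smul c h1

lemma goodL_closed [SigmaFinite μ] (hT : ErgodicFlow X μ T) : IsClosed (goodL hT : Set (Lp ℝ 2 μ)) := by
  refine isClosed_of_closure_subset fun f hf => ?_
  refine banach_principle hT QL_adm (lp_meas f) (lp_LI hT f) 2 (Or.inr rfl) fun ε hε => ?_
  obtain ⟨δ, hδ, hδε⟩ : ∃ δ : ℝ≥0∞, 0 < δ ∧ δ ^ 2 ≤ ε := by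
    rcases le_total ε 1 with h | h
    · exact ⟨ε, pos_iff_ne_zero.2 hε, by simpa using pow_le_of_le_one (zero_le) h two_ne_zero⟩
    · exact ⟨1, one_pos, by simpa using h⟩
  obtain ⟨g, hg, hd⟩ := EMetric.mem_closure_iff.1 hf δ hδ
  refine ⟨g, lp_meas g, lp_LI hT g, hg, ?_⟩
  have e : ∫⁻ x, ENNReal.ofReal (|f x - g x| ^ 2) ∂μ = ‖f - g‖ₑ ^ 2 := by
    rw [← lp_sq]
    refine lintegral_congr_ae ?_
    filter_upwards [Lp.coeFn_sub f g] with x hx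
    rw [hx]; rfl
  rw [e, ← edist_eq_enorm_sub]
  exact (pow_le_pow_left₀ (zero_le) hd.le 2).trans hδε

lemma cob_mem [SigmaFinite μ] (hT : ErgodicFlow X μ T) (s : ℝ) (g : Lp ℝ 2 μ) :
    Lp.compMeasurePreservingₗᵢ ℝ (T s) (hT.preserving s) g - g ∈ goodL hT := by
  induction g using Lp.induction with
  | hp_ne_top => simp
  | @indicatorConst c A hA hμA =>
    rw [Lp.simpleFunc.coe_indicatorConst]
    set u := indicatorConstLp 2 hA hμA.ne c with hu
    have h1 : (u : X → ℝ) =ᵐ[μ] A.indicator fun _ => c := indicatorConstLp_coeFn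
    have h2 : ((Lp.compMeasurePreservingₗᵢ ℝ (T s) (hT.preserving s) u : Lp ℝ 2 μ) : X → ℝ) =ᵐ[μ] u ∘ T s :=
      Lp.coeFn_compMeasurePreserving u (hT.preserving s)
    have h3 := (hT.preserving s).quasiMeasurePreserving.ae_eq_comp h1
    have h4 := Lp.coeFn_sub (Lp.compMeasurePreservingₗᵢ ℝ (T s) (hT.preserving s) u) u
    refine QGood_congr hT (u := fun y => A.indicator (fun _ => c) (T s y) - A.indicator (fun _ => c) y) ?_ ?_
    · filter_upwards [h1, h2, h3, h4] with x a1 a2 a3 a4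
      rw [a4, Pi.sub_apply, a2, a3, a1]; rfl
    · refine Eventually.of_forall (cob_QL hT (measurable_const.indicator hA) (M := |c|) (fun x => ?_) s)
      by_cases h : x ∈ A <;> simp [h]
  | add hf hg hd h1 h2 =>
    rw [map_add]
    convert (goodL hT).add_mem h1 h2 using 1
    abel
  | isClosed =>
    refine (goodL_closed hT).preimage (f := fun g => Lp.compMeasurePreservingₗᵢ ℝ (T s) (hT.preserving s) g - g) ?_
    exact (LinearIsometry.continuous _).sub continuous_id

lemma goodL_top [SigmaFinite μ] (hT : ErgodicFlow X μ T) (g : Lp ℝ 2 μ) : ∀ᵐ x ∂μ, QGood QL T g x := by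
  have h1 : (goodL hT).topologicalClosure = ⊤ := by
    rw [Submodule.topologicalClosure_eq_top_iff, Submodule.eq_bot_iff]
    intro q hq
    rw [Submodule.mem_orthogonal] at hq
    have hinv : ∀ s, Lp.compMeasurePreservingₗᵢ ℝ (T s) (hT.preserving s) q = q := by
      intro s
      set V := Lp.compMeasurePreservingₗᵢ ℝ (E := ℝ) (p := 2) (T s) (hT.preserving s)
      have a := hq _ (cob_mem hT s q)
      rw [inner_sub_left] at a
      have b := norm_sub_sq_real (V q) q
      rw [LinearIsometry.norm_map, ← real_inner_self_eq_norm_sq q] at b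
      have : ‖V q - q‖ ^ 2 = 0 := by rw [b]; linarith
      exact sub_eq_zero.1 (norm_eq_zero.1 (pow_eq_zero_iff two_ne_zero |>.1 this))
    have hmem : q ∈ goodL hT := by
      have hae : ∀ᵐ τ : ℝ, ∀ᵐ x ∂μ, q (T τ x) = q x := by
        refine Eventually.of_forall fun τ => ?_
        have := Lp.coeFn_compMeasurePreserving q (hT.preserving τ)
        have e : Lp.compMeasurePreserving (T τ) (hT.preserving τ) q = q := hinv τ
        rw [e] at this
        exact this.symm
      have hms : MeasurableSet {z : X × ℝ | q (T z.2 z.1) = q z.1} :=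
        measurableSet_eq_fun (hT.meas_joint (lp_meas q)) ((lp_meas q).comp measurable_fst)
      rw [← Measure.ae_ae_comm (p := fun (x : X) (τ : ℝ) => q (T τ x) = q x) hms] at hae
      change ∀ᵐ x ∂μ, QGood QL T q x
      filter_upwards [hae] with x hx ε hε
      refine ⟨0, fun a b _ => ?_⟩
      have : hI T q a b x = 0 := by
        unfold hI
        rw [intervalIntegral.integral_congr_ae (g := fun _ => 0)]
        · simp
        · filter_upwards [hx, ae_neg_real hx] with τ h1 h2 _
          rw [h1, h2]; simp
      rw [this]; simpa using hε.le
    exact inner_self_eq_zero.1 (hq q hmem)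
  rw [IsClosed.submodule_topologicalClosure_eq (goodL_closed hT)] at h1
  have : g ∈ goodL hT := by rw [h1]; trivial
  exact this

lemma QL_good [SigmaFinite μ] (hT : ErgodicFlow X μ T) {f : X → ℝ} (hf : Measurable f)
    (hfi : ∫⁻ x, ENNReal.ofReal |f x| ∂μ ≠ ∞) : ∀ᵐ x ∂μ, QGood QL T f x := by
  refine QGood_reduce hT QL_adm (fun f hf h0 ⟨M, hM⟩ hi => ?_) hf hfi
  have h_itg : Integrable f μ := by
    refine ⟨hf.aestronglyMeasurable, ?_⟩
    rw [hasFiniteIntegral_iff_ofReal (Eventually.of_forall h0)]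
    exact hi.lt_top
  have hmem : MemLp f 2 μ := by
    rw [memLp_two_iff_integrable_sq hf.aestronglyMeasurable]
    have := h_itg.bdd_mul hf.aestronglyMeasurable (c := M) (Eventually.of_forall fun x => by
      rw [Real.norm_eq_abs]; exact hM x)
    simpa only [pow_two] using this
  exact QGood_congr hT hmem.coeFn_toLp (goodL_top hT (hmem.toLp f))
end

section
variable {X : Type*} [MeasurableSpace X] {μ : Measure X} {T : ℝ → X → X}

lemma pv_eq {f : X → ℝ} {x : X} (hL : LI T f x) {δ : ℝ} (h0 : 0 < δ) (h1 : δ < 1) :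
    ∫ τ in {τ : ℝ | δ ≤ |τ| ∧ |τ| ≤ 1 / δ}, f (T τ x) / τ = hI T f δ (1 / δ) x := by
  have hb : δ < 1 / δ := by
    rw [lt_div_iff₀ h0]; nlinarith
  set b := 1 / δ with hbd
  have hb0 : 0 < b := h0.trans hb
  have ii : ∀ ψ : ℝ → ℝ, LocallyIntegrable ψ volume → IntervalIntegrable (fun τ => ψ τ / τ) volume δ b := by
    intro ψ hψ
    have := (LI_ii hψ δ b).mul_continuousOn (g := fun τ => τ⁻¹) (by
      refine ContinuousOn.inv₀ continuousOn_id fun v hv => ?_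
      rw [uIcc_of_le hb.le] at hv
      exact (h0.trans_le hv.1).ne')
    simpa only [div_eq_mul_inv] using this
  have ii' : IntervalIntegrable (fun τ => f (T τ x) / τ) volume (-b) (-δ) := by
    have := (LI_ii hL (-b) (-δ)).mul_continuousOn (g := fun τ => τ⁻¹) (by
      refine ContinuousOn.inv₀ continuousOn_id fun v hv => ?_
      rw [uIcc_of_le (by linarith)] at hv
      have : v < 0 := by have := hv.2; linarith
      exact this.ne)
    simpa only [div_eq_mul_inv] using this
  have hset : {τ : ℝ | δ ≤ |τ| ∧ |τ| ≤ b} = Icc δ b ∪ Icc (-b) (-δ) := by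
    ext τ
    simp only [Set.mem_ofPred_eq, mem_union, mem_Icc]
    constructor
    · rintro ⟨h2, h3⟩
      rcases le_total 0 τ with h | h
      · rw [abs_of_nonneg h] at h2 h3; exact Or.inl ⟨h2, h3⟩
      · rw [abs_of_nonpos h] at h2 h3; exact Or.inr ⟨by linarith, by linarith⟩
    · rintro (⟨h2, h3⟩ | ⟨h2, h3⟩)
      · rw [abs_of_pos (by linarith)]; exact ⟨h2, h3⟩
      · rw [abs_of_neg (by linarith)]; exact ⟨by linarith, by linarith⟩
  rw [hset, setIntegral_union]
  · rw [integral_Icc_eq_integral_Ioc, integral_Icc_eq_integral_Ioc, ← intervalIntegral.integral_of_le hb.le,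
      ← intervalIntegral.integral_of_le (by linarith)]
    have e := intervalIntegral.integral_comp_neg (a := δ) (b := b) (fun τ => f (T τ x) / τ)
    rw [← e]
    unfold hI
    rw [← intervalIntegral.integral_add (ii _ hL)]
    · congr 1; funext τ
      rw [div_neg, sub_div]; ring
    · have := (ii _ (LI_neg hL)).neg
      refine IntervalIntegrable.congr (fun τ _ => ?_) this
      simp [div_neg]
  · rw [Set.disjoint_left]
    rintro τ ⟨h2, _⟩ ⟨_, h3⟩
    linarith
  · exact measurableSet_Icc
  · rw [integrableOn_Icc_iff_integrableOn_Ioc]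
    exact (intervalIntegrable_iff_integrableOn_Ioc_of_le hb.le).1 (ii _ hL)
  · rw [integrableOn_Icc_iff_integrableOn_Ioc]
    exact (intervalIntegrable_iff_integrableOn_Ioc_of_le (by linarith)).1 ii'

lemma conv_ae [SigmaFinite μ] (hT : ErgodicFlow X μ T) {f : X → ℝ} (hf : Measurable f)
    (hfi : ∫⁻ x, ENNReal.ofReal |f x| ∂μ ≠ ∞) :
    ∀ᵐ x ∂μ, Tendsto (fun δ => hI T f δ (1 / δ) x) (𝓝[>] 0) (𝓝 (ergHilbert T f x)) := by
  have hLI := ae_LI hT hf 1 (Or.inl rfl) (by simpa only [pow_one] using hfi)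
  filter_upwards [hLI, QS_good hT hf hfi, QL_good hT hf hfi] with x hL hS hQ
  have hc : Cauchy (map (fun δ => hI T f δ (1 / δ) x) (𝓝[>] 0)) := by
    rw [Metric.cauchy_iff]
    refine ⟨inferInstance, fun ε hε => ?_⟩
    obtain ⟨n, hn⟩ := hS (ε / 3) (by positivity)
    obtain ⟨m, hm⟩ := hQ (ε / 3) (by positivity)
    set r := min (1 / ((n : ℝ) + 1)) (1 / ((m : ℝ) + 1)) with hr
    have hr0 : 0 < r := lt_min (by positivity) (by positivity)
    refine ⟨_, image_mem_map (Ioo_mem_nhdsGT hr0), ?_⟩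
    have key : ∀ δ δ' : ℝ, 0 < δ → δ < δ' → δ' < r →
        |hI T f δ (1 / δ) x - hI T f δ' (1 / δ') x| < ε := by
      intro δ δ' h0 h1 h2
      have h0' : 0 < δ' := h0.trans h1
      have e : hI T f δ (1 / δ) x - hI T f δ' (1 / δ') x = hI T f δ δ' x + hI T f (1 / δ') (1 / δ) x := by
        unfold hI
        have i1 := hI_ii hL h0 h0'
        have i2 := hI_ii hL h0' (show 0 < 1 / δ' by positivity)
        have i3 := hI_ii hL (show 0 < 1 / δ' by positivity) (show 0 < 1 / δ by positivity)
        rw [← intervalIntegral.integral_add_adjacent_intervals i1 (i2.trans i3),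
          ← intervalIntegral.integral_add_adjacent_intervals i2 i3]
        ring
      rw [e]
      have a1 := hn δ δ' ⟨h0, h1, h2.trans_le (min_le_left _ _)⟩
      have a2 := hm (1 / δ') (1 / δ) ⟨by
        have : δ' < 1 / ((m : ℝ) + 1) := h2.trans_le (min_le_right _ _)
        rw [lt_div_iff₀ (by positivity)] at this
        rw [lt_div_iff₀ h0']; linarith, one_div_lt_one_div_of_lt h0 h1⟩
      exact (abs_add_le _ _).trans_lt (by linarith)
    rintro _ ⟨δ, hδ, rfl⟩ _ ⟨δ', hδ', rfl⟩
    rw [Real.dist_eq]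
    rcases lt_trichotomy δ δ' with h | h | h
    · exact key δ δ' hδ.1 h hδ'.2
    · subst h; simpa using hε
    · rw [abs_sub_comm]; exact key δ' δ hδ'.1 h hδ.2
  obtain ⟨l, hl⟩ := cauchy_map_iff_exists_tendsto.1 hc
  have hev : (fun δ => hI T f δ (1 / δ) x) =ᶠ[𝓝[>] 0]
      fun δ => ∫ τ in {τ : ℝ | δ ≤ |τ| ∧ |τ| ≤ 1 / δ}, f (T τ x) / τ := by
    filter_upwards [Ioo_mem_nhdsGT (one_pos : (0:ℝ) < 1)] with δ hδ
    exact (pv_eq hL hδ.1 hδ.2).symm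
  have hl2 := hl.congr' hev
  have : ergHilbert T f x = l := hl2.limUnder_eq
  rw [this]; exact hl
end

section
variable {X : Type*} [MeasurableSpace X] {μ : Measure X} {T : ℝ → X → X}

/-- distribution function -/
def dst {X : Type*} [MeasurableSpace X] (μ : Measure X) (f : X → ℝ) (v : ℝ) : ℝ≥0∞ :=
  μ {x | v < |f x|}

lemma dst_anti (f : X → ℝ) : Antitone (dst μ f) := fun _ _ h =>
  measure_mono fun _ hx => lt_of_le_of_lt h hx

lemma dst_markov {f : X → ℝ} (hf : Measurable f) {v : ℝ} :
    ENNReal.ofReal v * dst μ f v ≤ ∫⁻ x, ENNReal.ofReal |f x| ∂μ := by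
  refine le_trans ?_ (mul_meas_ge_le_lintegral (hf.abs.ennreal_ofReal) (ENNReal.ofReal v))
  refine mul_le_mul_right (measure_mono fun x hx => ?_) _
  exact ENNReal.ofReal_le_ofReal (le_of_lt hx)

lemma rr_bdd {f : X → ℝ} (hf : Measurable f) (hfi : ∫⁻ x, ENNReal.ofReal |f x| ∂μ ≠ ∞) {t : ℝ}
    (ht : 0 < t) : BddAbove {s : ℝ | 0 ≤ s ∧ ENNReal.ofReal t < μ {x | s < |f x|}} := by
  refine ⟨(∫⁻ x, ENNReal.ofReal |f x| ∂μ).toReal / t, ?_⟩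
  rintro s ⟨hs, h⟩
  rw [le_div_iff₀ ht]
  have h1 := dst_markov (μ := μ) hf (v := s)
  have h2 : ENNReal.ofReal s * ENNReal.ofReal t ≤ ∫⁻ x, ENNReal.ofReal |f x| ∂μ :=
    le_trans (mul_le_mul_right h.le _) h1
  rw [← ENNReal.ofReal_mul hs] at h2
  exact (ENNReal.ofReal_le_iff_le_toReal hfi).1 h2

lemma rr_nonneg (f : X → ℝ) (t : ℝ) : 0 ≤ rearrange μ f t :=
  Real.sSup_nonneg fun _ h => h.1

lemma rr_le {f : X → ℝ} (hf : Measurable f) (hfi : ∫⁻ x, ENNReal.ofReal |f x| ∂μ ≠ ∞) {t v : ℝ}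
    (ht : 0 < t) (hv : 0 ≤ v) (h : ENNReal.ofReal t < dst μ f v) : v ≤ rearrange μ f t :=
  le_csSup (rr_bdd hf hfi ht) ⟨hv, h⟩

lemma rr_lt {f : X → ℝ} {t v : ℝ} (hv : 0 ≤ v) (h : v < rearrange μ f t) :
    ENNReal.ofReal t < dst μ f v := by
  have hne : {s : ℝ | 0 ≤ s ∧ ENNReal.ofReal t < μ {x | s < |f x|}}.Nonempty := by
    by_contra hc
    rw [not_nonempty_iff_eq_empty] at hc
    unfold rearrange at h
    rw [hc, Real.sSup_empty] at h
    linarith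
  obtain ⟨s, hs, hvs⟩ := exists_lt_of_lt_csSup hne h
  exact lt_of_lt_of_le hs.2 (dst_anti f hvs.le)

lemma rr_anti {f : X → ℝ} (hf : Measurable f) (hfi : ∫⁻ x, ENNReal.ofReal |f x| ∂μ ≠ ∞) :
    AntitoneOn (rearrange μ f) (Ioi 0) := by
  intro a ha b hb hab
  by_contra hc
  push Not at hc
  obtain ⟨v, h1, h2⟩ := exists_between hc
  have hv : 0 ≤ v := (rr_nonneg f a).trans h1.le
  have := rr_lt hv h2
  have h3 := rr_le hf hfi ha hv (lt_of_le_of_lt (ENNReal.ofReal_le_ofReal hab) this)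
  linarith

lemma vol_lt (c : ℝ≥0∞) : volume {s : ℝ | 0 < s ∧ ENNReal.ofReal s < c} = c := by
  by_cases hc : c = ∞
  · subst hc
    have : {s : ℝ | 0 < s ∧ ENNReal.ofReal s < ∞} = Ioi 0 := by ext s; simp
    rw [this, Real.volume_Ioi]
  · have : {s : ℝ | 0 < s ∧ ENNReal.ofReal s < c} = Ioo 0 c.toReal := by
      ext s
      simp only [Set.mem_ofPred_eq, mem_Ioo]
      refine and_congr_right fun hs => ?_
      rw [ENNReal.ofReal_lt_iff_lt_toReal hs.le hc]
    rw [this, Real.volume_Ioo, sub_zero, ENNReal.ofReal_toReal hc]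

/-- indicator kernel -/
def ek {X : Type*} [MeasurableSpace X] (μ : Measure X) (f : X → ℝ) (v s : ℝ) : ℝ≥0∞ :=
  {z : ℝ × ℝ | ENNReal.ofReal z.2 < dst μ f z.1}.indicator (fun _ => 1) (v, s)

lemma ek_set (f : X → ℝ) : MeasurableSet {z : ℝ × ℝ | ENNReal.ofReal z.2 < dst μ f z.1} :=
  measurableSet_lt (measurable_snd.ennreal_ofReal) ((dst_anti f).measurable.comp measurable_fst)

lemma ek_meas (f : X → ℝ) : Measurable (Function.uncurry (ek μ f)) :=
  measurable_const.indicator (ek_set f)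

lemma ek_le_one (f : X → ℝ) (v s : ℝ) : ek μ f v s ≤ 1 := by
  unfold ek
  exact indicator_le_self' (fun _ _ => zero_le) _ |>.trans le_rfl

lemma ek_s (f : X → ℝ) (v : ℝ) : ∫⁻ s in Ioi 0, ek μ f v s = dst μ f v := by
  have hm : MeasurableSet {s : ℝ | ENNReal.ofReal s < dst μ f v} :=
    measurableSet_lt ENNReal.measurable_ofReal measurable_const
  have : ∀ s, ek μ f v s = {s : ℝ | ENNReal.ofReal s < dst μ f v}.indicator (fun _ => 1) s := fun s => rfl
  simp_rw [this]
  rw [lintegral_indicator_const hm, one_mul, Measure.restrict_apply hm]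
  convert vol_lt (dst μ f v) using 2
  ext s; simp [and_comm]

lemma ek_v {f : X → ℝ} (hf : Measurable f) (hfi : ∫⁻ x, ENNReal.ofReal |f x| ∂μ ≠ ∞) {s : ℝ}
    (hs : 0 < s) : ∫⁻ v in Ioi 0, ek μ f v s = ENNReal.ofReal (rearrange μ f s) := by
  have hm : MeasurableSet {v : ℝ | ENNReal.ofReal s < dst μ f v} :=
    measurableSet_lt measurable_const (dst_anti f).measurable
  have : ∀ v, ek μ f v s = {v : ℝ | ENNReal.ofReal s < dst μ f v}.indicator (fun _ => 1) v := fun s => rfl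
  simp_rw [this]
  rw [lintegral_indicator_const hm, one_mul, Measure.restrict_apply hm]
  refine le_antisymm ?_ ?_
  · rw [← sub_zero (rearrange μ f s), ← Real.volume_Ioc]
    refine measure_mono ?_
    rintro v ⟨h1, h2⟩
    exact ⟨h2, rr_le hf hfi hs (le_of_lt h2) h1⟩
  · rw [← sub_zero (rearrange μ f s), ← Real.volume_Ioo]
    refine measure_mono ?_
    rintro v ⟨h1, h2⟩
    exact ⟨rr_lt h1.le h2, h1⟩

lemma rr_total {f : X → ℝ} (hf : Measurable f) (hfi : ∫⁻ x, ENNReal.ofReal |f x| ∂μ ≠ ∞) :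
    ∫⁻ s in Ioi 0, ENNReal.ofReal (rearrange μ f s) = ∫⁻ x, ENNReal.ofReal |f x| ∂μ := by
  rw [lintegral_eq_lintegral_meas_lt μ (Eventually.of_forall fun x => abs_nonneg (f x)) hf.abs.aemeasurable]
  calc ∫⁻ s in Ioi 0, ENNReal.ofReal (rearrange μ f s)
      = ∫⁻ s in Ioi 0, (∫⁻ v in Ioi 0, ek μ f v s) :=
        setLIntegral_congr_fun measurableSet_Ioi fun s hs => (ek_v hf hfi hs).symm
    _ = ∫⁻ v in Ioi 0, (∫⁻ s in Ioi 0, ek μ f v s) := by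
        refine lintegral_lintegral_swap ?_
        exact ((ek_meas f).comp measurable_swap).aemeasurable
    _ = ∫⁻ v in Ioi 0, dst μ f v := by simp_rw [ek_s]

lemma rr_top {f : X → ℝ} (hf : Measurable f) (hfi : ∫⁻ x, ENNReal.ofReal |f x| ∂μ ≠ ∞) {t : ℝ}
    (ht : 0 < t) :
    ∫⁻ v in Ioi (rearrange μ f t), dst μ f v ≤ ∫⁻ s in Ioo 0 t, ENNReal.ofReal (rearrange μ f s) := by
  have hR := rr_nonneg (μ := μ) f t
  calc ∫⁻ v in Ioi (rearrange μ f t), dst μ f v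
      ≤ ∫⁻ v in Ioi (rearrange μ f t), (∫⁻ s in Ioo 0 t, ek μ f v s) := by
        refine setLIntegral_mono' measurableSet_Ioi fun v hv => ?_
        rw [← ek_s]
        have h1 : dst μ f v ≤ ENNReal.ofReal t := by
          by_contra hc
          push Not at hc
          have := rr_le hf hfi ht (hR.trans (le_of_lt hv)) hc
          exact absurd hv (not_lt.2 this)
        rw [← lintegral_indicator measurableSet_Ioi, ← lintegral_indicator measurableSet_Ioo]
        refine lintegral_mono fun s => ?_
        by_cases hs : s ∈ Ioo 0 t
        · rw [indicator_of_mem hs, indicator_of_mem (show s ∈ Ioi (0:ℝ) from hs.1)]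
        · rw [indicator_of_notMem hs]
          by_cases hs0 : s ∈ Ioi (0:ℝ)
          · rw [indicator_of_mem hs0]
            have hts : t ≤ s := by
              by_contra hc; exact hs ⟨hs0, not_le.1 hc⟩
            have : ¬ ENNReal.ofReal s < dst μ f v :=
              not_lt.2 (h1.trans (ENNReal.ofReal_le_ofReal hts))
            unfold ek
            rw [indicator_of_notMem (show (v, s) ∉ {z : ℝ × ℝ | ENNReal.ofReal z.2 < dst μ f z.1} from this)]
          · rw [indicator_of_notMem hs0]
    _ ≤ ∫⁻ v in Ioi 0, (∫⁻ s in Ioo 0 t, ek μ f v s) :=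
        lintegral_mono_set (Ioi_subset_Ioi hR)
    _ = ∫⁻ s in Ioo 0 t, (∫⁻ v in Ioi 0, ek μ f v s) :=
        lintegral_lintegral_swap (ek_meas f).aemeasurable
    _ = _ := setLIntegral_congr_fun measurableSet_Ioo fun s hs => ek_v hf hfi hs.1

lemma tail_sq {K : ℝ} (hK : 0 ≤ K) : ∫⁻ u in Ioi (1:ℝ), ENNReal.ofReal (K / u ^ 2) ≤ ENNReal.ofReal K := by
  have hi := integrableOn_Ioi_rpow_of_lt (show (-2:ℝ) < -1 by norm_num) one_pos
  have hv := integral_Ioi_rpow_of_lt (show (-2:ℝ) < -1 by norm_num) one_pos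
  have e : ∀ u ∈ Ioi (1:ℝ), K / u ^ 2 = K * u ^ (-2:ℝ) := fun u hu => by
    have : 0 < u := one_pos.trans hu
    rw [Real.rpow_neg this.le, div_eq_mul_inv]; norm_num
  rw [setLIntegral_congr_fun measurableSet_Ioi fun u hu => by rw [e u hu]]
  rw [← ofReal_integral_eq_lintegral_ofReal (hi.const_mul K)]
  · rw [integral_const_mul, hv]; norm_num
  · refine (ae_restrict_mem measurableSet_Ioi).mono fun u hu => ?_
    have : (0:ℝ) < u := one_pos.trans hu
    exact mul_nonneg hK (Real.rpow_nonneg this.le _)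

lemma min_int (f : X → ℝ) (v : ℝ) {K : ℝ} (hK : 0 < K) :
    ∫⁻ u in Ioc (0:ℝ) 1, min (dst μ f v) (ENNReal.ofReal (K / u)) ≤
      ENNReal.ofReal K + ∫⁻ s in Ioi K, ek μ f v s * ENNReal.ofReal (K / s) := by
  have hmz : MeasurableSet {z : ℝ × ℝ | z.2 < K / z.1} :=
    measurableSet_lt measurable_snd (measurable_const.div measurable_fst)
  set k : ℝ → ℝ → ℝ≥0∞ := fun u s => {z : ℝ × ℝ | z.2 < K / z.1}.indicator (fun _ => 1) (u, s) with hk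
  have hkm : Measurable (Function.uncurry k) := measurable_const.indicator hmz
  have hem : Measurable fun s => ek μ f v s := (ek_meas f).comp (measurable_const.prodMk measurable_id)
  calc ∫⁻ u in Ioc (0:ℝ) 1, min (dst μ f v) (ENNReal.ofReal (K / u))
      = ∫⁻ u in Ioc (0:ℝ) 1, (∫⁻ s in Ioi 0, ek μ f v s * k u s) := by
        refine setLIntegral_congr_fun measurableSet_Ioc fun u hu => ?_
        have hm : MeasurableSet {s : ℝ | ENNReal.ofReal s < min (dst μ f v) (ENNReal.ofReal (K / u))} :=
          measurableSet_lt ENNReal.measurable_ofReal measurable_const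
        have e : ∀ s ∈ Ioi (0:ℝ), ek μ f v s * k u s =
            {s : ℝ | ENNReal.ofReal s < min (dst μ f v) (ENNReal.ofReal (K / u))}.indicator (fun _ => 1) s := by
          intro s hs
          have hKu : 0 < K / u := div_pos hK hu.1
          simp only [ek, hk, indicator_apply, Set.mem_ofPred_eq, lt_min_iff, ENNReal.ofReal_lt_ofReal_iff hKu]
          by_cases h1 : ENNReal.ofReal s < dst μ f v <;> by_cases h2 : s < K / u <;> simp [h1, h2]
        beta_reduce
        rw [setLIntegral_congr_fun measurableSet_Ioi e, lintegral_indicator_const hm, one_mul, Measure.restrict_apply hm]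
        refine (vol_lt (min (dst μ f v) (ENNReal.ofReal (K / u)))).symm.trans ?_
        congr 1
        ext s; simp [and_comm]
    _ = ∫⁻ s in Ioi 0, (∫⁻ u in Ioc (0:ℝ) 1, ek μ f v s * k u s) := by
        refine lintegral_lintegral_swap ?_
        exact ((hem.comp measurable_snd).mul hkm).aemeasurable
    _ = ∫⁻ s in Ioi 0, ek μ f v s * (∫⁻ u in Ioc (0:ℝ) 1, k u s) := by
        refine lintegral_congr fun s => ?_
        rw [lintegral_const_mul]
        exact hkm.comp (measurable_id.prodMk measurable_const)
    _ ≤ ∫⁻ s in Ioi 0, ek μ f v s * min 1 (ENNReal.ofReal (K / s)) := by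
        refine setLIntegral_mono' measurableSet_Ioi fun s hs => mul_le_mul_right ?_ _
        have hs0 : 0 < s := hs
        have hm : MeasurableSet {u : ℝ | s < K / u} :=
          measurableSet_lt measurable_const (measurable_const.div measurable_id)
        have e : ∀ u, k u s = {u : ℝ | s < K / u}.indicator (fun _ => 1) u := fun u => rfl
        simp_rw [e]
        rw [lintegral_indicator_const hm, one_mul, Measure.restrict_apply hm]
        refine le_min ?_ ?_
        · refine (measure_mono inter_subset_right).trans ?_
          rw [Real.volume_Ioc]; simp
        · rw [← sub_zero (K / s), ← Real.volume_Ioo]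
          refine measure_mono ?_
          rintro u ⟨h1, h2⟩
          refine ⟨h2.1, ?_⟩
          have h1' : s < K / u := h1
          rw [lt_div_iff₀ h2.1] at h1'
          rw [lt_div_iff₀ hs0]; linarith
    _ = (∫⁻ s in Ioc 0 K, ek μ f v s * min 1 (ENNReal.ofReal (K / s))) +
        ∫⁻ s in Ioi K, ek μ f v s * min 1 (ENNReal.ofReal (K / s)) := by
        rw [← Ioc_union_Ioi_eq_Ioi hK.le, lintegral_union measurableSet_Ioi Ioc_disjoint_Ioi_same]
    _ ≤ _ := by
        refine add_le_add ?_ ?_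
        · calc _ ≤ ∫⁻ s in Ioc 0 K, 1 := by
                refine lintegral_mono fun s => ?_
                exact (mul_le_mul' (ek_le_one f v s) (min_le_left _ _)).trans (by simp)
            _ = ENNReal.ofReal K := by rw [setLIntegral_one, Real.volume_Ioc, sub_zero]
        · exact lintegral_mono fun s => mul_le_mul_right (min_le_right _ _) _

lemma dual_est {f h : X → ℝ} (hf : Measurable f) (hfi : ∫⁻ x, ENNReal.ofReal |f x| ∂μ ≠ ∞)
    (hh : Measurable h) {K G : ℝ} (hK : 0 < K) (hG : 0 ≤ G)
    (h1 : ∀ u, 0 < u → dst μ h u ≤ ENNReal.ofReal (K / u))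
    (h2 : ∀ u, 0 < u → dst μ h u ≤ ENNReal.ofReal (K / u ^ 2)) :
    ∫⁻ x, ENNReal.ofReal (min |f x| G * |h x|) ∂μ ≤
      ENNReal.ofReal G * (ENNReal.ofReal K + ENNReal.ofReal K) +
      ENNReal.ofReal K * ∫⁻ s in Ioi K, ENNReal.ofReal (rearrange μ f s / s) := by
  have hA : ∀ v, MeasurableSet {x | v < |f x|} := fun v => measurableSet_lt measurable_const hf.abs
  -- level estimate
  have hlev : ∀ v, ∫⁻ x in {x | v < |f x|}, ENNReal.ofReal |h x| ∂μ ≤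
      (ENNReal.ofReal K + ENNReal.ofReal K) + ∫⁻ s in Ioi K, ek μ f v s * ENNReal.ofReal (K / s) := by
    intro v
    rw [lintegral_eq_lintegral_meas_lt _ (Eventually.of_forall fun x => abs_nonneg (h x)) hh.abs.aemeasurable,
      ← Ioc_union_Ioi_eq_Ioi (zero_le_one (α := ℝ)), lintegral_union measurableSet_Ioi Ioc_disjoint_Ioi_same]
    have hle : ∀ u, μ.restrict {x | v < |f x|} {x | u < |h x|} ≤ dst μ h u := fun u =>
      Measure.restrict_apply_le _ _
    have hle' : ∀ u, μ.restrict {x | v < |f x|} {x | u < |h x|} ≤ dst μ f v := fun u => by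
      rw [Measure.restrict_apply (measurableSet_lt measurable_const hh.abs)]
      exact measure_mono inter_subset_right
    have b1 : ∫⁻ u in Ioc (0:ℝ) 1, μ.restrict {x | v < |f x|} {x | u < |h x|} ≤
        ENNReal.ofReal K + ∫⁻ s in Ioi K, ek μ f v s * ENNReal.ofReal (K / s) := by
      refine le_trans (setLIntegral_mono' measurableSet_Ioc fun u hu => ?_) (min_int f v hK)
      exact le_min (hle' u) ((hle u).trans (h1 u hu.1))
    have b2 : ∫⁻ u in Ioi (1:ℝ), μ.restrict {x | v < |f x|} {x | u < |h x|} ≤ ENNReal.ofReal K := by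
      refine le_trans (setLIntegral_mono' measurableSet_Ioi fun u hu => ?_) (tail_sq hK.le)
      exact (hle u).trans (h2 u (one_pos.trans hu))
    calc _ ≤ _ := add_le_add b1 b2
      _ = _ := by ring
  set ν := μ.withDensity (fun x => ENNReal.ofReal |h x|) with hν
  have hhm : Measurable fun x => ENNReal.ofReal |h x| := hh.abs.ennreal_ofReal
  have hmm : Measurable fun x => min |f x| G := hf.abs.min measurable_const
  have e1 : ∫⁻ x, ENNReal.ofReal (min |f x| G * |h x|) ∂μ = ∫⁻ x, ENNReal.ofReal (min |f x| G) ∂ν := by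
    rw [hν, lintegral_withDensity_eq_lintegral_mul _ hhm hmm.ennreal_ofReal]
    refine lintegral_congr fun x => ?_
    rw [ENNReal.ofReal_mul (le_min (abs_nonneg _) hG), Pi.mul_apply, mul_comm]
  rw [e1, lintegral_eq_lintegral_meas_lt ν (Eventually.of_forall fun x => le_min (abs_nonneg (f x)) hG) hmm.aemeasurable]
  have hpt : ∀ v ∈ Ioi (0:ℝ), ν {x | v < min |f x| G} ≤ (Ioo 0 G).indicator (fun v =>
      (ENNReal.ofReal K + ENNReal.ofReal K) + ∫⁻ s in Ioi K, ek μ f v s * ENNReal.ofReal (K / s)) v := by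
    intro v hv
    by_cases hvG : v < G
    · rw [indicator_of_mem (show v ∈ Ioo 0 G from ⟨hv, hvG⟩)]
      refine le_trans ?_ (hlev v)
      rw [← withDensity_apply _ (hA v)]
      refine measure_mono fun x hx => ?_
      have hx' : v < min |f x| G := hx
      exact (lt_min_iff.1 hx').1
    · have : {x | v < min |f x| G} = ∅ := by
        ext x
        simp only [Set.mem_ofPred_eq, lt_min_iff, mem_empty_iff_false, iff_false]
        exact fun h => hvG h.2
      rw [this]; simp
  have hkm : Measurable fun z : ℝ × ℝ => ek μ f z.1 z.2 * ENNReal.ofReal (K / z.2) :=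
    (ek_meas f).mul (measurable_const.div measurable_snd).ennreal_ofReal
  calc _ ≤ ∫⁻ v in Ioi (0:ℝ), (Ioo 0 G).indicator (fun v =>
      (ENNReal.ofReal K + ENNReal.ofReal K) + ∫⁻ s in Ioi K, ek μ f v s * ENNReal.ofReal (K / s)) v :=
        setLIntegral_mono' measurableSet_Ioi hpt
    _ = ∫⁻ v in Ioo 0 G, ((ENNReal.ofReal K + ENNReal.ofReal K) +
        ∫⁻ s in Ioi K, ek μ f v s * ENNReal.ofReal (K / s)) := by
        rw [lintegral_indicator measurableSet_Ioo, Measure.restrict_restrict measurableSet_Ioo,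
          inter_eq_self_of_subset_left (fun v hv => hv.1)]
    _ = ENNReal.ofReal G * (ENNReal.ofReal K + ENNReal.ofReal K) +
        ∫⁻ v in Ioo 0 G, (∫⁻ s in Ioi K, ek μ f v s * ENNReal.ofReal (K / s)) := by
        rw [lintegral_add_left measurable_const, setLIntegral_const, Real.volume_Ioo, sub_zero, mul_comm]
    _ ≤ _ := by
        refine add_le_add_right ?_ _
        rw [lintegral_lintegral_swap hkm.aemeasurable, ← lintegral_const_mul' _ _ ENNReal.ofReal_ne_top]
        refine setLIntegral_mono' measurableSet_Ioi fun s hs => ?_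
        have hs0 : 0 < s := hK.trans hs
        rw [lintegral_mul_const' _ _ ENNReal.ofReal_ne_top]
        have := (lintegral_mono_set (μ := volume) (f := fun v => ek μ f v s) (fun v (hv : v ∈ Ioo 0 G) => (hv.1 : v ∈ Ioi 0))).trans
          (ek_v hf hfi hs0).le
        refine (mul_le_mul_left this _).trans (le_of_eq ?_)
        rw [← ENNReal.ofReal_mul (rr_nonneg f s), ← ENNReal.ofReal_mul hK.le]
        congr 1; ring
end

section
variable {X : Type*} [MeasurableSpace X] {μ : Measure X} {T : ℝ → X → X}

lemma ker_meas (hT : ErgodicFlow X μ T) {f : X → ℝ} (hf : Measurable f) :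
    Measurable fun q : X × ℝ => (f (T q.2 q.1) - f (T (-q.2) q.1)) / q.2 := by
  have h1 := hT.meas_joint hf
  have h2 : Measurable fun q : X × ℝ => f (T (-q.2) q.1) :=
    h1.comp (measurable_fst.prodMk measurable_snd.neg)
  exact (h1.sub h2).div measurable_snd

lemma hI_meas (hT : ErgodicFlow X μ T) {f : X → ℝ} (hf : Measurable f) {a b : ℝ} (hab : a < b) :
    Measurable (hI T f a b) := by
  unfold hI
  simp only [intervalIntegral.integral_of_le hab.le]
  exact ((ker_meas hT hf).stronglyMeasurable.integral_prod_right' (ν := volume.restrict (Ioc a b))).measurable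

lemma pair_shift (hT : ErgodicFlow X μ T) {u v : X → ℝ} (hu : Measurable u) (hv : Measurable v) (τ : ℝ) :
    ∫ x, v x * u (T τ x) ∂μ = ∫ x, u x * v (T (-τ) x) ∂μ := by
  have hm : Measurable fun x => u x * v (T (-τ) x) :=
    hu.mul (hv.comp (hT.preserving (-τ)).measurable)
  have := integral_map (μ := μ) (hT.preserving τ).measurable.aemeasurable
    (f := fun x => u x * v (T (-τ) x)) hm.aestronglyMeasurable
  rw [(hT.preserving τ).map_eq] at this
  rw [this]
  refine integral_congr_ae (Eventually.of_forall fun x => ?_)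
  beta_reduce
  rw [← hT.map_add, neg_add_cancel, hT.map_zero, mul_comm]

lemma pair_swap [SigmaFinite μ] (hT : ErgodicFlow X μ T) {u v : X → ℝ} (hu : Measurable u) {M : ℝ}
    (hM : ∀ x, |u x| ≤ M) (hv : Measurable v) (hvi : Integrable v μ) {a b : ℝ} (ha : 0 < a) (hab : a < b) :
    ∫ x, v x * hI T u a b x ∂μ =
      ∫ τ in a..b, ((∫ x, v x * u (T τ x) ∂μ) - ∫ x, v x * u (T (-τ) x) ∂μ) / τ := by
  unfold hI
  simp only [intervalIntegral.integral_of_le hab.le, ← integral_const_mul]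
  rw [integral_integral_swap]
  · refine setIntegral_congr_fun measurableSet_Ioc fun τ hτ => ?_
    beta_reduce
    have hi : ∀ τ, Integrable (fun x => v x * u (T τ x)) μ := fun τ => by
      refine hvi.mul_bdd (c := M) (hu.comp (hT.preserving τ).measurable).aestronglyMeasurable ?_
      exact Eventually.of_forall fun x => by rw [Real.norm_eq_abs]; exact hM _
    rw [← integral_sub (hi τ) (hi (-τ)), ← integral_div]
    congr 1; funext x; ring
  · have hb := hvi.mul_prod (integrable_const (μ := volume.restrict (Ioc a b)) (2 * M / a))
    refine hb.norm.mono' ((hv.comp measurable_fst).mul (ker_meas hT hu)).aestronglyMeasurable ?_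
    have hmem : ∀ᵐ z : X × ℝ ∂(μ.prod (volume.restrict (Ioc a b))), z.2 ∈ Ioc a b := by
      have := Measure.quasiMeasurePreserving_snd (μ := μ) (ν := volume.restrict (Ioc a b))
      exact this.ae (ae_restrict_mem measurableSet_Ioc)
    filter_upwards [hmem] with z hz
    have hz0 : 0 < z.2 := ha.trans hz.1
    have hM0 : 0 ≤ M := (abs_nonneg _).trans (hM z.1)
    have e1 := hM (T z.2 z.1)
    have e2 := hM (T (-z.2) z.1)
    have e3 := abs_sub (u (T z.2 z.1)) (u (T (-z.2) z.1))
    simp only [Function.uncurry, norm_mul, Real.norm_eq_abs]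
    refine mul_le_mul_of_nonneg_left ?_ (abs_nonneg _)
    rw [abs_div, abs_of_pos hz0, abs_of_nonneg (show 0 ≤ 2 * M / a by positivity)]
    gcongr
    · linarith
    · exact hz.1.le

lemma skew [SigmaFinite μ] (hT : ErgodicFlow X μ T) {u v : X → ℝ} (hu : Measurable u) {M N : ℝ}
    (hM : ∀ x, |u x| ≤ M) (hui : Integrable u μ) (hv : Measurable v) (hN : ∀ x, |v x| ≤ N)
    (hvi : Integrable v μ) {a b : ℝ} (ha : 0 < a) (hab : a < b) :
    ∫ x, v x * hI T u a b x ∂μ = - ∫ x, u x * hI T v a b x ∂μ := by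
  rw [pair_swap hT hu hM hv hvi ha hab, pair_swap hT hv hN hu hui ha hab, ← intervalIntegral.integral_neg]
  congr 1
  funext τ
  rw [pair_shift hT hu hv τ, pair_shift hT hu hv (-τ), neg_neg]
  ring

lemma weak_hI [SigmaFinite μ] (hT : ErgodicFlow X μ T) {f : X → ℝ} (hf : Measurable f) (p : ℕ)
    (hp : p = 1 ∨ p = 2) {l a b : ℝ} (hl : 0 < l) (ha : 0 < a) (hab : a < b) :
    ENNReal.ofReal (l ^ p) * dst μ (hI T f a b) l ≤
      ENNReal.ofReal (10 ^ 9) * ∫⁻ x, ENNReal.ofReal (|f x| ^ p) ∂μ := by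
  refine le_trans (mul_le_mul_right (measure_mono fun x hx => ?_) _) (flow_max hT hf p hp hl)
  exact ⟨a, b, ha, hab, hx⟩

/-- estimate for bounded part -/
lemma part2 [SigmaFinite μ] (hT : ErgodicFlow X μ T) {f f2 : X → ℝ} (hf : Measurable f)
    (hfi : ∫⁻ x, ENNReal.ofReal |f x| ∂μ ≠ ∞) {t : ℝ} (ht : 0 < t) {a b : ℝ} (ha : 0 < a) (hab : a < b)
    {G A0 B0 lam : ℝ} (hG0 : 0 ≤ G) (hGA : G ≤ A0 / t) (hB0 : 0 ≤ B0)
    (hf2 : Measurable f2) (hf2G : ∀ x, |f2 x| = min |f x| G)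
    (hB : ∫⁻ s in Ioi t, ENNReal.ofReal (rearrange μ f s / s) = ENNReal.ofReal B0)
    (hlam0 : 0 < lam) (hlam : 4 * 10 ^ 9 * (A0 / t + B0) < lam) :
    dst μ (hI T f2 a b) (lam / 2) ≤ ENNReal.ofReal (t / 2) := by
  set H := hI T f2 a b with hH
  have hHm : Measurable H := hI_meas hT hf2 hab
  set F := {x | lam / 2 < |H x|} with hF
  have hFm : MeasurableSet F := measurableSet_lt measurable_const hHm.abs
  have hf2l : ∫⁻ x, ENNReal.ofReal |f2 x| ∂μ ≠ ∞ :=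
    ne_top_of_le_ne_top hfi (lintegral_mono fun x => ENNReal.ofReal_le_ofReal (by rw [hf2G]; exact min_le_left _ _))
  have hf2i : Integrable f2 μ := by
    refine ⟨hf2.aestronglyMeasurable, ?_⟩
    rw [hasFiniteIntegral_iff_norm]
    simpa only [Real.norm_eq_abs] using hf2l.lt_top
  have hf2b : ∀ x, |f2 x| ≤ G := fun x => by rw [hf2G]; exact min_le_right _ _
  have hFfin : μ F ≠ ∞ := by
    have hw := weak_hI hT hf2 1 (Or.inl rfl) (half_pos hlam0) ha hab
    simp only [pow_one] at hw
    intro hc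
    have e : dst μ (hI T f2 a b) (lam / 2) = ∞ := hc
    rw [e, ENNReal.mul_top (by simpa using hlam0)] at hw
    exact ENNReal.mul_ne_top ENNReal.ofReal_ne_top hf2l (top_le_iff.1 hw)
  change μ F ≤ _
  by_contra hcon
  push Not at hcon
  set t' := (μ F).toReal with ht'
  have hFt : μ F = ENNReal.ofReal t' := (ENNReal.ofReal_toReal hFfin).symm
  have htt : t / 2 < t' := by
    rw [hFt] at hcon
    exact (ENNReal.ofReal_lt_ofReal_iff_of_nonneg (by positivity)).1 hcon
  have ht'0 : 0 < t' := by linarith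
  -- the test function
  set σ : X → ℝ := F.indicator (fun x => H x / |H x|) with hσ
  have hσm : Measurable σ := (hHm.div hHm.abs).indicator hFm
  have hpos : ∀ x ∈ F, 0 < |H x| := fun x hx => lt_trans (half_pos hlam0) hx
  have hσa : ∀ x, |σ x| = F.indicator (fun _ => 1) x := by
    intro x
    by_cases hx : x ∈ F
    · rw [hσ, indicator_of_mem hx, indicator_of_mem hx, abs_div, abs_abs, div_self (hpos x hx).ne']
    · rw [hσ, indicator_of_notMem hx, indicator_of_notMem hx, abs_zero]
  have hσ1 : ∀ x, |σ x| ≤ 1 := fun x => by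
    rw [hσa]; by_cases hx : x ∈ F <;> simp [hx]
  have hσp : ∀ p : ℕ, p = 1 ∨ p = 2 → ∫⁻ x, ENNReal.ofReal (|σ x| ^ p) ∂μ = ENNReal.ofReal t' := by
    intro p hp
    have hp0 : p ≠ 0 := by rcases hp with h | h <;> simp [h]
    rw [← hFt, ← lintegral_indicator_one hFm]
    refine lintegral_congr fun x => ?_
    rw [hσa]
    by_cases hx : x ∈ F <;> simp [hx, hp0]
  have hσi : Integrable σ μ := by
    refine ⟨hσm.aestronglyMeasurable, ?_⟩
    rw [hasFiniteIntegral_iff_norm]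
    have := hσp 1 (Or.inl rfl)
    simp only [pow_one] at this
    simp only [Real.norm_eq_abs, this]
    exact ENNReal.ofReal_lt_top
  have hσH : ∀ x, σ x * H x = F.indicator (fun x => |H x|) x := by
    intro x
    by_cases hx : x ∈ F
    · rw [hσ, indicator_of_mem hx, indicator_of_mem hx]
      have := (hpos x hx).ne'
      rw [div_mul_eq_mul_div, div_eq_iff this]
      exact (abs_mul_abs_self _).symm
    · rw [hσ, indicator_of_notMem hx, indicator_of_notMem hx, zero_mul]
  set h := hI T σ a b with hh
  have hhm : Measurable h := hI_meas hT hσm hab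
  set K := 10 ^ 9 * t' with hK
  have hK0 : 0 < K := by positivity
  have hwk : ∀ p : ℕ, p = 1 ∨ p = 2 → ∀ u, 0 < u → dst μ h u ≤ ENNReal.ofReal (K / u ^ p) := by
    intro p hp u hu
    have hw := weak_hI hT hσm p hp hu ha hab
    rw [hσp p hp, ← ENNReal.ofReal_mul (by positivity)] at hw
    rw [ENNReal.ofReal_div_of_pos (by positivity)]
    rw [ENNReal.le_div_iff_mul_le (Or.inl (by simp; positivity)) (Or.inl ENNReal.ofReal_ne_top), mul_comm]
    exact hw
  have hd := dual_est hf hfi hhm hK0 hG0 (fun u hu => by simpa using hwk 1 (Or.inl rfl) u hu) (hwk 2 (Or.inr rfl))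
  have hKt : t ≤ K := by rw [hK]; linarith
  have hd2 : ∫⁻ x, ENNReal.ofReal (min |f x| G * |h x|) ∂μ ≤ ENNReal.ofReal (2 * G * K + K * B0) := by
    refine hd.trans ?_
    have : ∫⁻ s in Ioi K, ENNReal.ofReal (rearrange μ f s / s) ≤ ENNReal.ofReal B0 := by
      rw [← hB]; exact lintegral_mono_set (Ioi_subset_Ioi hKt)
    calc _ ≤ ENNReal.ofReal G * (ENNReal.ofReal K + ENNReal.ofReal K) + ENNReal.ofReal K * ENNReal.ofReal B0 := by
          gcongr
      _ = _ := by
          rw [← ENNReal.ofReal_add hK0.le hK0.le, ← ENNReal.ofReal_mul hG0, ← ENNReal.ofReal_mul hK0.le,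
            ← ENNReal.ofReal_add (by positivity) (by positivity)]
          congr 1; ring
  -- duality
  have hup : |∫ x, f2 x * h x ∂μ| ≤ 2 * G * K + K * B0 := by
    have := norm_integral_le_lintegral_norm (μ := μ) (fun x => f2 x * h x)
    rw [Real.norm_eq_abs] at this
    refine this.trans ?_
    refine ENNReal.toReal_le_of_le_ofReal (by positivity) ?_
    refine le_trans (le_of_eq ?_) hd2
    refine lintegral_congr fun x => ?_
    rw [norm_mul, Real.norm_eq_abs, Real.norm_eq_abs, hf2G]
  have hHb : ∀ x, |H x| ≤ 2 * G / a * (b - a) := by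
    intro x
    have := intervalIntegral.norm_integral_le_of_norm_le_const (a := a) (b := b)
      (f := fun τ => (f2 (T τ x) - f2 (T (-τ) x)) / τ) (C := 2 * G / a) (fun τ hτ => by
        rw [uIoc_of_le hab.le] at hτ
        have hτ0 : 0 < τ := ha.trans hτ.1
        rw [Real.norm_eq_abs, abs_div, abs_of_pos hτ0]
        have e1 := hf2b (T τ x)
        have e2 := hf2b (T (-τ) x)
        have e3 := abs_sub (f2 (T τ x)) (f2 (T (-τ) x))
        gcongr
        · linarith
        · exact hτ.1.le)
    rw [Real.norm_eq_abs, abs_of_pos (show 0 < b - a by linarith)] at this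
    exact this
  have hlow : lam / 2 * t' ≤ ∫ x, σ x * H x ∂μ := by
    have e : ∫ x, F.indicator (fun _ => lam / 2) x ∂μ = lam / 2 * t' := by
      rw [integral_indicator_const _ hFm, smul_eq_mul, mul_comm]; rfl
    rw [← e]
    refine integral_mono ?_ ?_ fun x => ?_
    · exact (integrable_indicator_iff hFm).2 (integrableOn_const hFfin)
    · exact hσi.mul_bdd (c := 2 * G / a * (b - a)) hHm.aestronglyMeasurable
        (Eventually.of_forall fun x => by rw [Real.norm_eq_abs]; exact hHb x)
    · rw [hσH]
      by_cases hx : x ∈ F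
      · rw [indicator_of_mem hx, indicator_of_mem hx]; exact le_of_lt hx
      · rw [indicator_of_notMem hx, indicator_of_notMem hx]
  rw [skew hT hf2 hf2b hf2i hσm hσ1 hσi ha hab] at hlow
  have hfin : lam / 2 * t' ≤ 2 * G * K + K * B0 := hlow.trans ((neg_le_abs _).trans hup)
  have hfin2 : lam / 2 ≤ 10 ^ 9 * (2 * G + B0) := by
    have : lam / 2 * t' ≤ (10 ^ 9 * (2 * G + B0)) * t' := by rw [hK] at hfin; linarith
    exact le_of_mul_le_mul_right this ht'0
  linarith

lemma main_K [SigmaFinite μ] (hT : ErgodicFlow X μ T) {f : X → ℝ} (hf : Measurable f)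
    (hfi : ∫⁻ x, ENNReal.ofReal |f x| ∂μ ≠ ∞) {t : ℝ} (ht : 0 < t) {a b : ℝ} (ha : 0 < a) (hab : a < b)
    {A0 B0 lam : ℝ} (hA0 : 0 ≤ A0) (hB0 : 0 ≤ B0)
    (hA : ∫⁻ s in Ioo 0 t, ENNReal.ofReal (rearrange μ f s) = ENNReal.ofReal A0)
    (hB : ∫⁻ s in Ioi t, ENNReal.ofReal (rearrange μ f s / s) = ENNReal.ofReal B0)
    (hlam : 4 * 10 ^ 9 * (A0 / t + B0) < lam) :
    dst μ (hI T f a b) lam ≤ ENNReal.ofReal t := by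
  have hD0 : 0 ≤ A0 / t := by positivity
  have hlam0 : 0 < lam := lt_of_le_of_lt (by positivity) hlam
  set G := rearrange μ f t with hG
  have hG0 : 0 ≤ G := rr_nonneg f t
  have hGA : G ≤ A0 / t := by
    rw [le_div_iff₀ ht]
    have : ENNReal.ofReal (G * t) ≤ ENNReal.ofReal A0 := by
      rw [← hA, ENNReal.ofReal_mul hG0]
      calc ENNReal.ofReal G * ENNReal.ofReal t = ∫⁻ s in Ioo 0 t, ENNReal.ofReal G := by
            rw [setLIntegral_const, Real.volume_Ioo, sub_zero]
        _ ≤ _ := setLIntegral_mono' measurableSet_Ioo fun s hs =>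
            ENNReal.ofReal_le_ofReal (rr_anti hf hfi hs.1 ht hs.2.le)
    exact (ENNReal.ofReal_le_ofReal_iff hA0).1 this
  set f2 : X → ℝ := fun x => max (-G) (min (f x) G) with hf2d
  have hf2 : Measurable f2 := measurable_const.max (hf.min measurable_const)
  set f1 : X → ℝ := fun x => f x - f2 x with hf1d
  have hf1 : Measurable f1 := hf.sub hf2
  have hf2G : ∀ x, |f2 x| = min |f x| G := by
    intro x
    simp only [hf2d]
    rcases le_total 0 (f x) with h | h
    · rw [abs_of_nonneg h, max_eq_right (by have := le_min h hG0; linarith), abs_of_nonneg (le_min h hG0)]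
    · rw [abs_of_nonpos h, min_eq_left (h.trans hG0), abs_of_nonpos (max_le (by linarith) h), ← min_neg_neg,
        neg_neg, min_comm]
  have hf1G : ∀ x, ∀ v, 0 < v → (v < |f1 x| ↔ v + G < |f x|) := by
    intro x v hv
    have : |f1 x| = max (|f x| - G) 0 := by
      simp only [hf1d, hf2d]
      rcases le_total 0 (f x) with h | h
      · rw [abs_of_nonneg h, max_eq_right (by have := le_min h hG0; linarith)]
        rcases le_total (f x) G with h' | h'
        · rw [min_eq_left h', sub_self, abs_zero, max_eq_right (by linarith)]
        · rw [min_eq_right h', abs_of_nonneg (by linarith), max_eq_left (by linarith)]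
      · rw [abs_of_nonpos h, min_eq_left (h.trans hG0)]
        rcases le_total (-G) (f x) with h' | h'
        · rw [max_eq_right h', sub_self, abs_zero, max_eq_right (by linarith)]
        · rw [max_eq_left h', abs_of_nonpos (by linarith), max_eq_left (by linarith)]; ring
    rw [this, lt_max_iff]
    constructor
    · rintro (h | h) <;> linarith
    · intro h; left; linarith
  have hf1l : ∫⁻ x, ENNReal.ofReal |f1 x| ∂μ ≤ ENNReal.ofReal A0 := by
    rw [← hA]
    refine le_trans (le_of_eq ?_) (rr_top hf hfi ht)
    rw [lintegral_eq_lintegral_meas_lt μ (Eventually.of_forall fun x => abs_nonneg (f1 x)) hf1.abs.aemeasurable]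
    rw [← lintegral_indicator measurableSet_Ioi, ← lintegral_indicator measurableSet_Ioi,
      ← lintegral_add_right_eq_self ((Ioi (rearrange μ f t)).indicator (dst μ f)) G]
    refine lintegral_congr fun v => ?_
    by_cases hv : 0 < v
    · rw [indicator_of_mem (show v ∈ Ioi (0:ℝ) from hv),
        indicator_of_mem (show v + G ∈ Ioi (rearrange μ f t) from (by change G < v + G; linarith))]
      unfold dst
      congr 1
      ext x
      exact hf1G x v hv
    · rw [indicator_of_notMem (show v ∉ Ioi (0:ℝ) from hv),
        indicator_of_notMem (show v + G ∉ Ioi (rearrange μ f t) from (by change ¬ G < v + G; linarith))]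
  have hf2l : ∫⁻ x, ENNReal.ofReal |f2 x| ∂μ ≠ ∞ :=
    ne_top_of_le_ne_top hfi (lintegral_mono fun x => ENNReal.ofReal_le_ofReal (by rw [hf2G]; exact min_le_left _ _))
  have p2 := part2 hT hf hfi ht ha hab hG0 hGA hB0 hf2 hf2G hB hlam0 hlam
  have p1 : dst μ (hI T f1 a b) (lam / 2) ≤ ENNReal.ofReal (t / 2) := by
    by_contra hc
    push Not at hc
    have hw := weak_hI hT hf1 1 (Or.inl rfl) (half_pos hlam0) ha hab
    simp only [pow_one] at hw
    have h3 : ENNReal.ofReal (lam / 2 * (t / 2)) ≤ ENNReal.ofReal (10 ^ 9 * A0) := by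
      rw [ENNReal.ofReal_mul (by positivity), ENNReal.ofReal_mul (by positivity)]
      exact (mul_le_mul_right hc.le _).trans (hw.trans (mul_le_mul_right hf1l _))
    rw [ENNReal.ofReal_le_ofReal_iff (by positivity)] at h3
    have h4 : 4 * 10 ^ 9 * (A0 / t) < lam := lt_of_le_of_lt (by nlinarith) hlam
    rw [← mul_div_assoc, div_lt_iff₀ ht] at h4
    nlinarith
  have L1 := ae_LI hT hf1 1 (Or.inl rfl) (by
    simp only [pow_one]; exact ne_top_of_le_ne_top ENNReal.ofReal_ne_top hf1l)
  have L2 := ae_LI hT hf2 1 (Or.inl rfl) (by simpa only [pow_one] using hf2l)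
  calc dst μ (hI T f a b) lam ≤ μ ({x | lam / 2 < |hI T f1 a b x|} ∪ {x | lam / 2 < |hI T f2 a b x|}) := by
        refine measure_mono_ae ?_
        filter_upwards [L1, L2] with x h1 h2 hx
        have hx' : lam < |hI T f a b x| := hx
        have e := hI_add h1 h2 ha (ha.trans hab)
        have e2 : (fun y => f1 y + f2 y) = f := by funext y; simp [hf1d]
        rw [e2] at e
        by_contra hc
        have hc1 : ¬ lam / 2 < |hI T f1 a b x| := fun h => hc (Or.inl h)
        have hc2 : ¬ lam / 2 < |hI T f2 a b x| := fun h => hc (Or.inr h)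
        have := abs_add_le (hI T f1 a b x) (hI T f2 a b x)
        rw [← e] at this
        linarith
    _ ≤ dst μ (hI T f1 a b) (lam / 2) + dst μ (hI T f2 a b) (lam / 2) := measure_union_le _ _
    _ ≤ ENNReal.ofReal (t / 2) + ENNReal.ofReal (t / 2) := add_le_add p1 p2
    _ = ENNReal.ofReal t := by
        rw [← ENNReal.ofReal_add (by positivity) (by positivity)]; congr 1; ring
end

section
variable {X : Type*} [MeasurableSpace X] {μ : Measure X} {T : ℝ → X → X}

lemma rearrange_congr {f g : X → ℝ} (h : f =ᵐ[μ] g) : rearrange μ f = rearrange μ g := by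
  funext t
  unfold rearrange
  congr 1
  ext s
  have : μ {x | s < |f x|} = μ {x | s < |g x|} := by
    refine measure_congr ?_
    filter_upwards [h] with x hx
    change (s < |f x|) = (s < |g x|)
    rw [hx]
  rw [Set.mem_ofPred_eq, Set.mem_ofPred_eq, this]

lemma doubleStar_congr {f g : X → ℝ} (h : f =ᵐ[μ] g) : doubleStar μ f = doubleStar μ g := by
  funext t
  unfold doubleStar
  rw [rearrange_congr h]

lemma ergHilbert_congr [SigmaFinite μ] (hT : ErgodicFlow X μ T) {f g : X → ℝ} (h : f =ᵐ[μ] g) :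
    ergHilbert T f =ᵐ[μ] ergHilbert T g := by
  filter_upwards [ae_orbit hT h] with x hx
  unfold ergHilbert
  congr 1
  funext δ
  refine integral_congr_ae (ae_restrict_of_ae ?_)
  filter_upwards [hx] with τ hτ
  rw [hτ]

lemma rr_zero (f : X → ℝ) {s : ℝ} (h : μ univ ≤ ENNReal.ofReal s) : rearrange μ f s = 0 := by
  refine le_antisymm ?_ (rr_nonneg f s)
  by_contra hc
  push Not at hc
  have := rr_lt le_rfl hc
  exact absurd (this.trans_le ((measure_mono (subset_univ _)).trans h)) (lt_irrefl _)

lemma final_meas [SigmaFinite μ] (hT : ErgodicFlow X μ T) {f : X → ℝ} (hf : Measurable f)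
    (hfi : ∫⁻ x, ENNReal.ofReal |f x| ∂μ ≠ ∞) {t : ℝ} (ht : 0 < t) :
    rearrange μ (ergHilbert T f) t ≤
      4 * 10 ^ 9 * (doubleStar μ f t +
        ∫ s in {s : ℝ | t < s ∧ ENNReal.ofReal s < μ univ}, rearrange μ f s / s) := by
  set A0 : ℝ := ∫ s in Ioo (0 : ℝ) t, rearrange μ f s with hA0d
  set B0 : ℝ := ∫ s in {s : ℝ | t < s ∧ ENNReal.ofReal s < μ univ}, rearrange μ f s / s with hB0d
  have hds : doubleStar μ f t = A0 / t := by unfold doubleStar; rw [← hA0d]; ring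
  rw [hds]
  have hA0 : 0 ≤ A0 := integral_nonneg fun s => rr_nonneg f s
  have hmR : AEMeasurable (rearrange μ f) (volume.restrict (Ioi 0)) :=
    aemeasurable_restrict_of_antitoneOn measurableSet_Ioi (rr_anti hf hfi)
  have htot := rr_total hf hfi
  have hiR : IntegrableOn (rearrange μ f) (Ioi 0) := by
    refine ⟨hmR.aestronglyMeasurable, ?_⟩
    rw [hasFiniteIntegral_iff_ofReal (Eventually.of_forall fun s => rr_nonneg f s), htot]
    exact lt_top_iff_ne_top.2 hfi
  have hA : ∫⁻ s in Ioo 0 t, ENNReal.ofReal (rearrange μ f s) = ENNReal.ofReal A0 :=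
    (ofReal_integral_eq_lintegral_ofReal (hiR.mono_set Ioo_subset_Ioi_self)
      (Eventually.of_forall fun s => rr_nonneg f s)).symm
  have hmt : AEMeasurable (fun s => rearrange μ f s / s) (volume.restrict (Ioi t)) :=
    (hmR.mono_set (Ioi_subset_Ioi ht.le)).div measurable_id.aemeasurable
  have hnn : 0 ≤ᵐ[volume.restrict (Ioi t)] fun s => rearrange μ f s / s := by
    filter_upwards [ae_restrict_mem measurableSet_Ioi] with s hs
    exact div_nonneg (rr_nonneg f s) (ht.le.trans (le_of_lt hs))
  have hiB : IntegrableOn (fun s => rearrange μ f s / s) (Ioi t) := by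
    refine Integrable.mono' ((hiR.mono_set (Ioi_subset_Ioi ht.le)).div_const t)
      hmt.aestronglyMeasurable ?_
    filter_upwards [ae_restrict_mem measurableSet_Ioi, hnn] with s hs h2
    rw [Real.norm_of_nonneg h2]
    exact div_le_div_of_nonneg_left (rr_nonneg f s) ht (le_of_lt hs)
  have hB0e : B0 = ∫ s in Ioi t, rearrange μ f s / s := by
    rw [hB0d]
    refine (setIntegral_eq_of_subset_of_forall_sdiff_eq_zero measurableSet_Ioi
      (fun s hs => hs.1) fun s hs => ?_).symm
    have : μ univ ≤ ENNReal.ofReal s := by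
      by_contra hc
      push Not at hc
      exact hs.2 ⟨hs.1, hc⟩
    rw [rr_zero f this, zero_div]
  have hB : ∫⁻ s in Ioi t, ENNReal.ofReal (rearrange μ f s / s) = ENNReal.ofReal B0 := by
    rw [hB0e]
    exact (ofReal_integral_eq_lintegral_ofReal hiB hnn).symm
  have hB0 : 0 ≤ B0 := by rw [hB0e]; exact integral_nonneg_of_ae hnn
  by_contra hc
  push Not at hc
  obtain ⟨lam, h1, h2⟩ := exists_between hc
  have hlam0 : 0 ≤ lam := le_trans (by positivity) h1.le
  have h3 := rr_lt hlam0 h2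
  refine absurd h3 (not_lt.2 ?_)
  let d : ℕ → ℝ := fun m => 1 / ((m : ℝ) + 2)
  have hd0 : ∀ m, 0 < d m := fun m => by positivity
  have hd1 : ∀ m, d m < 1 / d m := fun m => by
    have : (0:ℝ) ≤ m := Nat.cast_nonneg m
    simp only [d, one_div_one_div]
    rw [div_lt_iff₀ (by positivity)]
    nlinarith
  have hdt : Tendsto d atTop (𝓝[>] 0) := by
    refine tendsto_nhdsWithin_iff.2 ⟨?_, Eventually.of_forall hd0⟩
    have : Tendsto (fun m : ℕ => (m : ℝ) + 2) atTop atTop :=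
      tendsto_atTop_add_const_right _ _ tendsto_natCast_atTop_atTop
    simp only [d, one_div]
    exact this.inv_tendsto_atTop
  have hm : ∀ m, dst μ (hI T f (d m) (1 / d m)) lam ≤ ENNReal.ofReal t := fun m =>
    main_K hT hf hfi ht (hd0 m) (hd1 m) hA0 hB0 hA hB h1
  let S : ℕ → Set X := fun n => ⋂ m ∈ Ici n, {x | lam < |hI T f (d m) (1 / d m) x|}
  have hS : Monotone S := fun n k hnk x hx => by
    simp only [S, mem_iInter, mem_Ici] at hx ⊢
    exact fun m hm => hx m (hnk.trans hm)
  calc dst μ (ergHilbert T f) lam ≤ μ (⋃ n, S n) := by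
        refine measure_mono_ae ?_
        filter_upwards [conv_ae hT hf hfi] with x hx hlx
        have hx' := (hx.comp hdt).abs
        have hev := hx'.eventually (lt_mem_nhds (show lam < |ergHilbert T f x| from hlx))
        obtain ⟨n, hn⟩ := eventually_atTop.1 hev
        change x ∈ ⋃ n, S n
        refine mem_iUnion.2 ⟨n, ?_⟩
        simp only [S, mem_iInter, mem_Ici]
        exact fun m hm => hn m hm
    _ = ⨆ n, μ (S n) := hS.measure_iUnion
    _ ≤ ENNReal.ofReal t := iSup_le fun n => le_trans (measure_mono fun x hx => by
        simp only [S, mem_iInter, mem_Ici] at hx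
        exact hx n le_rfl) (hm n)
end

/-- estimate (4.30).  There is an absolute constant `c > 0` such
that for every ergodic flow `(T_τ)` on a σ-finite measure space `(X,μ)` with
`ℓ = μ(X)` and every `f ∈ L¹(X,μ)`, the non-increasing rearrangement of the ergodic
Hilbert transform satisfies
`(Hf)*(t) ≤ c ((1/t)∫₀ᵗ f*(s) ds + ∫ₜ^ℓ f*(s)/s ds)` for all `0 < t < ℓ`. -/
theorem statement18 :
    ∃ c : ℝ, 0 < c ∧
      ∀ (X : Type) [MeasurableSpace X] (μ : Measure X) (T : ℝ → X → X),
        SigmaFinite μ → ErgodicFlow X μ T →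
        ∀ f : X → ℝ, Integrable f μ →
          ∀ t : ℝ, 0 < t → ENNReal.ofReal t < μ univ →
            rearrange μ (ergHilbert T f) t ≤
              c * (doubleStar μ f t +
                ∫ s in {s : ℝ | t < s ∧ ENNReal.ofReal s < μ univ},
                  rearrange μ f s / s) := by
  refine ⟨4 * 10 ^ 9, by norm_num, ?_⟩
  intro X _ μ T hσ hT f hf t ht _
  have hfe : f =ᵐ[μ] hf.1.mk f := hf.1.ae_eq_mk
  rw [rearrange_congr (ergHilbert_congr hT hfe), doubleStar_congr hfe, rearrange_congr hfe]
  refine final_meas hT hf.1.stronglyMeasurable_mk.measurable ?_ ht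
  have h2 := (hf.congr hfe).2
  rw [hasFiniteIntegral_iff_norm] at h2
  exact h2.ne

end
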